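/- For every n ≥ 4 there exists ε(n) > 0 such that any smooth solution u to the special Lagrangian equation ∑_{i=1}^n arctan λᵢ(x) = c on all of ℝⁿ whose Hessian eigenvalues satisfy λᵢ(x) ≥ −1/√3 − ε(n) for all i and all x ∈ ℝⁿ is a quadratic polynomial. -/

import Mathlib

noncomputable section

/-- The Hessian matrix `D²u(x)`, with entries `∂ᵢ∂ⱼ u (x)`. -/
def Hess {n : ℕ} (u : EuclideanSpace ℝ (Fin n) → ℝ) (x : EuclideanSpace ℝ (Fin n)) :
    Matrix (Fin n) (Fin n) ℝ :=
  Matrix.of fun i j =>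
    iteratedFDeriv ℝ 2 u x ![EuclideanSpace.single i 1, EuclideanSpace.single j 1]

/-- The induced metric `g = I + D²u · D²u` on the gradient graph `(x, ∇u(x))`. -/
def gMat {n : ℕ} (u : EuclideanSpace ℝ (Fin n) → ℝ) (x : EuclideanSpace ℝ (Fin n)) :
    Matrix (Fin n) (Fin n) ℝ :=
  1 + Hess u x * Hess u x

/-- The Laplace–Beltrami operator `Δ_g v = ∑ g^{ij} ∂ᵢ∂ⱼ v` of the induced metric. -/
def lapg {n : ℕ} (u v : EuclideanSpace ℝ (Fin n) → ℝ) (x : EuclideanSpace ℝ (Fin n)) : ℝ :=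
  ∑ i, ∑ j, (gMat u x)⁻¹ i j *
    iteratedFDeriv ℝ 2 v x ![EuclideanSpace.single i 1, EuclideanSpace.single j 1]

/-- The squared metric gradient norm `|∇_g v|²_g = ∑ g^{ij} ∂ᵢv ∂ⱼv`. -/
def gradSq {n : ℕ} (u v : EuclideanSpace ℝ (Fin n) → ℝ) (x : EuclideanSpace ℝ (Fin n)) : ℝ :=
  ∑ i, ∑ j, (gMat u x)⁻¹ i j * fderiv ℝ v x (EuclideanSpace.single i 1) *
    fderiv ℝ v x (EuclideanSpace.single j 1)

/-- The volume element `V = √(det g)`. -/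
def Vol {n : ℕ} (u : EuclideanSpace ℝ (Fin n) → ℝ) (x : EuclideanSpace ℝ (Fin n)) : ℝ :=
  Real.sqrt ((gMat u x).det)

end

section
set_option autoImplicit false
set_option linter.unusedVariables false
namespace SL
open Matrix MeasureTheory Filter Topology
open scoped ContDiff

variable {n : ℕ}

/-- `ℝⁿ` with the sup norm. -/
abbrev E (n : ℕ) := Fin n → ℝ

/-- Partial derivative. -/
noncomputable def pd (k : Fin n) (f : E n → ℝ) (x : E n) : ℝ := fderiv ℝ f x (Pi.single k 1)

/-- Smooth. -/
def Sm (f : E n → ℝ) : Prop := ContDiff ℝ ∞ f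

theorem Sm.diff {f : E n → ℝ} (h : Sm f) : Differentiable ℝ f := ContDiff.differentiable h (by simp)
theorem Sm.cont {f : E n → ℝ} (h : Sm f) : Continuous f := ContDiff.continuous h
theorem Sm.pd {f : E n → ℝ} (h : Sm f) (k : Fin n) : Sm (pd k f) := by
  unfold Sm SL.pd
  have := ContDiff.fderiv_right (m := ∞) h (by simp)
  exact this.clm_apply contDiff_const
theorem Sm.const (c : ℝ) : Sm (fun _ : E n => c) := contDiff_const
theorem Sm.coord (i : Fin n) : Sm (fun x : E n => x i) := contDiff_apply ℝ ℝ i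
theorem Sm.add {f g : E n → ℝ} (hf : Sm f) (hg : Sm g) : Sm (fun x => f x + g x) := ContDiff.add hf hg
theorem Sm.sub {f g : E n → ℝ} (hf : Sm f) (hg : Sm g) : Sm (fun x => f x - g x) := ContDiff.sub hf hg
theorem Sm.neg {f : E n → ℝ} (hf : Sm f) : Sm (fun x => - f x) := ContDiff.neg hf
theorem Sm.mul {f g : E n → ℝ} (hf : Sm f) (hg : Sm g) : Sm (fun x => f x * g x) := ContDiff.mul hf hg
theorem Sm.pow {f : E n → ℝ} (hf : Sm f) (k : ℕ) : Sm (fun x => f x ^ k) := ContDiff.pow hf k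
theorem Sm.sum {ι : Type*} {s : Finset ι} {f : ι → E n → ℝ} (hf : ∀ i, Sm (f i)) :
    Sm (fun x => ∑ i ∈ s, f i x) := ContDiff.sum (fun i _ => hf i)
theorem Sm.prod {ι : Type*} {s : Finset ι} {f : ι → E n → ℝ} (hf : ∀ i, Sm (f i)) :
    Sm (fun x => ∏ i ∈ s, f i x) := contDiff_prod (fun i _ => hf i)

theorem pd_const (k : Fin n) (c : ℝ) (x : E n) : pd k (fun _ => c) x = 0 := by simp [pd]
theorem pd_coord (k i : Fin n) (x : E n) : pd k (fun y => y i) x = if i = k then 1 else 0 := by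
  unfold pd
  have : HasFDerivAt (fun y : E n => y i) (ContinuousLinearMap.proj (R := ℝ) i) x :=
    (ContinuousLinearMap.proj (R := ℝ) (φ := fun _ : Fin n => ℝ) i).hasFDerivAt
  rw [this.fderiv]
  simp [Pi.single_apply]
theorem pd_add {f g : E n → ℝ} {x : E n} (k : Fin n) (hf : DifferentiableAt ℝ f x)
    (hg : DifferentiableAt ℝ g x) : pd k (fun x => f x + g x) x = pd k f x + pd k g x := by
  unfold pd; rw [fderiv_fun_add hf hg]; rfl
theorem pd_sub {f g : E n → ℝ} {x : E n} (k : Fin n) (hf : DifferentiableAt ℝ f x)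
    (hg : DifferentiableAt ℝ g x) : pd k (fun x => f x - g x) x = pd k f x - pd k g x := by
  unfold pd; rw [fderiv_fun_sub hf hg]; rfl
theorem pd_neg {f : E n → ℝ} {x : E n} (k : Fin n) : pd k (fun x => - f x) x = - pd k f x := by
  unfold pd; rw [fderiv_fun_neg]; rfl
theorem pd_mul {f g : E n → ℝ} {x : E n} (k : Fin n) (hf : DifferentiableAt ℝ f x)
    (hg : DifferentiableAt ℝ g x) : pd k (fun x => f x * g x) x = pd k f x * g x + f x * pd k g x := by
  unfold pd; rw [fderiv_fun_mul hf hg]; simp; ring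
theorem pd_sum {ι : Type*} {s : Finset ι} {f : ι → E n → ℝ} {x : E n} (k : Fin n)
    (hf : ∀ i, DifferentiableAt ℝ (f i) x) :
    pd k (fun x => ∑ i ∈ s, f i x) x = ∑ i ∈ s, pd k (f i) x := by
  unfold pd; rw [fderiv_fun_sum (fun i _ => hf i)]; simp
theorem pd_comp {f : E n → ℝ} {x : E n} (k : Fin n) {φ : ℝ → ℝ} {φ' : ℝ} (hφ : HasDerivAt φ φ' (f x))
    (hf : DifferentiableAt ℝ f x) : pd k (fun x => φ (f x)) x = φ' * pd k f x := by
  unfold pd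
  have := hφ.comp_hasFDerivAt x hf.hasFDerivAt
  rw [show (fun x => φ (f x)) = φ ∘ f from rfl, this.fderiv]; simp

theorem pd_comm {f : E n → ℝ} (hf : Sm f) (j k : Fin n) (x : E n) :
    pd j (pd k f) x = pd k (pd j f) x := by
  have h2 : ∀ a b : Fin n, pd a (pd b f) x
      = fderiv ℝ (fderiv ℝ f) x (Pi.single a 1) (Pi.single b 1) := by
    intro a b
    have hd : DifferentiableAt ℝ (fderiv ℝ f) x :=
      ((ContDiff.fderiv_right (m := ∞) hf (by simp)).differentiable (by simp)) x
    unfold pd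
    rw [fderiv_clm_apply hd (differentiableAt_const _)]
    simp
  rw [h2, h2]
  exact (ContDiff.contDiffAt hf).isSymmSndFDerivAt
    (by rw [minSmoothness_of_isRCLikeNormedField]; exact WithTop.coe_le_coe.2 le_top) _ _

theorem integral_pd_zero {f : E n → ℝ} (hf : ContDiff ℝ 1 f) (hc : HasCompactSupport f) (k : Fin n) :
    ∫ x, pd k f x = 0 := by
  have h1 : Continuous (fun x => fderiv ℝ f x (Pi.single k 1)) :=
    (hf.continuous_fderiv (by simp)).clm_apply continuous_const
  have h2 : HasCompactSupport (fun x => fderiv ℝ f x (Pi.single k 1)) :=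
    hc.fderiv_apply ℝ _
  have := integral_mul_fderiv_eq_neg_fderiv_mul_of_integrable (μ := (volume : Measure (E n)))
    (f := fun _ : E n => (1:ℝ)) (g := f) (v := Pi.single k 1) (by simp)
    (by simpa using h1.integrable_of_hasCompactSupport h2)
    (by simpa using hf.continuous.integrable_of_hasCompactSupport hc)
    (fun x _ => differentiableAt_const _) (fun x _ => hf.differentiable (by simp) x)
  simpa [pd] using this

/-- Matrix valued smoothness. -/
def SmM (M : E n → Matrix (Fin n) (Fin n) ℝ) : Prop := ∀ i j, Sm (fun x => M x i j)

/-- Entrywise partial derivative of a matrix valued function. -/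
noncomputable def pdM (k : Fin n) (M : E n → Matrix (Fin n) (Fin n) ℝ) (x : E n) : Matrix (Fin n) (Fin n) ℝ :=
  Matrix.of fun i j => pd k (fun y => M y i j) x

theorem pdM_apply (k : Fin n) (M : E n → Matrix (Fin n) (Fin n) ℝ) (x : E n) (i j : Fin n) :
    pdM k M x i j = pd k (fun y => M y i j) x := rfl

theorem SmM.pdM {M : E n → Matrix (Fin n) (Fin n) ℝ} (h : SmM M) (k : Fin n) : SmM (pdM k M) :=
  fun i j => (h i j).pd k
theorem SmM.add {M N : E n → Matrix (Fin n) (Fin n) ℝ} (h : SmM M) (h' : SmM N) :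
    SmM (fun x => M x + N x) := fun i j => (h i j).add (h' i j)
theorem SmM.sub {M N : E n → Matrix (Fin n) (Fin n) ℝ} (h : SmM M) (h' : SmM N) :
    SmM (fun x => M x - N x) := fun i j => (h i j).sub (h' i j)
theorem SmM.neg {M : E n → Matrix (Fin n) (Fin n) ℝ} (h : SmM M) :
    SmM (fun x => - M x) := fun i j => (h i j).neg
theorem SmM.const (A : Matrix (Fin n) (Fin n) ℝ) : SmM (fun _ : E n => A) := fun _ _ => Sm.const _
theorem SmM.mul {M N : E n → Matrix (Fin n) (Fin n) ℝ} (h : SmM M) (h' : SmM N) :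
    SmM (fun x => M x * N x) := fun i j => by
  simp only [Matrix.mul_apply]
  exact Sm.sum fun l => (h i l).mul (h' l j)
theorem SmM.trace {M : E n → Matrix (Fin n) (Fin n) ℝ} (h : SmM M) :
    Sm (fun x => (M x).trace) := by
  simp only [Matrix.trace, Matrix.diag]
  exact Sm.sum fun l => h l l
theorem SmM.det {M : E n → Matrix (Fin n) (Fin n) ℝ} (h : SmM M) :
    Sm (fun x => (M x).det) := by
  simp only [Matrix.det_apply']
  exact Sm.sum fun σ => (Sm.const _).mul (Sm.prod fun i => h _ _)
theorem SmM.adjugate {M : E n → Matrix (Fin n) (Fin n) ℝ} (h : SmM M) :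
    SmM (fun x => (M x).adjugate) := fun i j => by
  simp only [Matrix.adjugate_apply]
  refine SmM.det fun a b => ?_
  by_cases ha : a = j
  · subst ha; simp only [Matrix.updateRow_self]; exact Sm.const _
  · simp only [Matrix.updateRow_ne ha]; exact h a b

theorem pdM_mul {M N : E n → Matrix (Fin n) (Fin n) ℝ} (h : SmM M) (h' : SmM N) (k : Fin n) (x : E n) :
    pdM k (fun x => M x * N x) x = pdM k M x * N x + M x * pdM k N x := by
  ext i j
  simp only [pdM_apply, Matrix.mul_apply, Matrix.add_apply]
  rw [pd_sum k (fun l => ((h i l).mul (h' l j)).diff x), ← Finset.sum_add_distrib]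
  exact Finset.sum_congr rfl fun l _ => pd_mul k ((h i l).diff x) ((h' l j).diff x)
theorem pdM_add {M N : E n → Matrix (Fin n) (Fin n) ℝ} (h : SmM M) (h' : SmM N) (k : Fin n) (x : E n) :
    pdM k (fun x => M x + N x) x = pdM k M x + pdM k N x := by
  ext i j
  exact pd_add k ((h i j).diff x) ((h' i j).diff x)
theorem pdM_neg {M : E n → Matrix (Fin n) (Fin n) ℝ} (k : Fin n) (x : E n) :
    pdM k (fun x => - M x) x = - pdM k M x := by
  ext i j
  exact pd_neg k
theorem pdM_const (A : Matrix (Fin n) (Fin n) ℝ) (k : Fin n) (x : E n) :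
    pdM k (fun _ => A) x = 0 := by
  ext i j
  exact pd_const k _ x
theorem pd_trace {M : E n → Matrix (Fin n) (Fin n) ℝ} (h : SmM M) (k : Fin n) (x : E n) :
    pd k (fun x => (M x).trace) x = (pdM k M x).trace := by
  simp only [Matrix.trace, Matrix.diag]
  exact pd_sum k (fun l => (h l l).diff x)

theorem hasDerivAt_line {f : E n → ℝ} {x : E n} (hf : DifferentiableAt ℝ f x) (k : Fin n) :
    HasDerivAt (fun s : ℝ => f (x + s • (Pi.single k 1 : E n))) (pd k f x) 0 := by
  have h1 : HasDerivAt (fun s : ℝ => x + s • (Pi.single k 1 : E n)) (Pi.single k 1 : E n) 0 := by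
    simpa using ((hasDerivAt_id (0:ℝ)).smul_const (Pi.single k 1 : E n)).const_add x
  have h2 : HasFDerivAt f (fderiv ℝ f x) (x + (0:ℝ) • (Pi.single k 1 : E n)) := by
    simpa using hf.hasFDerivAt
  exact h2.comp_hasDerivAt (0:ℝ) h1

/-- Jacobi's formula. -/
theorem hasFDerivAt_det (M : Matrix (Fin n) (Fin n) ℂ) :
    ∃ L : (Fin n → Fin n → ℂ) →L[ℂ] ℂ,
      HasFDerivAt (fun A : Fin n → Fin n → ℂ => Matrix.det (Matrix.of A)) L (fun i j => M i j) ∧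
      ∀ N : Matrix (Fin n) (Fin n) ℂ, L (fun i j => N i j) = (M.adjugate * N).trace := by
  have hcont : Continuous fun A : Fin n → Fin n → ℂ => Matrix.det (Matrix.of A) := by
    exact Continuous.matrix_det (continuous_id)
  let f : ContinuousMultilinearMap ℂ (fun _ : Fin n => Fin n → ℂ) ℂ :=
    ⟨Matrix.detRowAlternating.toMultilinearMap, hcont⟩
  refine ⟨f.linearDeriv (fun i j => M i j), f.hasFDerivAt _, fun N => ?_⟩
  rw [ContinuousMultilinearMap.linearDeriv_apply]
  have : ∀ i, f (Function.update (fun i j => M i j) i (fun j => N i j)) = ∑ j, M.adjugate j i * N i j := by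
    intro i
    change Matrix.det (M.updateRow i (N i)) = _
    rw [← Matrix.cramer_transpose_apply, Matrix.cramer_eq_adjugate_mulVec, ← Matrix.adjugate_transpose]
    simp [Matrix.mulVec, dotProduct]
  simp only [this, Matrix.trace, Matrix.diag, Matrix.mul_apply]
  rw [Finset.sum_comm]

end SL
end

section
set_option autoImplicit false
set_option linter.unusedVariables false
namespace SL
open Matrix MeasureTheory Filter Topology
open scoped ContDiff

variable {n : ℕ}

abbrev Mt (n : ℕ) := Matrix (Fin n) (Fin n) ℝ

def gM (p : Mt n) : Mt n := 1 + p * p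
noncomputable def Rm (p : Mt n) : Mt n := ((gM p).det)⁻¹ • (gM p).adjugate
noncomputable def Qm (p : Mt n) : Mt n := p * Rm p
noncomputable def Vd (p : Mt n) : ℝ := Real.sqrt ((gM p).det)

theorem gM_posDef {p : Mt n} (hp : p.IsSymm) : (gM p).PosDef := by
  unfold gM
  refine Matrix.PosDef.add_posSemidef Matrix.PosDef.one ?_
  have := Matrix.posSemidef_conjTranspose_mul_self p
  rwa [Matrix.conjTranspose_eq_transpose_of_trivial, hp.eq] at this

theorem gM_det_pos {p : Mt n} (hp : p.IsSymm) : 0 < (gM p).det := (gM_posDef hp).det_pos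
theorem Vd_pos {p : Mt n} (hp : p.IsSymm) : 0 < Vd p := Real.sqrt_pos.2 (gM_det_pos hp)

theorem gM_symm {p : Mt n} (hp : p.IsSymm) : (gM p).IsSymm := by
  unfold gM Matrix.IsSymm
  rw [Matrix.transpose_add, Matrix.transpose_mul, hp.eq, Matrix.transpose_one]
theorem Rm_symm {p : Mt n} (hp : p.IsSymm) : (Rm p).IsSymm := by
  unfold Rm
  exact (gM_symm hp).adjugate.smul _
theorem Rm_mul_gM {p : Mt n} (hp : p.IsSymm) : Rm p * gM p = 1 := by
  unfold Rm
  rw [Matrix.smul_mul, Matrix.adjugate_mul, smul_smul, inv_mul_cancel₀ (gM_det_pos hp).ne', one_smul]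
theorem gM_mul_Rm {p : Mt n} (hp : p.IsSymm) : gM p * Rm p = 1 := by
  unfold Rm
  rw [Matrix.mul_smul, Matrix.mul_adjugate, smul_smul, inv_mul_cancel₀ (gM_det_pos hp).ne', one_smul]
theorem p_gM (p : Mt n) : p * gM p = gM p * p := by
  unfold gM; noncomm_ring
theorem p_Rm {p : Mt n} (hp : p.IsSymm) : p * Rm p = Rm p * p := by
  calc p * Rm p = (Rm p * gM p) * (p * Rm p) := by rw [Rm_mul_gM hp, one_mul]
    _ = Rm p * (gM p * p) * Rm p := by noncomm_ring
    _ = Rm p * p * (gM p * Rm p) := by rw [← p_gM]; noncomm_ring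
    _ = _ := by rw [gM_mul_Rm hp, mul_one]
theorem Qm_symm {p : Mt n} (hp : p.IsSymm) : (Qm p).IsSymm := by
  unfold Qm Matrix.IsSymm
  rw [Matrix.transpose_mul, hp.eq, (Rm_symm hp).eq, p_Rm hp]
theorem Rm_add {p : Mt n} (hp : p.IsSymm) : Rm p + Qm p * p = 1 := by
  have := Rm_mul_gM hp
  rw [gM, mul_add, mul_one, ← mul_assoc, ← p_Rm hp] at this
  exact this

theorem SmM.gM {M : E n → Mt n} (h : SmM M) : SmM (fun x => gM (M x)) :=
  (SmM.const 1).add (h.mul h)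
theorem SmM.Rm {M : E n → Mt n} (h : SmM M) (hs : ∀ x, (M x).IsSymm) : SmM (fun x => Rm (M x)) := by
  intro i j
  simp only [SL.Rm, Matrix.smul_apply, smul_eq_mul]
  have hd : Sm (fun x => (SL.gM (M x)).det) := h.gM.det
  exact Sm.mul (ContDiff.inv hd fun x => (gM_det_pos (hs x)).ne') (h.gM.adjugate i j)
theorem SmM.Qm {M : E n → Mt n} (h : SmM M) (hs : ∀ x, (M x).IsSymm) : SmM (fun x => Qm (M x)) :=
  h.mul (h.Rm hs)
theorem SmM.Vd {M : E n → Mt n} (h : SmM M) (hs : ∀ x, (M x).IsSymm) : Sm (fun x => Vd (M x)) := by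
  have hd : Sm (fun x => (SL.gM (M x)).det) := h.gM.det
  exact ContDiff.sqrt hd fun x => (gM_det_pos (hs x)).ne'

/-- gradient of `ν`. -/
noncomputable def Pm (ν : Fin n → E n → ℝ) (x : E n) : Mt n := Matrix.of fun i j => pd j (ν i) x
/-- third derivatives -/
noncomputable def Tm (ν : Fin n → E n → ℝ) (x : E n) (k : Fin n) : Mt n := pdM k (Pm ν) x

def SpecBd (c : ℝ) (p : Mt n) : Prop := ∀ v : Fin n → ℝ, |v ⬝ᵥ (p *ᵥ v)| ≤ c * (v ⬝ᵥ v)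

structure Sol (ν : Fin n → E n → ℝ) : Prop where
  sm : ∀ i, Sm (ν i)
  sym : ∀ x, (Pm ν x).IsSymm
  bd : ∀ x, SpecBd 2 (Pm ν x)
  phase : ∃ om : ℂ, ∀ x, om * (1 + Complex.I • (Pm ν x).map Complex.ofReal).det = (Vd (Pm ν x) : ℂ)

theorem Sol.smP {ν : Fin n → E n → ℝ} (h : Sol ν) : SmM (Pm ν) := fun i j => (h.sm i).pd j
theorem Sol.smT {ν : Fin n → E n → ℝ} (h : Sol ν) (k : Fin n) : SmM (fun x => Tm ν x k) := h.smP.pdM k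
theorem Sol.smR {ν : Fin n → E n → ℝ} (h : Sol ν) : SmM (fun x => Rm (Pm ν x)) := h.smP.Rm h.sym
theorem Sol.smQ {ν : Fin n → E n → ℝ} (h : Sol ν) : SmM (fun x => Qm (Pm ν x)) := h.smP.Qm h.sym
theorem Sol.smV {ν : Fin n → E n → ℝ} (h : Sol ν) : Sm (fun x => Vd (Pm ν x)) := h.smP.Vd h.sym

/-- total symmetry of a 3-tensor -/
def TS (T : Fin n → Mt n) : Prop := (∀ k i j, T k i j = T k j i) ∧ (∀ k i j, T k i j = T i k j)

theorem Sol.ts {ν : Fin n → E n → ℝ} (h : Sol ν) (x : E n) : TS (Tm ν x) := by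
  have h1 : ∀ k i j, Tm ν x k i j = Tm ν x k j i := by
    intro k i j
    change pd k (fun y => Pm ν y i j) x = pd k (fun y => Pm ν y j i) x
    congr 1; funext y; exact (h.sym y).apply j i
  have h2 : ∀ k i j, Tm ν x k i j = Tm ν x j i k := by
    intro k i j
    change pd k (pd j (ν i)) x = pd j (pd k (ν i)) x
    exact pd_comm (h.sm i) k j x
  exact ⟨h1, fun k i j => by rw [h1 k i j, h2 k j i, h1]⟩

theorem TS.symm {T : Fin n → Mt n} (h : TS T) (k : Fin n) : (T k).IsSymm := by
  ext i j; exact h.1 k j i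

theorem Sol.pdR {ν : Fin n → E n → ℝ} (h : Sol ν) (k : Fin n) (x : E n) :
    pdM k (fun y => Rm (Pm ν y)) x = -(Rm (Pm ν x) * Tm ν x k * Qm (Pm ν x) + Qm (Pm ν x) * Tm ν x k * Rm (Pm ν x)) := by
  have e : (fun y => Rm (Pm ν y) * gM (Pm ν y)) = fun _ => 1 := funext fun y => Rm_mul_gM (h.sym y)
  have h1 := pdM_mul h.smR h.smP.gM k x
  rw [e, pdM_const] at h1
  have h2 : pdM k (fun y => gM (Pm ν y)) x = Tm ν x k * Pm ν x + Pm ν x * Tm ν x k := by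
    unfold gM
    rw [pdM_add (SmM.const 1) (h.smP.mul h.smP), pdM_const, zero_add, pdM_mul h.smP h.smP]; rfl
  rw [h2] at h1
  have h3 := congrArg (· * Rm (Pm ν x)) h1
  simp only [zero_mul, add_mul, mul_assoc, gM_mul_Rm (h.sym x), mul_one] at h3
  have h4 := p_Rm (h.sym x)
  unfold Qm
  rw [eq_neg_iff_add_eq_zero, h3, mul_add]
  congr 1
  rw [h4]; simp only [mul_assoc]

theorem Sol.pdQ {ν : Fin n → E n → ℝ} (h : Sol ν) (k : Fin n) (x : E n) :
    pdM k (fun y => Qm (Pm ν y)) x = Rm (Pm ν x) * Tm ν x k * Rm (Pm ν x) - Qm (Pm ν x) * Tm ν x k * Qm (Pm ν x) := by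
  have h1 : pdM k (fun y => Qm (Pm ν y)) x = Tm ν x k * Rm (Pm ν x) + Pm ν x * pdM k (fun y => Rm (Pm ν y)) x :=
    pdM_mul h.smP h.smR k x
  have h2 : Pm ν x * Qm (Pm ν x) = 1 - Rm (Pm ν x) := by
    rw [eq_sub_iff_add_eq', ← Rm_add (h.sym x)]
    congr 1
    unfold Qm; rw [p_Rm (h.sym x), ← mul_assoc, p_Rm (h.sym x)]
  rw [h1, h.pdR]
  have h3 : Pm ν x * -(Rm (Pm ν x) * Tm ν x k * Qm (Pm ν x) + Qm (Pm ν x) * Tm ν x k * Rm (Pm ν x)) =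
    -(Qm (Pm ν x) * Tm ν x k * Qm (Pm ν x)) - (Pm ν x * Qm (Pm ν x)) * Tm ν x k * Rm (Pm ν x) := by
    nth_rewrite 3 [Qm]
    noncomm_ring
  rw [h3, h2]
  noncomm_ring

theorem Sol.phase' {ν : Fin n → E n → ℝ} (h : Sol ν) (k : Fin n) (x : E n) :
    (Rm (Pm ν x) * Tm ν x k).trace = 0 ∧
    pd k (fun y => Vd (Pm ν y)) x = Vd (Pm ν x) * (Qm (Pm ν x) * Tm ν x k).trace := by
  obtain ⟨om, hom⟩ := h.phase
  set p := Pm ν x with hp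
  set T := Tm ν x k with hT
  set A : Matrix (Fin n) (Fin n) ℂ := 1 + Complex.I • p.map Complex.ofReal with hA
  have hmul : ∀ a b : Mt n, (a * b).map Complex.ofReal = a.map Complex.ofReal * b.map Complex.ofReal := by
    intro a b; exact Matrix.map_mul (f := Complex.ofRealHom)
  have hadd : ∀ a b : Mt n, (a + b).map Complex.ofReal = a.map Complex.ofReal + b.map Complex.ofReal := by
    intro a b; ext i j; simp
  have hone : (1 : Mt n).map Complex.ofReal = 1 := by
    ext i j; by_cases hij : i = j <;> simp [Matrix.one_apply, hij]
  have htr : ∀ a : Mt n, (a.map Complex.ofReal).trace = (a.trace : ℂ) := by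
    intro a; simp [Matrix.trace]
  have hinv : A * ((Rm p).map Complex.ofReal - Complex.I • (Qm p).map Complex.ofReal) = 1 := by
    have e1 : p.map Complex.ofReal * (Rm p).map Complex.ofReal = (Qm p).map Complex.ofReal := by
      rw [← hmul]; rfl
    have e2 : (Rm p).map Complex.ofReal + p.map Complex.ofReal * (Qm p).map Complex.ofReal = 1 := by
      rw [← hmul, ← hadd, ← hone]; congr 1
      rw [← Rm_add (h.sym x)]
      congr 1
      have := Qm_symm (h.sym x)
      unfold Qm
      rw [p_Rm (h.sym x), ← mul_assoc, p_Rm (h.sym x)]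
    rw [hA, add_mul, one_mul, mul_sub, Matrix.smul_mul, Matrix.smul_mul, Matrix.mul_smul, smul_smul, e1,
      Complex.I_mul_I, neg_one_smul, ← e2]
    abel
  have hadj : A.adjugate = A.det • ((Rm p).map Complex.ofReal - Complex.I • (Qm p).map Complex.ofReal) := by
    calc A.adjugate = A.adjugate * (A * ((Rm p).map Complex.ofReal - Complex.I • (Qm p).map Complex.ofReal)) := by
          rw [hinv, mul_one]
      _ = _ := by rw [← mul_assoc, Matrix.adjugate_mul, Matrix.smul_mul, one_mul]
  obtain ⟨L, hL, hL2⟩ := hasFDerivAt_det A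
  -- the curve
  have hc : HasDerivAt (fun s : ℝ => (fun i j => (1 + Complex.I • (Pm ν (x + s • (Pi.single k 1 : E n))).map Complex.ofReal : Matrix (Fin n) (Fin n) ℂ) i j))
      (fun i j => (Complex.I • T.map Complex.ofReal : Matrix (Fin n) (Fin n) ℂ) i j) 0 := by
    rw [hasDerivAt_pi]; intro i
    rw [hasDerivAt_pi]; intro j
    have := (hasDerivAt_line ((h.smP i j).diff x) k).ofReal_comp
    have := (this.const_mul Complex.I).const_add ((1 : Matrix (Fin n) (Fin n) ℂ) i j)
    simpa [hT, Tm, pdM_apply] using this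
  have hL' : HasFDerivAt (fun A : Fin n → Fin n → ℂ => Matrix.det (Matrix.of A)) (L.restrictScalars ℝ)
      ((fun s : ℝ => (fun i j => (1 + Complex.I • (Pm ν (x + s • (Pi.single k 1 : E n))).map Complex.ofReal : Matrix (Fin n) (Fin n) ℂ) i j)) 0) := by
    have := hL.restrictScalars ℝ
    simpa [hA] using this
  have hd := (hL'.comp_hasDerivAt (0:ℝ) hc).const_mul om
  have hV := (hasDerivAt_line (h.smV.diff x) k).ofReal_comp
  have he : (fun s : ℝ => om * ((fun A : Fin n → Fin n → ℂ => Matrix.det (Matrix.of A)) ∘ (fun s : ℝ => (fun i j => (1 + Complex.I • (Pm ν (x + s • (Pi.single k 1 : E n))).map Complex.ofReal : Matrix (Fin n) (Fin n) ℂ) i j))) s)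
     = fun s : ℝ => ((Vd (Pm ν (x + s • (Pi.single k 1 : E n))) : ℝ) : ℂ) := by
    funext s; exact hom _
  rw [he] at hd
  have key := hd.unique hV
  have e3 : (L.restrictScalars ℝ) (fun i j => (Complex.I • T.map Complex.ofReal : Matrix (Fin n) (Fin n) ℂ) i j)
      = A.det * (((Qm p * T).trace : ℂ) + Complex.I * ((Rm p * T).trace : ℂ)) := by
    change L _ = _
    rw [hL2, hadj, Matrix.smul_mul, Matrix.trace_smul, smul_eq_mul, Matrix.mul_smul, Matrix.sub_mul,
      Matrix.smul_mul, ← hmul, ← hmul, Matrix.trace_smul, Matrix.trace_sub, Matrix.trace_smul, htr, htr]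
    congr 1
    simp only [smul_eq_mul, mul_sub, ← mul_assoc, Complex.I_mul_I]; ring
  rw [e3, ← mul_assoc, hom x] at key
  have hre := congrArg Complex.re key
  have him := congrArg Complex.im key
  simp at hre him
  refine ⟨?_, ?_⟩
  · rcases him with h0 | h0
    · exact absurd h0 (Vd_pos (h.sym x)).ne'
    · exact h0
  · exact hre.symm

theorem TS.contr {T : Fin n → Mt n} (h : TS T) {A B : Mt n} (hA : A.IsSymm) (b : Fin n) :
    ∑ k, (A * T k * B) k b = ∑ j, (A * T j).trace * B j b := by
  have e1 : ∀ k, (A * T k * B) k b = ∑ j, ∑ i, A k i * T k i j * B j b := by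
    intro k
    simp only [Matrix.mul_apply, Finset.sum_mul]
  have e2 : ∀ j, (A * T j).trace * B j b = ∑ k, ∑ i, A k i * T k i j * B j b := by
    intro j
    simp only [Matrix.trace, Matrix.diag, Matrix.mul_apply, Finset.sum_mul]
    refine Finset.sum_congr rfl fun k _ => Finset.sum_congr rfl fun i _ => ?_
    rw [h.2 j i k, h.1 i j k, h.2 i k j]
  simp only [e1, e2]
  rw [Finset.sum_comm]

theorem Sol.D1 {ν : Fin n → E n → ℝ} (h : Sol ν) (b : Fin n) (x : E n) :
    ∑ k, pd k (fun y => Vd (Pm ν y) * Rm (Pm ν y) k b) x = 0 := by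
  have e : ∀ k, pd k (fun y => Vd (Pm ν y) * Rm (Pm ν y) k b) x =
      Vd (Pm ν x) * ((Qm (Pm ν x) * Tm ν x k).trace * Rm (Pm ν x) k b
       - (Rm (Pm ν x) * Tm ν x k * Qm (Pm ν x)) k b - (Qm (Pm ν x) * Tm ν x k * Rm (Pm ν x)) k b) := by
    intro k
    rw [pd_mul k (h.smV.diff x) ((h.smR k b).diff x), (h.phase' k x).2, ← pdM_apply k (fun y => Rm (Pm ν y)), h.pdR]
    simp only [Matrix.neg_apply, Matrix.add_apply]; ring
  simp only [e, ← Finset.mul_sum, Finset.sum_sub_distrib]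
  rw [(h.ts x).contr (Rm_symm (h.sym x)), (h.ts x).contr (Qm_symm (h.sym x))]
  simp [(h.phase' _ x).1]

theorem Sol.D2 {ν : Fin n → E n → ℝ} (h : Sol ν) (b : Fin n) (x : E n) :
    ∑ k, pd k (fun y => Vd (Pm ν y) * Qm (Pm ν y) k b) x = 0 := by
  have e : ∀ k, pd k (fun y => Vd (Pm ν y) * Qm (Pm ν y) k b) x =
      Vd (Pm ν x) * ((Qm (Pm ν x) * Tm ν x k).trace * Qm (Pm ν x) k b
       + (Rm (Pm ν x) * Tm ν x k * Rm (Pm ν x)) k b - (Qm (Pm ν x) * Tm ν x k * Qm (Pm ν x)) k b) := by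
    intro k
    rw [pd_mul k (h.smV.diff x) ((h.smQ k b).diff x), (h.phase' k x).2, ← pdM_apply k (fun y => Qm (Pm ν y)), h.pdQ]
    simp only [Matrix.sub_apply]; ring
  simp only [e, ← Finset.mul_sum, Finset.sum_sub_distrib, Finset.sum_add_distrib]
  rw [(h.ts x).contr (Rm_symm (h.sym x)), (h.ts x).contr (Qm_symm (h.sym x))]
  simp [(h.phase' _ x).1]

end SL
end

section
set_option autoImplicit false
set_option linter.unusedVariables false
set_option linter.unusedSimpArgs false
namespace SL
open Matrix MeasureTheory Filter Topology
open scoped ContDiff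

variable {n : ℕ}

noncomputable def CC (A B D : Mt n) (T : Fin n → Mt n) : ℝ :=
  ∑ k, ∑ b, A k b * (B * T k * D * T b).trace
noncomputable def F0 (p : Mt n) (T : Fin n → Mt n) : ℝ :=
  CC (Rm p) (Rm p) (Rm p) T - CC (Rm p) (Qm p) (Qm p) T + CC (Qm p) (Rm p) (Qm p) T
    + CC (Qm p) (Qm p) (Rm p) T
noncomputable def F1 (p : Mt n) (T : Fin n → Mt n) : ℝ :=
  CC (Rm p) 1 1 T + CC p (Rm p) (Qm p) T + CC p (Qm p) (Rm p) T
noncomputable def Gf (p : Mt n) (T : Fin n → Mt n) : ℝ :=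
  CC 1 (Rm p) (Rm p) T - CC 1 (Qm p) (Qm p) T
noncomputable def Y2 (p : Mt n) (T : Fin n → Mt n) (k : Fin n) : ℝ :=
  (Qm p * T k).trace - ∑ b, Qm p k b * (T b).trace

theorem Sol.U_comm {ν : Fin n → E n → ℝ} (h : Sol ν) (x : E n) (a b i j : Fin n) :
    pd a (fun y => Tm ν y b i j) x = pd b (fun y => Tm ν y a i j) x :=
  pd_comm (h.smP i j) a b x

theorem Sol.U_sym {ν : Fin n → E n → ℝ} (h : Sol ν) (x : E n) (k b i j : Fin n) :
    pd k (fun y => Tm ν y b i j) x = pd j (fun y => Tm ν y i k b) x := by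
  have e1 : (fun y => Tm ν y b i j) = fun y => Tm ν y j b i := by
    funext y; rw [(h.ts y).1 b i j, (h.ts y).2 b j i]
  have e2 : (fun y => Tm ν y k b i) = fun y => Tm ν y i k b := by
    funext y; rw [(h.ts y).1 k b i, (h.ts y).2 k i b]
  rw [e1, h.U_comm, e2]

theorem Sol.divG {ν : Fin n → E n → ℝ} (h : Sol ν) {M : E n → Mt n} (hM : SmM M)
    (h0 : ∀ b x, ∑ k, pd k (fun y => Vd (Pm ν y) * M y k b) x = 0)
    {f : Fin n → E n → ℝ} (hf : ∀ b, Sm (f b)) (x : E n) :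
    ∑ k, pd k (fun y => Vd (Pm ν y) * ∑ b, M y k b * f b y) x
      = Vd (Pm ν x) * ∑ k, ∑ b, M x k b * pd k (f b) x := by
  have e : ∀ k, pd k (fun y => Vd (Pm ν y) * ∑ b, M y k b * f b y) x
      = ∑ b, (pd k (fun y => Vd (Pm ν y) * M y k b) x * f b x
         + Vd (Pm ν x) * (M x k b * pd k (f b) x)) := by
    intro k
    have e1 : (fun y => Vd (Pm ν y) * ∑ b, M y k b * f b y)
       = fun y => ∑ b, (Vd (Pm ν y) * M y k b) * f b y := by
      funext y; rw [Finset.mul_sum]; exact Finset.sum_congr rfl fun b _ => by ring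
    rw [e1, pd_sum k (fun b => ((h.smV.mul (hM k b)).mul (hf b)).diff x)]
    refine Finset.sum_congr rfl fun b _ => ?_
    rw [pd_mul k ((h.smV.mul (hM k b)).diff x) ((hf b).diff x)]; ring
  rw [Finset.sum_congr rfl fun k _ => e k]
  simp only [Finset.sum_add_distrib]
  rw [Finset.sum_comm]
  simp only [← Finset.sum_mul, h0, ← Finset.mul_sum]
  simp

theorem Sol.divR {ν : Fin n → E n → ℝ} (h : Sol ν)
    {f : Fin n → E n → ℝ} (hf : ∀ b, Sm (f b)) (x : E n) :
    ∑ k, pd k (fun y => Vd (Pm ν y) * ∑ b, Rm (Pm ν y) k b * f b y) x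
      = Vd (Pm ν x) * ∑ k, ∑ b, Rm (Pm ν x) k b * pd k (f b) x := h.divG h.smR h.D1 hf x

theorem trace_mul_eq (A B : Mt n) : (A * B).trace = ∑ i, ∑ j, A i j * B j i := by
  simp [Matrix.trace, Matrix.mul_apply]

theorem Sol.eqdiff {ν : Fin n → E n → ℝ} (h : Sol ν) (x : E n) (i j : Fin n) :
    ∑ k, ∑ b, Rm (Pm ν x) k b * pd k (fun y => Tm ν y b j i) x
      = - (pdM i (fun y => Rm (Pm ν y)) x * Tm ν x j).trace := by
  have e : (fun y => (Rm (Pm ν y) * Tm ν y j).trace) = fun _ => 0 := funext fun y => (h.phase' j y).1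
  have h1 := pd_trace (h.smR.mul (h.smT j)) i x
  rw [e, pd_const, pdM_mul h.smR (h.smT j), Matrix.trace_add] at h1
  rw [eq_neg_iff_add_eq_zero, h1, add_comm]
  congr 1
  rw [trace_mul_eq]
  refine Finset.sum_congr rfl fun k _ => Finset.sum_congr rfl fun b _ => ?_
  rw [h.U_sym, pdM_apply]
  congr 2
  funext y
  exact (h.ts y).1 _ _ _

theorem Sol.divB {ν : Fin n → E n → ℝ} (h : Sol ν) {B : E n → Mt n} (hB : SmM B) (x : E n) :
    ∑ k, pd k (fun y => Vd (Pm ν y) * ∑ b, Rm (Pm ν y) k b * (B y * Tm ν y b).trace) x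
      = Vd (Pm ν x) * (∑ k, ∑ b, Rm (Pm ν x) k b * (pdM k B x * Tm ν x b).trace
         - ∑ i, ∑ j, B x i j * (pdM i (fun y => Rm (Pm ν y)) x * Tm ν x j).trace) := by
  rw [h.divR (f := fun b y => (B y * Tm ν y b).trace) (fun b => (hB.mul (h.smT b)).trace)]
  congr 1
  have e : ∀ k b, pd k (fun y => (B y * Tm ν y b).trace) x
     = (pdM k B x * Tm ν x b).trace + ∑ i, ∑ j, B x i j * pd k (fun y => Tm ν y b j i) x := by
    intro k b
    rw [pd_trace (hB.mul (h.smT b)), pdM_mul hB (h.smT b), Matrix.trace_add]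
    congr 1
  simp only [e, mul_add, Finset.sum_add_distrib]
  rw [sub_eq_add_neg]
  congr 1
  simp only [← Finset.sum_neg_distrib]
  have e2 : ∀ i j, -(B x i j * (pdM i (fun y => Rm (Pm ν y)) x * Tm ν x j).trace)
     = ∑ k, ∑ b, B x i j * (Rm (Pm ν x) k b * pd k (fun y => Tm ν y b j i) x) := by
    intro i j
    rw [← mul_neg, ← h.eqdiff]
    simp only [Finset.mul_sum]
  simp only [e2, Finset.mul_sum]
  have swap : ∀ f : Fin n → Fin n → Fin n → Fin n → ℝ,
      ∑ k, ∑ b, ∑ i, ∑ j, f k b i j = ∑ i, ∑ j, ∑ k, ∑ b, f k b i j := by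
    intro f
    have s1 : ∀ k, ∑ b, ∑ i, ∑ j, f k b i j = ∑ i, ∑ j, ∑ b, f k b i j := fun k => by
      rw [Finset.sum_comm]
      exact Finset.sum_congr rfl fun i _ => Finset.sum_comm
    rw [Finset.sum_congr rfl fun k _ => s1 k, Finset.sum_comm]
    exact Finset.sum_congr rfl fun i _ => Finset.sum_comm
  rw [swap]
  refine Finset.sum_congr rfl fun i _ => Finset.sum_congr rfl fun j _ =>
    Finset.sum_congr rfl fun k _ => Finset.sum_congr rfl fun b _ => by ring

theorem Sol.divF0 {ν : Fin n → E n → ℝ} (h : Sol ν) (x : E n) :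
    ∑ k, pd k (fun y => Vd (Pm ν y) * ∑ b, Rm (Pm ν y) k b * (Qm (Pm ν y) * Tm ν y b).trace) x
      = Vd (Pm ν x) * F0 (Pm ν x) (Tm ν x) := by
  rw [h.divB h.smQ]
  congr 1
  unfold F0 CC
  simp only [h.pdR, h.pdQ, sub_mul, neg_mul, add_mul, Matrix.trace_sub, Matrix.trace_neg, Matrix.trace_add,
    mul_sub, mul_add, mul_neg, Finset.sum_sub_distrib, Finset.sum_add_distrib, Finset.sum_neg_distrib]
  ring

theorem Sol.divF1 {ν : Fin n → E n → ℝ} (h : Sol ν) (x : E n) :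
    ∑ k, pd k (fun y => Vd (Pm ν y) * ∑ b, Rm (Pm ν y) k b * (Pm ν y * Tm ν y b).trace) x
      = Vd (Pm ν x) * F1 (Pm ν x) (Tm ν x) := by
  rw [h.divB h.smP]
  congr 1
  have : ∀ k, pdM k (fun y => Pm ν y) x = Tm ν x k := fun k => rfl
  unfold F1 CC
  simp only [h.pdR, this, sub_mul, neg_mul, add_mul, Matrix.trace_sub, Matrix.trace_neg, Matrix.trace_add,
    mul_sub, mul_add, mul_neg, Finset.sum_sub_distrib, Finset.sum_add_distrib, Finset.sum_neg_distrib, one_mul, mul_one]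
  ring

theorem Sol.smTQ {ν : Fin n → E n → ℝ} (h : Sol ν) (b : Fin n) : Sm (fun y => (Qm (Pm ν y) * Tm ν y b).trace) :=
  (h.smQ.mul (h.smT b)).trace
theorem Sol.smY {ν : Fin n → E n → ℝ} (h : Sol ν) (k : Fin n) : Sm (fun y => Y2 (Pm ν y) (Tm ν y) k) :=
  (h.smTQ k).sub (Sm.sum fun b => (h.smQ k b).mul (h.smT b).trace)

theorem Sol.divF2 {ν : Fin n → E n → ℝ} (h : Sol ν) (x : E n) :
    ∑ k, pd k (fun y => Vd (Pm ν y) * Y2 (Pm ν y) (Tm ν y) k) x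
      = Vd (Pm ν x) * (Gf (Pm ν x) (Tm ν x) + ∑ k, (Qm (Pm ν x) * Tm ν x k).trace ^ 2) := by
  have e : ∀ k, pd k (fun y => Vd (Pm ν y) * Y2 (Pm ν y) (Tm ν y) k) x
    = pd k (fun y => Vd (Pm ν y) * (Qm (Pm ν y) * Tm ν y k).trace) x
     - pd k (fun y => Vd (Pm ν y) * ∑ b, Qm (Pm ν y) k b * (Tm ν y b).trace) x := by
    intro k
    rw [← pd_sub k ((h.smV.mul (h.smTQ k)).diff x)
       ((h.smV.mul (Sm.sum fun b => (h.smQ k b).mul (h.smT b).trace)).diff x)]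
    congr 1; funext y; simp only [Y2]; ring
  simp only [e, Finset.sum_sub_distrib]
  rw [h.divG h.smQ h.D2 (f := fun b y => (Tm ν y b).trace) (fun b => (h.smT b).trace)]
  have e2 : ∀ k, pd k (fun y => Vd (Pm ν y) * (Qm (Pm ν y) * Tm ν y k).trace) x
    = Vd (Pm ν x) * ((Qm (Pm ν x) * Tm ν x k).trace ^ 2 + ((Rm (Pm ν x) * Tm ν x k * Rm (Pm ν x) * Tm ν x k).trace
       - (Qm (Pm ν x) * Tm ν x k * Qm (Pm ν x) * Tm ν x k).trace)
       + ∑ i, ∑ j, Qm (Pm ν x) i j * pd k (fun y => Tm ν y k j i) x) := by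
    intro k
    rw [pd_mul k (h.smV.diff x) ((h.smTQ k).diff x), (h.phase' k x).2, pd_trace (h.smQ.mul (h.smT k)),
      pdM_mul h.smQ (h.smT k), Matrix.trace_add, h.pdQ, sub_mul, Matrix.trace_sub, trace_mul_eq _ (pdM _ _ _)]
    simp only [pdM_apply]
    ring
  have e3 : ∀ k b, pd k (fun y => (Tm ν y b).trace) x = ∑ i, pd i (fun y => Tm ν y i b k) x := by
    intro k b
    rw [pd_trace (h.smT b)]
    simp only [Matrix.trace, Matrix.diag, pdM_apply]
    refine Finset.sum_congr rfl fun i _ => ?_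
    rw [h.U_sym]
    congr 1; funext y; exact ((h.ts y).1 _ _ _)
  simp only [e2, e3]
  have eG : Gf (Pm ν x) (Tm ν x) = ∑ k, ((Rm (Pm ν x) * Tm ν x k * Rm (Pm ν x) * Tm ν x k).trace
       - (Qm (Pm ν x) * Tm ν x k * Qm (Pm ν x) * Tm ν x k).trace) := by
    simp [Gf, CC, Matrix.one_apply]
  rw [eG, ← Finset.mul_sum, ← mul_sub]
  congr 1
  simp only [Finset.sum_add_distrib]
  have e4 : ∑ k, ∑ i, ∑ j, Qm (Pm ν x) i j * pd k (fun y => Tm ν y k j i) x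
     = ∑ k, ∑ b, Qm (Pm ν x) k b * ∑ i, pd i (fun y => Tm ν y i b k) x := by
    rw [Finset.sum_comm]
    refine Finset.sum_congr rfl fun i _ => ?_
    rw [Finset.sum_comm]
    simp only [Finset.mul_sum]
  rw [e4]; ring

end SL
end

section
set_option autoImplicit false
set_option linter.unusedVariables false
set_option linter.unusedSimpArgs false
namespace SL
open Matrix MeasureTheory Filter Topology
open scoped ContDiff

variable {n : ℕ}

theorem sum3_rot {T : Fin n → Mt n} (h : TS T) (g : Fin n → Fin n → Fin n → ℝ) :
    ∑ k, ∑ i, ∑ j, g k i j * T k i j ^ 2 = ∑ k, ∑ i, ∑ j, g i j k * T k i j ^ 2 := by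
  have e : ∑ k, ∑ i, ∑ j, g i j k * T k i j ^ 2 = ∑ i, ∑ j, ∑ k, g i j k * T k i j ^ 2 := by
    rw [Finset.sum_comm]
    exact Finset.sum_congr rfl fun i _ => Finset.sum_comm
  rw [e]
  refine Finset.sum_congr rfl fun k _ => Finset.sum_congr rfl fun i _ => Finset.sum_congr rfl fun j _ => ?_
  rw [h.1 k i j, h.2 k j i]

theorem sum3_cyc {T : Fin n → Mt n} (h : TS T) (g : Fin n → Fin n → Fin n → ℝ) :
    3 * ∑ k, ∑ i, ∑ j, g k i j * T k i j ^ 2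
      = ∑ k, ∑ i, ∑ j, (g k i j + g i j k + g j k i) * T k i j ^ 2 := by
  have h1 := sum3_rot h g
  have h2 := sum3_rot h (fun k i j => g i j k)
  simp only [add_mul, Finset.sum_add_distrib]
  linarith

theorem CC_diag {T : Fin n → Mt n} (h : TS T) (a b d : Fin n → ℝ) :
    CC (diagonal a) (diagonal b) (diagonal d) T = ∑ k, ∑ i, ∑ j, (a k * b i * d j) * T k i j ^ 2 := by
  unfold CC
  refine Finset.sum_congr rfl fun k _ => ?_
  rw [Finset.sum_eq_single k]
  · rw [diagonal_apply_eq, trace_mul_eq, Finset.mul_sum]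
    refine Finset.sum_congr rfl fun i _ => ?_
    rw [Finset.mul_sum]
    refine Finset.sum_congr rfl fun j _ => ?_
    rw [Matrix.mul_diagonal, Matrix.diagonal_mul, h.1 k j i]; ring
  · intro l _ hl; simp [diagonal_apply_ne' _ hl]
  · simp

theorem Rm_unique {p X : Mt n} (hp : p.IsSymm) (h : X * gM p = 1) : Rm p = X := by
  calc Rm p = (X * gM p) * Rm p := by rw [h, one_mul]
    _ = X := by rw [mul_assoc, gM_mul_Rm hp, mul_one]

theorem Rm_diag (l : Fin n → ℝ) : Rm (diagonal l) = diagonal fun i => (1 + l i ^ 2)⁻¹ := by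
  apply Rm_unique (Matrix.isSymm_diagonal l)
  unfold gM
  rw [Matrix.diagonal_mul_diagonal, ← Matrix.diagonal_one, Matrix.diagonal_add, Matrix.diagonal_mul_diagonal]
  congr 1; funext i
  have : 1 + l i ^ 2 ≠ 0 := by positivity
  field_simp

theorem Qm_diag (l : Fin n → ℝ) : Qm (diagonal l) = diagonal fun i => l i * (1 + l i ^ 2)⁻¹ := by
  unfold Qm; rw [Rm_diag, Matrix.diagonal_mul_diagonal]

noncomputable def rr (a : ℝ) : ℝ := (1 + a ^ 2)⁻¹
theorem rr_pos (a : ℝ) : 0 < rr a := by unfold rr; positivity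

noncomputable def c0 (a b c : ℝ) : ℝ := rr a * rr b * rr c * (3 + (a * b + b * c + c * a))
noncomputable def c1 (a b c : ℝ) : ℝ := rr a + rr b + rr c + a * rr b * rr c * (b + c) + b * rr c * rr a * (c + a)
  + c * rr a * rr b * (a + b)
noncomputable def cG (a b c : ℝ) : ℝ := rr b * rr c * (1 - b * c) + rr c * rr a * (1 - c * a) + rr a * rr b * (1 - a * b)

theorem F0_diag {T : Fin n → Mt n} (h : TS T) (l : Fin n → ℝ) :
    3 * F0 (diagonal l) T = ∑ k, ∑ i, ∑ j, c0 (l k) (l i) (l j) * T k i j ^ 2 := by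
  have : F0 (diagonal l) T = ∑ k, ∑ i, ∑ j, (rr (l k) * rr (l i) * rr (l j) - rr (l k) * (l i * rr (l i)) * (l j * rr (l j))
     + (l k * rr (l k)) * rr (l i) * (l j * rr (l j)) + (l k * rr (l k)) * (l i * rr (l i)) * rr (l j)) * T k i j ^ 2 := by
    unfold F0
    rw [Rm_diag, Qm_diag, CC_diag h, CC_diag h, CC_diag h, CC_diag h]
    simp only [add_mul, sub_mul, Finset.sum_add_distrib, Finset.sum_sub_distrib]
    rfl
  rw [this, sum3_cyc h]
  refine Finset.sum_congr rfl fun k _ => Finset.sum_congr rfl fun i _ => Finset.sum_congr rfl fun j _ => ?_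
  unfold c0; ring

theorem F1_diag {T : Fin n → Mt n} (h : TS T) (l : Fin n → ℝ) :
    3 * F1 (diagonal l) T = ∑ k, ∑ i, ∑ j, c1 (l k) (l i) (l j) * T k i j ^ 2 := by
  have : F1 (diagonal l) T = ∑ k, ∑ i, ∑ j, (rr (l k) * 1 * 1 + l k * rr (l i) * (l j * rr (l j))
     + l k * (l i * rr (l i)) * rr (l j)) * T k i j ^ 2 := by
    unfold F1
    rw [Rm_diag, Qm_diag, ← Matrix.diagonal_one, CC_diag h, CC_diag h, CC_diag h]
    simp only [add_mul, sub_mul, Finset.sum_add_distrib, Finset.sum_sub_distrib]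
    rfl
  rw [this, sum3_cyc h]
  refine Finset.sum_congr rfl fun k _ => Finset.sum_congr rfl fun i _ => Finset.sum_congr rfl fun j _ => ?_
  unfold c1; ring

theorem Gf_diag {T : Fin n → Mt n} (h : TS T) (l : Fin n → ℝ) :
    3 * Gf (diagonal l) T = ∑ k, ∑ i, ∑ j, cG (l k) (l i) (l j) * T k i j ^ 2 := by
  have : Gf (diagonal l) T = ∑ k, ∑ i, ∑ j, (1 * rr (l i) * rr (l j) - 1 * (l i * rr (l i)) * (l j * rr (l j)))
     * T k i j ^ 2 := by
    unfold Gf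
    rw [Rm_diag, Qm_diag, ← Matrix.diagonal_one, CC_diag h, CC_diag h]
    simp only [add_mul, sub_mul, Finset.sum_add_distrib, Finset.sum_sub_distrib]
    rfl
  rw [this, sum3_cyc h]
  refine Finset.sum_congr rfl fun k _ => Finset.sum_congr rfl fun i _ => Finset.sum_congr rfl fun j _ => ?_
  unfold cG; ring

theorem c0_nonneg {a b c : ℝ} (ha : |a| ≤ √3) (hb : |b| ≤ √3) (hc : |c| ≤ √3) : 0 ≤ c0 a b c ∧
    (c0 a b c = 0 → (a = √3 ∨ b = √3 ∨ c = √3) ∧ (a = -√3 ∨ b = -√3 ∨ c = -√3)) := by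
  have hs : √3 ^ 2 = (3:ℝ) := Real.sq_sqrt (by norm_num)
  have hp : 0 < √(3:ℝ) := by positivity
  set s := √(3:ℝ)
  rw [abs_le] at ha hb hc
  have h1 : 0 ≤ (s + a) * (s + b) * (s + c) :=
    mul_nonneg (mul_nonneg (by linarith) (by linarith)) (by linarith)
  have h2 : 0 ≤ (s - a) * (s - b) * (s - c) :=
    mul_nonneg (mul_nonneg (by linarith) (by linarith)) (by linarith)
  have id : 2 * s * (3 + (a * b + b * c + c * a)) = (s + a) * (s + b) * (s + c) + (s - a) * (s - b) * (s - c) := by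
    have : s * 3 = s ^ 3 := by rw [← hs]; ring
    linear_combination 2 * this
  have h3 : 0 ≤ 3 + (a * b + b * c + c * a) := by
    by_contra hneg
    push Not at hneg
    nlinarith
  have hr : 0 < rr a * rr b * rr c := mul_pos (mul_pos (rr_pos _) (rr_pos _)) (rr_pos _)
  refine ⟨mul_nonneg hr.le h3, fun h0 => ?_⟩
  have h4 : 3 + (a * b + b * c + c * a) = 0 := by
    unfold c0 at h0
    rcases mul_eq_zero.1 h0 with h | h
    · exact absurd h hr.ne'
    · exact h
  rw [h4] at id
  have h5 : (s + a) * (s + b) * (s + c) = 0 := by linarith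
  have h6 : (s - a) * (s - b) * (s - c) = 0 := by linarith
  simp only [mul_eq_zero] at h5 h6
  constructor
  · rcases h6 with (h | h) | h
    · left; linarith
    · right; left; linarith
    · right; right; linarith
  · rcases h5 with (h | h) | h
    · left; linarith
    · right; left; linarith
    · right; right; linarith

theorem rr_s : rr (√3) = 1 / 4 := by
  unfold rr; rw [Real.sq_sqrt (by norm_num)]; norm_num
theorem rr_ns : rr (-√3) = 1 / 4 := by
  unfold rr; rw [neg_sq, Real.sq_sqrt (by norm_num)]; norm_num

theorem c1_val (x : ℝ) : c1 (√3) x (-√3) = 1 / 2 * (x ^ 2 * rr x) := by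
  have hs : √3 ^ 2 = (3:ℝ) := Real.sq_sqrt (by norm_num)
  unfold c1; rw [rr_s, rr_ns]
  have : rr x * (1 + x ^ 2) = 1 := by unfold rr; field_simp
  linear_combination (-rr x / 2) * hs - this / 2
theorem cG_val : cG (√3) 0 (-√3) = 3 / 4 := by
  have hs : √3 ^ 2 = (3:ℝ) := Real.sq_sqrt (by norm_num)
  unfold cG; rw [rr_s, rr_ns]
  have : rr 0 = 1 := by unfold rr; norm_num
  rw [this]; linear_combination hs / 16
theorem c1_swap (a b c : ℝ) : c1 a b c = c1 b a c := by unfold c1; ring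
theorem c1_cyc (a b c : ℝ) : c1 a b c = c1 b c a := by unfold c1; ring
theorem cG_swap (a b c : ℝ) : cG a b c = cG b a c := by unfold cG; ring
theorem cG_cyc (a b c : ℝ) : cG a b c = cG b c a := by unfold cG; ring

/-- Structure of null triples. -/
theorem c1_cases {a b c : ℝ} (h1 : a = √3 ∨ b = √3 ∨ c = √3) (h2 : a = -√3 ∨ b = -√3 ∨ c = -√3) :
    0 ≤ c1 a b c ∧ (c1 a b c = 0 → cG a b c = 3 / 4 ∧ a ≠ b ∧ b ≠ c ∧ a ≠ c) := by
  have hp : 0 < √(3:ℝ) := by positivity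
  have key : ∀ x : ℝ, 0 ≤ c1 (√3) x (-√3) ∧ (c1 (√3) x (-√3) = 0 → x = 0) := by
    intro x
    rw [c1_val]
    have := rr_pos x
    refine ⟨by positivity, fun h => ?_⟩
    have : x ^ 2 = 0 := by
      rcases mul_eq_zero.1 h with h | h
      · norm_num at h
      · rcases mul_eq_zero.1 h with h | h
        · exact h
        · linarith
    exact pow_eq_zero_iff (two_ne_zero) |>.1 this
  have main : ∀ x, c1 a b c = c1 (√3) x (-√3) → cG a b c = cG (√3) x (-√3) →
     (x = 0 → a ≠ b ∧ b ≠ c ∧ a ≠ c) →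
     0 ≤ c1 a b c ∧ (c1 a b c = 0 → cG a b c = 3 / 4 ∧ a ≠ b ∧ b ≠ c ∧ a ≠ c) := by
    intro x e1 e2 e3
    rw [e1, e2]
    refine ⟨(key x).1, fun h => ?_⟩
    have hx := (key x).2 h
    exact ⟨by rw [hx, cG_val], e3 hx⟩
  rcases h1 with rfl | rfl | rfl
  · rcases h2 with h | rfl | rfl
    · linarith
    · refine main c (by unfold c1; ring) (by unfold cG; ring) fun hx => ?_
      subst hx; refine ⟨?_, ?_, ?_⟩ <;> intro h <;> linarith
    · refine main b (by unfold c1; ring) (by unfold cG; ring) fun hx => ?_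
      subst hx; refine ⟨?_, ?_, ?_⟩ <;> intro h <;> linarith
  · rcases h2 with rfl | h | rfl
    · refine main c (by unfold c1; ring) (by unfold cG; ring) fun hx => ?_
      subst hx; refine ⟨?_, ?_, ?_⟩ <;> intro h <;> linarith
    · linarith
    · refine main a (by unfold c1; ring) (by unfold cG; ring) fun hx => ?_
      subst hx; refine ⟨?_, ?_, ?_⟩ <;> intro h <;> linarith
  · rcases h2 with rfl | rfl | h
    · refine main b (by unfold c1; ring) (by unfold cG; ring) fun hx => ?_
      subst hx; refine ⟨?_, ?_, ?_⟩ <;> intro h <;> linarith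
    · refine main a (by unfold c1; ring) (by unfold cG; ring) fun hx => ?_
      subst hx; refine ⟨?_, ?_, ?_⟩ <;> intro h <;> linarith
    · linarith

def T2 (T : Fin n → Mt n) : ℝ := ∑ k, ∑ i, ∑ j, T k i j ^ 2

theorem sum3_zero {g : Fin n → Fin n → Fin n → ℝ} (hg : ∀ k i j, 0 ≤ g k i j)
    (h : ∑ k, ∑ i, ∑ j, g k i j = 0) (k i j : Fin n) : g k i j = 0 := by
  have h1 := (Finset.sum_eq_zero_iff_of_nonneg (fun k _ => Finset.sum_nonneg fun i _ =>
    Finset.sum_nonneg fun j _ => hg k i j)).1 h k (Finset.mem_univ _)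
  have h2 := (Finset.sum_eq_zero_iff_of_nonneg (fun i _ =>
    Finset.sum_nonneg fun j _ => hg k i j)).1 h1 i (Finset.mem_univ _)
  exact (Finset.sum_eq_zero_iff_of_nonneg (fun j _ => hg k i j)).1 h2 j (Finset.mem_univ _)

theorem diag_main {T : Fin n → Mt n} (h : TS T) {l : Fin n → ℝ} (hl : ∀ i, |l i| ≤ √3) :
    0 ≤ F0 (diagonal l) T ∧ (F0 (diagonal l) T = 0 → 0 ≤ F1 (diagonal l) T ∧
      (F1 (diagonal l) T = 0 → Gf (diagonal l) T = 1 / 4 * T2 T ∧ ∀ k i, T k i i = 0)) := by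
  have n0 : ∀ k i j, 0 ≤ c0 (l k) (l i) (l j) * T k i j ^ 2 := fun k i j =>
    mul_nonneg (c0_nonneg (hl k) (hl i) (hl j)).1 (sq_nonneg _)
  have e0 := F0_diag h l
  refine ⟨?_, fun hF0 => ?_⟩
  · have : 0 ≤ ∑ k, ∑ i, ∑ j, c0 (l k) (l i) (l j) * T k i j ^ 2 :=
      Finset.sum_nonneg fun k _ => Finset.sum_nonneg fun i _ => Finset.sum_nonneg fun j _ => n0 k i j
    linarith
  rw [hF0, mul_zero] at e0
  have z0 := sum3_zero n0 e0.symm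
  have st : ∀ k i j, T k i j ≠ 0 → (l k = √3 ∨ l i = √3 ∨ l j = √3) ∧ (l k = -√3 ∨ l i = -√3 ∨ l j = -√3) := by
    intro k i j hT
    refine (c0_nonneg (hl k) (hl i) (hl j)).2 ?_
    rcases mul_eq_zero.1 (z0 k i j) with h | h
    · exact h
    · exact absurd (pow_eq_zero_iff two_ne_zero |>.1 h) hT
  have n1 : ∀ k i j, 0 ≤ c1 (l k) (l i) (l j) * T k i j ^ 2 := by
    intro k i j
    by_cases hT : T k i j = 0
    · simp [hT]
    · exact mul_nonneg (c1_cases (st k i j hT).1 (st k i j hT).2).1 (sq_nonneg _)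
  have e1 := F1_diag h l
  refine ⟨?_, fun hF1 => ?_⟩
  · have : 0 ≤ ∑ k, ∑ i, ∑ j, c1 (l k) (l i) (l j) * T k i j ^ 2 :=
      Finset.sum_nonneg fun k _ => Finset.sum_nonneg fun i _ => Finset.sum_nonneg fun j _ => n1 k i j
    linarith
  rw [hF1, mul_zero] at e1
  have z1 := sum3_zero n1 e1.symm
  have st2 : ∀ k i j, T k i j ≠ 0 → cG (l k) (l i) (l j) = 3 / 4 ∧ l k ≠ l i ∧ l i ≠ l j ∧ l k ≠ l j := by
    intro k i j hT
    refine (c1_cases (st k i j hT).1 (st k i j hT).2).2 ?_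
    rcases mul_eq_zero.1 (z1 k i j) with h | h
    · exact h
    · exact absurd (pow_eq_zero_iff two_ne_zero |>.1 h) hT
  refine ⟨?_, fun k i => ?_⟩
  · have eG := Gf_diag h l
    have : ∑ k, ∑ i, ∑ j, cG (l k) (l i) (l j) * T k i j ^ 2 = 3 / 4 * T2 T := by
      unfold T2
      simp only [Finset.mul_sum]
      refine Finset.sum_congr rfl fun k _ => Finset.sum_congr rfl fun i _ => Finset.sum_congr rfl fun j _ => ?_
      by_cases hT : T k i j = 0
      · simp [hT]
      · rw [(st2 k i j hT).1]
    linarith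
  · by_contra hT
    exact (st2 k i i hT).2.2.1 rfl

end SL
end

section
set_option autoImplicit false
set_option linter.unusedVariables false
set_option linter.unusedSimpArgs false
namespace SL
open Matrix MeasureTheory Filter Topology
open scoped ContDiff

variable {n : ℕ}

/-- spectral decomposition -/
theorem exists_diag {p : Mt n} (hp : p.IsSymm) : ∃ (O : Mt n) (l : Fin n → ℝ),
    O * Oᵀ = 1 ∧ Oᵀ * O = 1 ∧ p = O * diagonal l * Oᵀ := by
  have hH : p.IsHermitian := by
    unfold Matrix.IsHermitian; rw [Matrix.conjTranspose_eq_transpose_of_trivial]; exact hp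
  refine ⟨hH.eigenvectorUnitary, hH.eigenvalues, ?_, ?_, ?_⟩
  · have := Unitary.coe_mul_star_self hH.eigenvectorUnitary
    rwa [Unitary.coe_star, Matrix.star_eq_conjTranspose, Matrix.conjTranspose_eq_transpose_of_trivial] at this
  · have := Unitary.coe_star_mul_self hH.eigenvectorUnitary
    rwa [Matrix.star_eq_conjTranspose, Matrix.conjTranspose_eq_transpose_of_trivial] at this
  · have := hH.spectral_theorem
    rw [Unitary.conjStarAlgAut_apply, Matrix.star_eq_conjTranspose,
      Matrix.conjTranspose_eq_transpose_of_trivial] at this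
    exact this

/-- rotate a 3-tensor -/
def rot (O : Mt n) (T : Fin n → Mt n) (k : Fin n) : Mt n := ∑ l, O k l • (O * T l * Oᵀ)

theorem rot_rot {O : Mt n} (h : O * Oᵀ = 1) (T : Fin n → Mt n) : rot O (rot Oᵀ T) = T := by
  funext k
  unfold rot
  simp only [Matrix.mul_sum, Matrix.sum_mul, Matrix.transpose_transpose, Matrix.mul_smul, Matrix.smul_mul, Finset.smul_sum, smul_smul]
  have e : ∀ l, O * (Oᵀ * T l * O) * Oᵀ = T l := by
    intro l
    calc O * (Oᵀ * T l * O) * Oᵀ = (O * Oᵀ) * T l * (O * Oᵀ) := by noncomm_ring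
      _ = _ := by rw [h]; simp
  simp only [e]
  rw [Finset.sum_comm]
  have e2 : ∀ l, ∑ m, (O k m * Oᵀ m l) • T l = (if k = l then (1:ℝ) else 0) • T l := by
    intro l
    rw [← Finset.sum_smul, ← Matrix.mul_apply, h, Matrix.one_apply]
  simp only [e2]
  simp

theorem rot_apply (O : Mt n) (T : Fin n → Mt n) (k i j : Fin n) :
    rot O T k i j = ∑ l, ∑ a, ∑ b, O k l * (O i a * (O j b * T l a b)) := by
  unfold rot
  simp only [Matrix.sum_apply, Matrix.smul_apply, smul_eq_mul, Matrix.mul_apply, Finset.mul_sum, Finset.sum_mul,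
    Matrix.transpose_apply]
  refine Finset.sum_congr rfl fun l _ => ?_
  rw [Finset.sum_comm]
  refine Finset.sum_congr rfl fun a _ => Finset.sum_congr rfl fun b _ => by ring

theorem TS.rot {T : Fin n → Mt n} (h : TS T) (O : Mt n) : TS (rot O T) := by
  constructor
  · intro k i j
    rw [rot_apply, rot_apply]
    refine Finset.sum_congr rfl fun l _ => ?_
    rw [Finset.sum_comm]
    refine Finset.sum_congr rfl fun a _ => Finset.sum_congr rfl fun b _ => ?_
    rw [h.1 l b a]; ring
  · intro k i j
    rw [rot_apply, rot_apply, Finset.sum_comm]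
    refine Finset.sum_congr rfl fun l _ => Finset.sum_congr rfl fun a _ => Finset.sum_congr rfl fun b _ => ?_
    rw [h.2 a l b]; ring

theorem CC_rot {O : Mt n} (h : Oᵀ * O = 1) (A B D : Mt n) (T : Fin n → Mt n) :
    CC (O * A * Oᵀ) (O * B * Oᵀ) (O * D * Oᵀ) (rot O T) = CC A B D T := by
  have e : ∀ k b, ((O * B * Oᵀ) * rot O T k * (O * D * Oᵀ) * rot O T b).trace
      = ∑ l, ∑ m, O k l * O b m * (B * T l * D * T m).trace := by
    intro k b
    unfold rot
    simp only [Matrix.mul_sum, Matrix.sum_mul, Matrix.mul_smul, Matrix.smul_mul, Matrix.trace_sum, Matrix.trace_smul,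
      smul_eq_mul, Finset.smul_sum, Finset.mul_sum]
    rw [Finset.sum_comm]
    refine Finset.sum_congr rfl fun l _ => Finset.sum_congr rfl fun m _ => ?_
    rw [← mul_assoc, mul_comm (O b m)]
    congr 1
    have : O * B * Oᵀ * (O * T l * Oᵀ) * (O * D * Oᵀ) * (O * T m * Oᵀ)
       = O * (B * (Oᵀ * O) * T l * (Oᵀ * O) * D * (Oᵀ * O) * T m) * Oᵀ := by noncomm_ring
    rw [this, h, Matrix.trace_mul_cycle, h]
    simp
  have e2 : ∀ l m, ∑ k, ∑ b, (O * A * Oᵀ) k b * (O k l * O b m) = A l m := by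
    intro l m
    have : (Oᵀ * (O * A * Oᵀ) * O) l m = A l m := by
      have : Oᵀ * (O * A * Oᵀ) * O = (Oᵀ * O) * A * (Oᵀ * O) := by noncomm_ring
      rw [this, h]; simp
    rw [← this]
    rw [Matrix.mul_apply]
    simp only [Matrix.mul_apply (M := Oᵀ), Matrix.transpose_apply, Finset.sum_mul]
    rw [Finset.sum_comm]
    refine Finset.sum_congr rfl fun a _ => Finset.sum_congr rfl fun b _ => by ring
  unfold CC
  simp only [e, ← e2, Finset.mul_sum, Finset.sum_mul]
  have swap : ∀ f : Fin n → Fin n → Fin n → Fin n → ℝ,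
      ∑ k, ∑ b, ∑ i, ∑ j, f k b i j = ∑ i, ∑ j, ∑ k, ∑ b, f k b i j := by
    intro f
    have s1 : ∀ k, ∑ b, ∑ i, ∑ j, f k b i j = ∑ i, ∑ j, ∑ b, f k b i j := fun k => by
      rw [Finset.sum_comm]
      exact Finset.sum_congr rfl fun i _ => Finset.sum_comm
    rw [Finset.sum_congr rfl fun k _ => s1 k, Finset.sum_comm]
    exact Finset.sum_congr rfl fun i _ => Finset.sum_comm
  rw [swap]
  refine Finset.sum_congr rfl fun i _ => Finset.sum_congr rfl fun j _ =>
    Finset.sum_congr rfl fun k _ => Finset.sum_congr rfl fun b _ => by ring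

theorem T2_eq_CC {T : Fin n → Mt n} (h : TS T) : T2 T = CC 1 1 1 T := by
  rw [← Matrix.diagonal_one, CC_diag h]; simp [T2]

theorem Rm_rot {O p : Mt n} (hO : O * Oᵀ = 1) (h : Oᵀ * O = 1) (hp : p.IsSymm) :
    Rm (O * p * Oᵀ) = O * Rm p * Oᵀ := by
  have hs : (O * p * Oᵀ).IsSymm := by
    unfold Matrix.IsSymm; simp [Matrix.transpose_mul, hp.eq, mul_assoc]
  apply Rm_unique hs
  have hg : gM (O * p * Oᵀ) = O * gM p * Oᵀ := by
    unfold gM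
    have : O * p * Oᵀ * (O * p * Oᵀ) = O * (p * (Oᵀ * O) * p) * Oᵀ := by noncomm_ring
    rw [this, h, mul_add, add_mul, mul_one, mul_one, hO]
  rw [hg]
  have : O * Rm p * Oᵀ * (O * gM p * Oᵀ) = O * (Rm p * (Oᵀ * O) * gM p) * Oᵀ := by noncomm_ring
  rw [this, h, mul_one, Rm_mul_gM hp, mul_one, hO]

theorem Qm_rot {O p : Mt n} (hO : O * Oᵀ = 1) (h : Oᵀ * O = 1) (hp : p.IsSymm) :
    Qm (O * p * Oᵀ) = O * Qm p * Oᵀ := by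
  unfold Qm
  rw [Rm_rot hO h hp]
  have : O * p * Oᵀ * (O * Rm p * Oᵀ) = O * (p * (Oᵀ * O) * Rm p) * Oᵀ := by noncomm_ring
  rw [this, h, mul_one]

theorem rot_main {p : Mt n} (hp : p.IsSymm) (hb : SpecBd (√3) p) {T : Fin n → Mt n} (h : TS T) :
    0 ≤ F0 p T ∧ (F0 p T = 0 → 0 ≤ F1 p T ∧
      (F1 p T = 0 → Gf p T = 1 / 4 * T2 T ∧ ∀ k, Y2 p T k = 0)) := by
  obtain ⟨O, l, hO, hO', rfl⟩ := exists_diag hp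
  set T' := rot Oᵀ T with hT'
  have hT : T = rot O T' := (rot_rot hO T).symm
  have ts' : TS T' := h.rot _
  have hds := Matrix.isSymm_diagonal l
  have one_eq : (1 : Mt n) = O * 1 * Oᵀ := by rw [mul_one, hO]
  have c1 : ∀ R : Mt n, CC (O * R * Oᵀ) 1 1 (rot O T') = CC R 1 1 T' := by
    intro R; have := CC_rot hO' R 1 1 T'; rwa [mul_one, hO] at this
  have c2 : ∀ B D : Mt n, CC 1 (O * B * Oᵀ) (O * D * Oᵀ) (rot O T') = CC 1 B D T' := by
    intro B D; have := CC_rot hO' 1 B D T'; rwa [mul_one, hO] at this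
  have c3 : ∀ A B : Mt n, CC (O * A * Oᵀ) (O * B * Oᵀ) 1 (rot O T') = CC A B 1 T' := by
    intro A B; have := CC_rot hO' A B 1 T'; rwa [mul_one, hO] at this
  have c4 : ∀ A B : Mt n, CC (O * A * Oᵀ) 1 (O * B * Oᵀ) (rot O T') = CC A 1 B T' := by
    intro A B; have := CC_rot hO' A 1 B T'; rwa [mul_one, hO] at this
  have a0 : F0 (O * diagonal l * Oᵀ) T = F0 (diagonal l) T' := by
    unfold F0; rw [Rm_rot hO hO' hds, Qm_rot hO hO' hds, hT]
    simp only [CC_rot hO']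
  have a1 : F1 (O * diagonal l * Oᵀ) T = F1 (diagonal l) T' := by
    unfold F1; rw [Rm_rot hO hO' hds, Qm_rot hO hO' hds, hT]
    simp only [CC_rot hO', c1, c2, c3, c4]
  have aG : Gf (O * diagonal l * Oᵀ) T = Gf (diagonal l) T' := by
    unfold Gf; rw [Rm_rot hO hO' hds, Qm_rot hO hO' hds, hT]
    simp only [CC_rot hO', c1, c2, c3, c4]
  have aT : T2 T = T2 T' := by
    rw [T2_eq_CC h, T2_eq_CC ts', hT]
    conv_lhs => rw [one_eq]
    simp only [CC_rot hO']
  have hl : ∀ i, |l i| ≤ √3 := by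
    intro i
    have h1 := hb (O *ᵥ Pi.single i 1)
    have key : ∀ M : Mt n, (O *ᵥ Pi.single i 1) ⬝ᵥ (O * M * Oᵀ) *ᵥ (O *ᵥ Pi.single i 1) = M i i := by
      intro M
      have : (O * M * Oᵀ) *ᵥ (O *ᵥ Pi.single i 1) = O *ᵥ (M *ᵥ Pi.single i 1) := by
        rw [Matrix.mulVec_mulVec, Matrix.mulVec_mulVec, mul_assoc, hO', mul_one]
      rw [this, Matrix.dotProduct_mulVec, ← Matrix.mulVec_transpose, Matrix.mulVec_mulVec, hO', Matrix.one_mulVec]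
      simp
    have k1 := key (diagonal l)
    have k2 := key 1
    rw [mul_one, hO, Matrix.one_mulVec] at k2
    rw [k1, k2] at h1
    simpa using h1
  have main := diag_main ts' hl
  rw [a0, a1, aG, aT]
  refine ⟨main.1, fun h0 => ⟨(main.2 h0).1, fun h1 => ⟨((main.2 h0).2 h1).1, fun k => ?_⟩⟩⟩
  have hz := ((main.2 h0).2 h1).2
  have tr0 : ∀ b, (T b).trace = 0 := by
    intro b
    rw [hT]; unfold rot
    simp only [Matrix.trace_sum, Matrix.trace_smul]
    refine Finset.sum_eq_zero fun m _ => ?_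
    rw [Matrix.trace_mul_cycle, hO', one_mul]
    simp [Matrix.trace, hz]
  have trQ : (Qm (O * diagonal l * Oᵀ) * T k).trace = 0 := by
    rw [hT, Qm_rot hO hO' hds, Qm_diag]; unfold rot
    simp only [Matrix.mul_sum, Matrix.mul_smul, Matrix.trace_sum, Matrix.trace_smul]
    refine Finset.sum_eq_zero fun m _ => ?_
    have : ∀ D : Mt n, O * D * Oᵀ * (O * T' m * Oᵀ) = O * (D * (Oᵀ * O) * T' m) * Oᵀ := by
      intro D; noncomm_ring
    rw [this, hO', Matrix.trace_mul_cycle, hO', mul_one, one_mul]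
    simp [Matrix.trace, hz]
  unfold Y2
  rw [trQ]; simp [tr0]

end SL
end

section
set_option autoImplicit false
set_option linter.unusedVariables false
set_option linter.unusedSimpArgs false
namespace SL
open Matrix MeasureTheory Filter Topology
open scoped ContDiff

variable {n : ℕ}

theorem nested_empty {Y : Type*} [TopologicalSpace Y] [CompactSpace Y] (Z : ℕ → Set Y)
    (hc : ∀ m, IsClosed (Z m)) (hd : ∀ m, Z (m+1) ⊆ Z m) (he : ∀ y, ¬ ∀ m, y ∈ Z m) : ∃ m, ∀ y, y ∉ Z m := by
  by_contra hne
  push Not at hne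
  obtain ⟨y, hy⟩ := IsCompact.nonempty_iInter_of_sequence_nonempty_isCompact_isClosed Z hd
    (fun m => hne m) (hc 0).isCompact hc
  exact he y (by simpa using hy)

theorem lemK {Y : Type*} [TopologicalSpace Y] [CompactSpace Y] {Z : Set Y} (hZ : IsClosed Z) {f g : Y → ℝ}
    (hf : Continuous f) (hg : Continuous g) (h0 : ∀ z ∈ Z, 0 ≤ f z) (h : ∀ z ∈ Z, f z = 0 → 0 < g z) :
    ∃ C : ℝ, 0 ≤ C ∧ ∀ z ∈ Z, 0 < g z + C * f z := by
  obtain ⟨m, hm⟩ := nested_empty (fun m : ℕ => Z ∩ {z | g z + m * f z ≤ 0}) (fun m => hZ.inter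
    (isClosed_le (by fun_prop) continuous_const)) (fun m z hz => ⟨hz.1, by
      have h1 := hz.2; have h2 := h0 z hz.1
      simp only [Set.mem_ofPred_eq, Nat.cast_add, Nat.cast_one] at h1 ⊢
      nlinarith⟩) (fun y hy => by
      have hyZ := (hy 0).1
      have h2 := h0 y hyZ
      rcases h2.eq_or_lt with h3 | h3
      · have := (hy 0).2
        have h4 := h y hyZ h3.symm
        simp at this; linarith
      · obtain ⟨m, hm⟩ := exists_nat_gt (- g y / f y)
        have := (hy m).2
        rw [div_lt_iff₀ h3] at hm
        simp only [Set.mem_ofPred_eq] at this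
        linarith)
  refine ⟨m, Nat.cast_nonneg m, fun z hz => ?_⟩
  by_contra hcon
  exact hm z ⟨hz, not_lt.1 hcon⟩

theorem lemK2 {Y : Type*} [TopologicalSpace Y] [CompactSpace Y] (S : ℕ → Set Y) (hS : ∀ m, IsClosed (S m))
    (hd : ∀ m, S (m+1) ⊆ S m) {f0 f1 g : Y → ℝ} (c0 : Continuous f0) (c1 : Continuous f1) (cg : Continuous g)
    (h0 : ∀ z, (∀ m, z ∈ S m) → 0 ≤ f0 z) (h1 : ∀ z, (∀ m, z ∈ S m) → f0 z = 0 → 0 ≤ f1 z)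
    (hg : ∀ z, (∀ m, z ∈ S m) → f0 z = 0 → f1 z = 0 → 0 < g z) :
    ∃ C0 C1 : ℝ, 0 ≤ C0 ∧ 0 ≤ C1 ∧ ∃ m, ∀ z ∈ S m, 0 < g z + C1 * f1 z + C0 * f0 z := by
  have hcl : IsClosed (⋂ m, S m) := isClosed_iInter hS
  obtain ⟨C1, p1, q1⟩ := lemK (Z := (⋂ m, S m) ∩ {z | f0 z = 0})
    (hcl.inter (isClosed_eq c0 continuous_const)) c1 cg
    (fun z hz => h1 z (by simpa using hz.1) hz.2) (fun z hz => hg z (by simpa using hz.1) hz.2)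
  obtain ⟨C0, p0, q0⟩ := lemK (Z := (⋂ m, S m)) (f := f0) (g := fun z => g z + C1 * f1 z) hcl c0 (by fun_prop)
    (fun z hz => h0 z (by simpa using hz)) (fun z hz h => q1 z ⟨hz, h⟩)
  obtain ⟨m, hm⟩ := nested_empty (fun m => S m ∩ {z | g z + C1 * f1 z + C0 * f0 z ≤ 0})
    (fun m => (hS m).inter (isClosed_le (by fun_prop) continuous_const))
    (fun m z hz => ⟨hd m hz.1, hz.2⟩) (fun y hy => by
      have := q0 y (by simpa using fun m => (hy m).1)
      have h2 := (hy 0).2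
      simp only [Set.mem_ofPred_eq] at h2; linarith)
  refine ⟨C0, C1, p0, p1, m, fun z hz => ?_⟩
  by_contra hcon
  exact hm z ⟨hz, not_lt.1 hcon⟩

theorem SpecBd.entry {c : ℝ} {p : Mt n} (hp : p.IsSymm) (h : SpecBd c p) (i j : Fin n) : |p i j| ≤ c := by
  have hii : ∀ i, |p i i| ≤ c := by
    intro i
    have := h (Pi.single i 1)
    simpa using this
  by_cases hij : i = j
  · subst hij; exact hii i
  · have a := h (Pi.single i 1 + Pi.single j 1)
    have b := h (Pi.single i 1 - Pi.single j 1)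
    have hs := hp.apply i j
    simp [Matrix.mulVec_add, Matrix.mulVec_sub, hij, Ne.symm hij] at a b
    rw [hs] at a b
    rw [abs_le] at *
    constructor <;> linarith [a.1, a.2, b.1, b.2]

theorem SpecBd.mono {c d : ℝ} {p : Mt n} (h : SpecBd c p) (hcd : c ≤ d) : SpecBd d p := fun v => by
  refine (h v).trans (mul_le_mul_of_nonneg_right hcd ?_)
  exact Finset.sum_nonneg fun i _ => mul_self_nonneg _

theorem continuous_gM : Continuous (gM : Mt n → Mt n) := by unfold gM; fun_prop

theorem continuous_Rm {Y : Type*} [TopologicalSpace Y] {p : Y → Mt n} (hp : Continuous p)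
    (hs : ∀ y, (p y).IsSymm) : Continuous (fun y => Rm (p y)) := by
  unfold Rm
  have h1 : Continuous fun y => gM (p y) := continuous_gM.comp hp
  exact Continuous.smul (Continuous.inv₀ h1.matrix_det fun y => (gM_det_pos (hs y)).ne') h1.matrix_adjugate

theorem continuous_Qm {Y : Type*} [TopologicalSpace Y] {p : Y → Mt n} (hp : Continuous p)
    (hs : ∀ y, (p y).IsSymm) : Continuous (fun y => Qm (p y)) := hp.matrix_mul (continuous_Rm hp hs)

theorem continuous_Vd {Y : Type*} [TopologicalSpace Y] {p : Y → Mt n} (hp : Continuous p) :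
    Continuous (fun y => Vd (p y)) := (continuous_gM.comp hp).matrix_det.sqrt

theorem continuous_CC {Y : Type*} [TopologicalSpace Y] {A B D : Y → Mt n} {T : Y → Fin n → Mt n}
    (hA : Continuous A) (hB : Continuous B) (hD : Continuous D) (hT : Continuous T) :
    Continuous (fun y => CC (A y) (B y) (D y) (T y)) := by
  unfold CC
  refine continuous_finsetSum _ fun k _ => continuous_finsetSum _ fun b _ => ?_
  have h1 : ∀ k, Continuous fun y => T y k := fun k => (continuous_apply k).comp hT
  exact (hA.matrix_elem k b).mul (((hB.matrix_mul (h1 k)).matrix_mul hD).matrix_mul (h1 b)).matrix_trace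

theorem CC_smul (A B D : Mt n) (T : Fin n → Mt n) (c : ℝ) : CC A B D (c • T) = c^2 * CC A B D T := by
  unfold CC
  simp only [Finset.mul_sum]
  refine Finset.sum_congr rfl fun k _ => Finset.sum_congr rfl fun b _ => ?_
  simp only [Pi.smul_apply, Matrix.mul_smul, Matrix.smul_mul, Matrix.trace_smul, smul_eq_mul]
  ring
theorem F0_smul (p : Mt n) (T : Fin n → Mt n) (c : ℝ) : F0 p (c • T) = c^2 * F0 p T := by
  unfold F0; simp only [CC_smul]; ring
theorem F1_smul (p : Mt n) (T : Fin n → Mt n) (c : ℝ) : F1 p (c • T) = c^2 * F1 p T := by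
  unfold F1; simp only [CC_smul]; ring
theorem Gf_smul (p : Mt n) (T : Fin n → Mt n) (c : ℝ) : Gf p (c • T) = c^2 * Gf p T := by
  unfold Gf; simp only [CC_smul]; ring
theorem Y2_smul (p : Mt n) (T : Fin n → Mt n) (c : ℝ) (k : Fin n) : Y2 p (c • T) k = c * Y2 p T k := by
  unfold Y2
  simp only [Pi.smul_apply, Matrix.mul_smul, Matrix.smul_mul, Matrix.trace_smul, smul_eq_mul, mul_sub, Finset.mul_sum]
  congr 1
  exact Finset.sum_congr rfl fun b _ => by ring
theorem T2_smul (T : Fin n → Mt n) (c : ℝ) : T2 (c • T) = c^2 * T2 T := by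
  unfold T2
  simp only [Finset.mul_sum, Pi.smul_apply, Matrix.smul_apply, smul_eq_mul, mul_pow]
theorem T2_nonneg (T : Fin n → Mt n) : 0 ≤ T2 T :=
  Finset.sum_nonneg fun _ _ => Finset.sum_nonneg fun _ _ => Finset.sum_nonneg fun _ _ => sq_nonneg _
theorem sq_le_T2 (T : Fin n → Mt n) (k i j : Fin n) : T k i j ^ 2 ≤ T2 T := by
  have h1 : T k i j ^ 2 ≤ ∑ j, T k i j ^ 2 := Finset.single_le_sum (f := fun j => T k i j ^ 2) (fun _ _ => sq_nonneg _) (Finset.mem_univ j)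
  have h2 : ∑ j, T k i j ^ 2 ≤ ∑ i, ∑ j, T k i j ^ 2 := Finset.single_le_sum (f := fun i => ∑ j, T k i j ^ 2)
    (fun _ _ => Finset.sum_nonneg fun _ _ => sq_nonneg _) (Finset.mem_univ i)
  have h3 : ∑ i, ∑ j, T k i j ^ 2 ≤ T2 T := Finset.single_le_sum (f := fun k => ∑ i, ∑ j, T k i j ^ 2)
    (fun _ _ => Finset.sum_nonneg fun _ _ => Finset.sum_nonneg fun _ _ => sq_nonneg _) (Finset.mem_univ k)
  linarith
theorem T2_eq_zero {T : Fin n → Mt n} (h : T2 T = 0) : T = 0 := by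
  funext k; ext i j
  have := sq_le_T2 T k i j
  rw [h] at this
  simpa using pow_eq_zero_iff (two_ne_zero) |>.1 (le_antisymm this (sq_nonneg _))
theorem continuous_T2 : Continuous (T2 : (Fin n → Mt n) → ℝ) := by
  unfold T2
  refine continuous_finsetSum _ fun k _ => continuous_finsetSum _ fun i _ => continuous_finsetSum _ fun j _ => ?_
  exact ((continuous_apply k).matrix_elem i j).pow 2

/-- compact parameter set -/
def YS (n : ℕ) : Set (Mt n × (Fin n → Mt n)) :=
  {z | z.1.IsSymm ∧ SpecBd 3 z.1 ∧ TS z.2 ∧ T2 z.2 = 1}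

theorem isClosed_SpecBd {Y : Type*} [TopologicalSpace Y] {p : Y → Mt n} (hp : Continuous p) (c : ℝ) :
    IsClosed {y | SpecBd c (p y)} := by
  have : {y | SpecBd c (p y)} = ⋂ v : Fin n → ℝ, {y | |v ⬝ᵥ (p y *ᵥ v)| ≤ c*(v ⬝ᵥ v)} := by
    ext y; simp [SpecBd]
  rw [this]
  refine isClosed_iInter fun v => isClosed_le ?_ continuous_const
  exact (continuous_const.dotProduct (hp.matrix_mulVec continuous_const)).abs

theorem isClosed_symm {Y : Type*} [TopologicalSpace Y] {p : Y → Mt n} (hp : Continuous p) :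
    IsClosed {y | (p y).IsSymm} := isClosed_eq hp.matrix_transpose hp

theorem isCompact_YS : IsCompact (YS n) := by
  refine Metric.isCompact_of_isClosed_isBounded (α := (Fin n → Fin n → ℝ) × (Fin n → Fin n → Fin n → ℝ)) ?_ ?_
  · refine IsClosed.inter (isClosed_symm continuous_fst) (IsClosed.inter (isClosed_SpecBd continuous_fst 3)
      (IsClosed.inter ?_ (isClosed_eq (continuous_T2.comp continuous_snd) continuous_const)))
    have e : ∀ k i j, Continuous fun z : Mt n × (Fin n → Mt n) => z.2 k i j := fun k i j =>
      ((continuous_apply k).comp continuous_snd).matrix_elem i j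
    refine IsClosed.inter ?_ ?_
    · have : {z : Mt n × (Fin n → Mt n) | ∀ k i j, z.2 k i j = z.2 k j i} =
        ⋂ k, ⋂ i, ⋂ j, {z | z.2 k i j = z.2 k j i} := by ext z; simp
      change IsClosed {z : Mt n × (Fin n → Mt n) | ∀ k i j, z.2 k i j = z.2 k j i}
      rw [this]
      exact isClosed_iInter fun k => isClosed_iInter fun i => isClosed_iInter fun j => isClosed_eq (e _ _ _) (e _ _ _)
    · have : {z : Mt n × (Fin n → Mt n) | ∀ k i j, z.2 k i j = z.2 i k j} =
        ⋂ k, ⋂ i, ⋂ j, {z | z.2 k i j = z.2 i k j} := by ext z; simp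
      change IsClosed {z : Mt n × (Fin n → Mt n) | ∀ k i j, z.2 k i j = z.2 i k j}
      rw [this]
      exact isClosed_iInter fun k => isClosed_iInter fun i => isClosed_iInter fun j => isClosed_eq (e _ _ _) (e _ _ _)
  · refine (Metric.isBounded_iff_subset_closedBall (0 : (Fin n → Fin n → ℝ) × (Fin n → Fin n → Fin n → ℝ))).2 ⟨3, ?_⟩
    rintro ⟨p, T⟩ ⟨h1, h2, h3, h4⟩
    rw [mem_closedBall_zero_iff, Prod.norm_def, max_le_iff]
    simp only at h1 h2 h3 h4
    constructor
    · refine (pi_norm_le_iff_of_nonneg (by norm_num)).2 fun i => (pi_norm_le_iff_of_nonneg (by norm_num)).2 fun j => ?_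
      exact h2.entry h1 i j
    · refine (pi_norm_le_iff_of_nonneg (by norm_num)).2 fun k => (pi_norm_le_iff_of_nonneg (by norm_num)).2 fun i => (pi_norm_le_iff_of_nonneg (by norm_num)).2 fun j => ?_
      have := sq_le_T2 T k i j
      rw [h4] at this
      change |T k i j| ≤ 3
      rw [abs_le]; constructor <;> nlinarith

instance : CompactSpace (YS n) := isCompact_iff_compactSpace.1 isCompact_YS

theorem sqrt3_lt : √3 < 2 := by
  rw [Real.sqrt_lt' (by norm_num)]; norm_num

theorem alg_gen (g : Mt n → (Fin n → Mt n) → ℝ) (hg : Continuous fun z : YS n => g z.1.1 z.1.2)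
    (hs : ∀ p T (c : ℝ), g p (c • T) = c^2 * g p T)
    (hpos : ∀ p T, p.IsSymm → SpecBd (√3) p → TS T → T2 T = 1 → F0 p T = 0 → F1 p T = 0 → 0 < g p T) :
    ∃ C0 C1 δ : ℝ, 0 ≤ C0 ∧ 0 ≤ C1 ∧ 0 < δ ∧ ∀ p T, p.IsSymm → SpecBd (√3 + δ) p → TS T →
      0 ≤ g p T + C1 * F1 p T + C0 * F0 p T := by
  have cp : Continuous fun z : YS n => z.1.1 := continuous_fst.comp continuous_subtype_val
  have cT : Continuous fun z : YS n => z.1.2 := continuous_snd.comp continuous_subtype_val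
  have cR := continuous_Rm cp fun z => z.2.1
  have cQ := continuous_Qm cp fun z => z.2.1
  have one : Continuous fun z : YS n => (1 : Mt n) := continuous_const
  have lim : ∀ z : YS n, (∀ m : ℕ, SpecBd (√3 + 1/((m:ℝ)+1)) z.1.1) → SpecBd (√3) z.1.1 := by
    intro z hz v
    have ht : Tendsto (fun m : ℕ => (√3 + 1/((m:ℝ)+1)) * (v ⬝ᵥ v)) atTop (𝓝 ((√3 + 0) * (v ⬝ᵥ v))) :=
      (tendsto_const_nhds.add tendsto_one_div_add_atTop_nhds_zero_nat).mul_const _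
    rw [add_zero] at ht
    exact ge_of_tendsto' ht fun m => hz m v
  obtain ⟨C0, C1, h0, h1, m, hm⟩ := lemK2 (Y := YS n) (fun m => {z | SpecBd (√3 + 1/((m:ℝ)+1)) z.1.1})
    (fun m => isClosed_SpecBd cp _) (fun m z hz => by
      refine SpecBd.mono hz ?_
      push_cast
      have : 1 / ((m:ℝ) + 1 + 1) ≤ 1 / ((m:ℝ)+1) := one_div_le_one_div_of_le (by positivity) (by linarith)
      linarith)
    (f0 := fun z => F0 z.1.1 z.1.2) (f1 := fun z => F1 z.1.1 z.1.2) (g := fun z => g z.1.1 z.1.2)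
    (((continuous_CC cR cR cR cT).sub (continuous_CC cR cQ cQ cT)).add (continuous_CC cQ cR cQ cT) |>.add (continuous_CC cQ cQ cR cT))
    (((continuous_CC cR one one cT).add (continuous_CC cp cR cQ cT)).add (continuous_CC cp cQ cR cT)) hg
    (fun z hz => (rot_main z.2.1 (lim z hz) z.2.2.2.1).1)
    (fun z hz a => ((rot_main z.2.1 (lim z hz) z.2.2.2.1).2 a).1)
    (fun z hz a b => hpos _ _ z.2.1 (lim z hz) z.2.2.2.1 z.2.2.2.2 a b)
  · refine ⟨C0, C1, 1/((m:ℝ)+1), h0, h1, by positivity, fun p T hp hb hT => ?_⟩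
    have hle : 1/((m:ℝ)+1) ≤ 1 := by
      rw [div_le_one (by positivity)]; linarith [(Nat.cast_nonneg m : (0:ℝ) ≤ m)]
    rcases (T2_nonneg T).eq_or_lt with h | h
    · have hz := T2_eq_zero h.symm
      have e : T = (0:ℝ) • T := by rw [hz]; simp
      rw [e, hs, F0_smul, F1_smul]; simp
    · set c := √(T2 T) with hc
      have hc0 : 0 < c := Real.sqrt_pos.2 h
      have hc2 : c^2 = T2 T := Real.sq_sqrt h.le
      have e : T = c • (c⁻¹ • T) := by rw [smul_smul, mul_inv_cancel₀ hc0.ne', one_smul]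
      have key := hm ⟨(p, c⁻¹ • T), hp, hb.mono (by linarith [sqrt3_lt]), ⟨fun k i j => by
        simp [hT.1 k i j], fun k i j => by simp [hT.2 k i j]⟩, by
          rw [T2_smul, ← hc2]; field_simp⟩ hb
      rw [e, hs, F0_smul, F1_smul]
      simp only at key
      nlinarith [mul_pos (pow_pos hc0 2) key]

theorem algI (n : ℕ) : ∃ C0 C1 δ : ℝ, 0 ≤ C0 ∧ 0 ≤ C1 ∧ 0 < δ ∧ ∀ (p : Mt n) (T : Fin n → Mt n), p.IsSymm → SpecBd (√3 + δ) p → TS T →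
      1/8 * T2 T ≤ Gf p T + C1 * F1 p T + C0 * F0 p T := by
  have cp : Continuous fun z : YS n => z.1.1 := continuous_fst.comp continuous_subtype_val
  have cT : Continuous fun z : YS n => z.1.2 := continuous_snd.comp continuous_subtype_val
  have cR := continuous_Rm cp fun z => z.2.1
  have cQ := continuous_Qm cp fun z => z.2.1
  have one : Continuous fun z : YS n => (1 : Mt n) := continuous_const
  obtain ⟨C0, C1, δ, h0, h1, hδ, h⟩ := alg_gen (fun (p : Mt n) T => Gf p T - 1/8 * T2 T)
    (((continuous_CC one cR cR cT).sub (continuous_CC one cQ cQ cT)).sub (continuous_const.mul (continuous_T2.comp cT)))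
    (fun p T c => by simp only [Gf_smul, T2_smul]; ring)
    (fun p T hp hb hT h1 a b => by
      have := (((rot_main hp hb hT).2 a).2 b).1
      rw [this, h1]; norm_num)
  exact ⟨C0, C1, δ, h0, h1, hδ, fun p T hp hb hT => by linarith [h p T hp hb hT]⟩

theorem algII (n : ℕ) {κ : ℝ} (hκ : 0 < κ) : ∃ C0 C1 δ : ℝ, 0 ≤ C0 ∧ 0 ≤ C1 ∧ 0 < δ ∧ ∀ (p : Mt n) (T : Fin n → Mt n), p.IsSymm → SpecBd (√3 + δ) p → TS T →
      ∑ k, Y2 p T k ^ 2 ≤ κ * T2 T + C1 * F1 p T + C0 * F0 p T := by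
  have cp : Continuous fun z : YS n => z.1.1 := continuous_fst.comp continuous_subtype_val
  have cT : Continuous fun z : YS n => z.1.2 := continuous_snd.comp continuous_subtype_val
  have cQ := continuous_Qm cp fun z => z.2.1
  have cTk : ∀ k, Continuous fun z : YS n => z.1.2 k := fun k => (continuous_apply k).comp cT
  obtain ⟨C0, C1, δ, h0, h1, hδ, h⟩ := alg_gen (fun (p : Mt n) T => κ * T2 T - ∑ k, Y2 p T k ^ 2)
    ((continuous_const.mul (continuous_T2.comp cT)).sub (continuous_finsetSum _ fun k _ => by
      refine Continuous.pow ?_ 2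
      refine (cQ.matrix_mul (cTk k)).matrix_trace.sub (continuous_finsetSum _ fun b _ => ?_)
      exact (cQ.matrix_elem k b).mul (cTk b).matrix_trace))
    (fun p T c => by simp only [Y2_smul, T2_smul, mul_pow, ← Finset.mul_sum]; ring)
    (fun p T hp hb hT h1 a b => by
      have := (((rot_main hp hb hT).2 a).2 b).2
      simp [this, h1, hκ])
  exact ⟨C0, C1, δ, h0, h1, hδ, fun p T hp hb hT => by linarith [h p T hp hb hT]⟩

end SL
end

section
set_option autoImplicit false
set_option linter.unusedVariables false
set_option linter.unusedSimpArgs false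
namespace SL
open Matrix MeasureTheory Filter Topology
open scoped ContDiff

variable {n : ℕ}

def PS (n : ℕ) : Set (Mt n) := {p | p.IsSymm ∧ SpecBd 2 p}

theorem isCompact_PS : IsCompact (PS n) := by
  refine Metric.isCompact_of_isClosed_isBounded (α := (Fin n → Fin n → ℝ)) ?_ ?_
  · exact IsClosed.inter (isClosed_symm continuous_id) (isClosed_SpecBd continuous_id 2)
  · refine (Metric.isBounded_iff_subset_closedBall (0 : (Fin n → Fin n → ℝ))).2 ⟨2, ?_⟩
    rintro p ⟨h1, h2⟩
    rw [mem_closedBall_zero_iff]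
    refine (pi_norm_le_iff_of_nonneg (by norm_num)).2 fun i => (pi_norm_le_iff_of_nonneg (by norm_num)).2 fun j => ?_
    exact h2.entry h1 i j

instance : CompactSpace (PS n) := isCompact_iff_compactSpace.1 isCompact_PS

theorem exists_bd {Y : Type*} [TopologicalSpace Y] [CompactSpace Y] {f : Y → ℝ} (hf : Continuous f) :
    ∃ C : ℝ, ∀ y, |f y| ≤ C := by
  obtain ⟨C, hC⟩ := isCompact_univ.bddAbove_image (f := fun y => |f y|) hf.abs.continuousOn
  exact ⟨C, fun y => hC ⟨y, Set.mem_univ y, rfl⟩⟩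

theorem mulVec_sq_le {p : Mt n} {c : ℝ} (hc : ∀ i j, |p i j| ≤ c) (v : Fin n → ℝ) :
    (p *ᵥ v) ⬝ᵥ (p *ᵥ v) ≤ (n:ℝ)^2 * c^2 * (v ⬝ᵥ v) := by
  have h1 : ∀ i, (p *ᵥ v) i * (p *ᵥ v) i ≤ (n * c^2) * (v ⬝ᵥ v) := by
    intro i
    have := Finset.sum_mul_sq_le_sq_mul_sq Finset.univ (fun j => p i j) v
    have h2 : ∑ j, p i j ^ 2 ≤ n * c^2 := by
      calc _ ≤ ∑ j : Fin n, c^2 := Finset.sum_le_sum fun j _ => sq_le_sq' (abs_le.1 (hc i j)).1 (abs_le.1 (hc i j)).2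
        _ = _ := by simp
    have h3 : ∑ j, v j ^ 2 = v ⬝ᵥ v := by simp [dotProduct, sq]
    rw [h3] at this
    have h4 : 0 ≤ v ⬝ᵥ v := by rw [← h3]; exact Finset.sum_nonneg fun _ _ => sq_nonneg _
    calc _ = (∑ j, p i j * v j)^2 := by simp [Matrix.mulVec, dotProduct, sq]
      _ ≤ _ := this.trans (mul_le_mul_of_nonneg_right h2 h4)
  calc _ ≤ ∑ i : Fin n, (n * c^2) * (v ⬝ᵥ v) := Finset.sum_le_sum fun i _ => h1 i
    _ = _ := by simp; ring

theorem dot_nonneg (v : Fin n → ℝ) : 0 ≤ v ⬝ᵥ v := Finset.sum_nonneg fun _ _ => mul_self_nonneg _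

theorem dotR_eq {p : Mt n} (hp : p.IsSymm) (v : Fin n → ℝ) :
    v ⬝ᵥ (Rm p *ᵥ v) = (Rm p *ᵥ v) ⬝ᵥ (Rm p *ᵥ v) + (Qm p *ᵥ v) ⬝ᵥ (Qm p *ᵥ v) := by
  set y := Rm p *ᵥ v with hy
  have hv : v = gM p *ᵥ y := by rw [hy, Matrix.mulVec_mulVec, gM_mul_Rm hp, Matrix.one_mulVec]
  have hq : Qm p *ᵥ v = p *ᵥ y := by rw [hy, Matrix.mulVec_mulVec]; rfl
  rw [hq]
  nth_rewrite 1 [hv]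
  unfold gM
  rw [Matrix.add_mulVec, Matrix.one_mulVec, add_dotProduct, ← Matrix.mulVec_mulVec]
  congr 1
  rw [dotProduct_comm, Matrix.dotProduct_mulVec, ← Matrix.mulVec_transpose, hp.eq]

theorem dotR_nonneg {p : Mt n} (hp : p.IsSymm) (v : Fin n → ℝ) : 0 ≤ v ⬝ᵥ (Rm p *ᵥ v) := by
  rw [dotR_eq hp]; exact add_nonneg (dot_nonneg _) (dot_nonneg _)

theorem unif (n : ℕ) : ∃ K : ℝ, 1 ≤ K ∧ ∀ p : Mt n, p.IsSymm → SpecBd 2 p →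
    (∀ i j, |p i j| ≤ K ∧ |Rm p i j| ≤ K ∧ |Qm p i j| ≤ K) ∧ 1 ≤ Vd p * K ∧ Vd p ≤ K ∧
      ∀ v, v ⬝ᵥ v ≤ K * (v ⬝ᵥ (Rm p *ᵥ v)) := by
  have cp : Continuous fun z : PS n => z.1 := continuous_subtype_val
  have cR := continuous_Rm cp fun z => z.2.1
  have cQ := continuous_Qm cp fun z => z.2.1
  have cV := continuous_Vd cp
  have b1 : ∀ i j, ∃ C : ℝ, ∀ y : PS n, |Rm y.1 i j| ≤ C := fun i j => exists_bd (cR.matrix_elem i j)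
  have b2 : ∀ i j, ∃ C : ℝ, ∀ y : PS n, |Qm y.1 i j| ≤ C := fun i j => exists_bd (cQ.matrix_elem i j)
  obtain ⟨C3, h3⟩ := exists_bd cV
  obtain ⟨C4, h4⟩ := exists_bd (cV.inv₀ fun z => (Vd_pos z.2.1).ne')
  choose C1 h1 using b1
  choose C2 h2 using b2
  let K := 2 + 8*(n:ℝ)^2 + (∑ i, ∑ j, |C1 i j|) + (∑ i, ∑ j, |C2 i j|) + |C3| + |C4|
  have s1 : 0 ≤ (∑ i, ∑ j, |C1 i j|) := Finset.sum_nonneg fun _ _ => Finset.sum_nonneg fun _ _ => abs_nonneg _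
  have s2 : 0 ≤ (∑ i, ∑ j, |C2 i j|) := Finset.sum_nonneg fun _ _ => Finset.sum_nonneg fun _ _ => abs_nonneg _
  have e : ∀ (C : Fin n → Fin n → ℝ) i j, C i j ≤ ∑ i, ∑ j, |C i j| := by
    intro C i j
    have a1 : |C i j| ≤ ∑ j, |C i j| := Finset.single_le_sum (f := fun j => |C i j|) (fun _ _ => abs_nonneg _) (Finset.mem_univ j)
    have a2 : ∑ j, |C i j| ≤ ∑ i, ∑ j, |C i j| := Finset.single_le_sum (f := fun i => ∑ j, |C i j|)
      (fun _ _ => Finset.sum_nonneg fun _ _ => abs_nonneg _) (Finset.mem_univ i)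
    linarith [le_abs_self (C i j)]
  have n2 : 0 ≤ 8*(n:ℝ)^2 := by positivity
  have p3 := abs_nonneg C3
  have p4 := abs_nonneg C4
  refine ⟨K, by simp only [K]; linarith, fun p hp hb => ⟨fun i j => ⟨?_, ?_, ?_⟩, ?_, ?_, fun v => ?_⟩⟩
  · refine (hb.entry hp i j).trans (by simp only [K]; linarith)
  · refine (h1 i j ⟨p, hp, hb⟩).trans (by simp only [K]; linarith [e C1 i j])
  · refine (h2 i j ⟨p, hp, hb⟩).trans (by simp only [K]; linarith [e C2 i j])
  · have : |(Vd p)⁻¹| ≤ C4 := h4 ⟨p, hp, hb⟩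
    have hV := Vd_pos hp
    rw [abs_of_pos (inv_pos.2 hV)] at this
    have hK : (Vd p)⁻¹ ≤ K := by simp only [K]; linarith [le_abs_self C4]
    calc (1:ℝ) = Vd p * (Vd p)⁻¹ := (mul_inv_cancel₀ hV.ne').symm
      _ ≤ _ := mul_le_mul_of_nonneg_left hK hV.le
  · have := h3 ⟨p, hp, hb⟩
    refine (le_abs_self _).trans (this.trans ?_)
    simp only [K]; linarith [le_abs_self C3]
  · rw [dotR_eq hp]
    set y := Rm p *ᵥ v with hy
    set z := Qm p *ᵥ v with hz
    have hv : v = y + p *ᵥ z := by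
      have : v = gM p *ᵥ y := by rw [hy, Matrix.mulVec_mulVec, gM_mul_Rm hp, Matrix.one_mulVec]
      rw [this, gM, Matrix.add_mulVec, Matrix.one_mulVec, ← Matrix.mulVec_mulVec, hz, hy, Matrix.mulVec_mulVec (M := p) (N := Rm p)]; rfl
    have hpz := mulVec_sq_le (hb.entry hp) z
    set q := p *ᵥ z
    have hle : v ⬝ᵥ v ≤ 2 * (y ⬝ᵥ y) + 2 * (q ⬝ᵥ q) := by
      rw [hv]
      simp only [dotProduct, Finset.mul_sum, ← Finset.sum_add_distrib, Pi.add_apply]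
      exact Finset.sum_le_sum fun i _ => by nlinarith [sq_nonneg (y i - q i)]
    have y0 := dot_nonneg y
    have z0 := dot_nonneg z
    have k2 : 2 ≤ K := by simp only [K]; linarith
    have k3 : 8*(n:ℝ)^2 ≤ K := by simp only [K]; linarith
    nlinarith

noncomputable def KK (n : ℕ) : ℝ := (unif n).choose
theorem KK_ge (n : ℕ) : 1 ≤ KK n := (unif n).choose_spec.1
theorem KK_pos (n : ℕ) : 0 < KK n := by linarith [KK_ge n]

theorem Sol.P_le {ν : Fin n → E n → ℝ} (h : Sol ν) (x : E n) (i j : Fin n) : |Pm ν x i j| ≤ KK n := (((unif n).choose_spec.2 _ (h.sym x) (h.bd x)).1 i j).1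
theorem Sol.R_le {ν : Fin n → E n → ℝ} (h : Sol ν) (x : E n) (i j : Fin n) : |Rm (Pm ν x) i j| ≤ KK n := (((unif n).choose_spec.2 _ (h.sym x) (h.bd x)).1 i j).2.1
theorem Sol.Q_le {ν : Fin n → E n → ℝ} (h : Sol ν) (x : E n) (i j : Fin n) : |Qm (Pm ν x) i j| ≤ KK n := (((unif n).choose_spec.2 _ (h.sym x) (h.bd x)).1 i j).2.2
theorem Sol.V_ge {ν : Fin n → E n → ℝ} (h : Sol ν) (x : E n) : 1 ≤ Vd (Pm ν x) * KK n := ((unif n).choose_spec.2 _ (h.sym x) (h.bd x)).2.1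
theorem Sol.V_le {ν : Fin n → E n → ℝ} (h : Sol ν) (x : E n) : Vd (Pm ν x) ≤ KK n := ((unif n).choose_spec.2 _ (h.sym x) (h.bd x)).2.2.1
theorem Sol.V_pos {ν : Fin n → E n → ℝ} (h : Sol ν) (x : E n) : 0 < Vd (Pm ν x) := Vd_pos (h.sym x)
theorem Sol.R_ge {ν : Fin n → E n → ℝ} (h : Sol ν) (x : E n) (v : Fin n → ℝ) : v ⬝ᵥ v ≤ KK n * (v ⬝ᵥ (Rm (Pm ν x) *ᵥ v)) :=
  ((unif n).choose_spec.2 _ (h.sym x) (h.bd x)).2.2.2 v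

end SL
end

section
set_option autoImplicit false
set_option linter.unusedVariables false
set_option linter.unusedSimpArgs false
namespace SL
open Matrix MeasureTheory Filter Topology
open scoped ContDiff

variable {n : ℕ}

/-- cutoff profile -/
noncomputable def pp (k : ℕ) (τ : ℝ) : ℝ := (max (1 - τ) 0) ^ k

theorem pp_cont (k : ℕ) : Continuous (pp k) := by unfold pp; fun_prop
theorem pp_nonneg (k : ℕ) (τ : ℝ) : 0 ≤ pp k τ := by unfold pp; positivity
theorem pp_zero {k : ℕ} (hk : k ≠ 0) {τ : ℝ} (h : 1 ≤ τ) : pp k τ = 0 := by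
  unfold pp; rw [max_eq_right (by linarith), zero_pow hk]
theorem pp_le_one (k : ℕ) {τ : ℝ} (h : 0 ≤ τ) : pp k τ ≤ 1 := by
  unfold pp; exact pow_le_one₀ (le_max_right _ _) (max_le (by linarith) (by norm_num))
theorem pp_succ_le (k : ℕ) {τ : ℝ} (h : 0 ≤ τ) : pp (k+1) τ ≤ pp k τ := by
  unfold pp; exact pow_le_pow_of_le_one (le_max_right _ _) (max_le (by linarith) (by norm_num)) (Nat.le_succ k)
theorem pp_anti (k : ℕ) {a b : ℝ} (h : a ≤ b) : pp k b ≤ pp k a := by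
  unfold pp; gcongr

theorem pp_deriv (k : ℕ) (τ : ℝ) : HasDerivAt (pp (k+2)) (-((k:ℝ)+2) * pp (k+1) τ) τ := by
  have hne : ∀ y, y ≠ 1 → HasDerivAt (pp (k+2)) (-((k:ℝ)+2) * pp (k+1) y) y := by
    intro y hy
    rcases lt_or_gt_of_ne hy with h | h
    · have h1 : HasDerivAt (fun z : ℝ => (1 - z)^(k+2)) (-((k:ℝ)+2) * pp (k+1) y) y := by
        have := ((hasDerivAt_id y).const_sub 1).pow (k+2)
        unfold pp
        rw [max_eq_left (by linarith)]
        refine HasDerivAt.congr_deriv (f := fun z : ℝ => (1 - z)^(k+2)) this ?_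
        push_cast
        simp only [id]
        ring
      refine h1.congr_of_eventuallyEq ?_
      filter_upwards [Iio_mem_nhds h] with z hz
      unfold pp; rw [max_eq_left (by simp at hz; linarith)]
    · rw [pp_zero (by simp) h.le, mul_zero]
      refine (hasDerivAt_const y (0:ℝ)).congr_of_eventuallyEq ?_
      filter_upwards [Ioi_mem_nhds h] with z hz
      exact pp_zero (by simp) (le_of_lt hz)
  by_cases h : τ = 1
  · exact hasDerivAt_of_hasDerivAt_of_ne' (x := 1) hne (pp_cont _).continuousAt
      (continuous_const.mul (pp_cont _)).continuousAt τ
  · exact hne τ h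

theorem pp_contDiff (k : ℕ) : ContDiff ℝ 1 (pp (k+2)) := by
  rw [contDiff_one_iff_deriv]
  refine ⟨fun τ => (pp_deriv k τ).differentiableAt, ?_⟩
  rw [show deriv (pp (k+2)) = fun τ => -((k:ℝ)+2) * pp (k+1) τ from funext fun τ => (pp_deriv k τ).deriv]
  exact continuous_const.mul (pp_cont _)

theorem Sm.c1 {f : E n → ℝ} (h : Sm f) : ContDiff ℝ 1 f := ContDiff.of_le h (by norm_cast)

theorem ibp1 {X c : E n → ℝ} (hX : ContDiff ℝ 1 X) (hc : ContDiff ℝ 1 c) (hs : HasCompactSupport c) (k : Fin n) :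
    ∫ x, c x * pd k X x = - ∫ x, X x * pd k c x := by
  have h1 := integral_pd_zero (hc.mul hX) (hs.mul_right) k
  have e : ∀ x, pd k (fun x => c x * X x) x = c x * pd k X x + X x * pd k c x := fun x => by
    rw [pd_mul k (hc.differentiable (by simp) x) (hX.differentiable (by simp) x)]; ring
  have cX : Continuous (pd k X) := (hX.continuous_fderiv (by simp)).clm_apply continuous_const
  have cc : Continuous (pd k c) := (hc.continuous_fderiv (by simp)).clm_apply continuous_const
  have hs' : HasCompactSupport (pd k c) := (hs.fderiv_apply ℝ _)
  change ∫ x, pd k (fun x => c x * X x) x = 0 at h1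
  simp only [e] at h1
  rw [integral_add] at h1
  · linarith
  · exact (hc.continuous.mul cX).integrable_of_hasCompactSupport hs.mul_right
  · exact (hX.continuous.mul cc).integrable_of_hasCompactSupport hs'.mul_left

theorem ibp {X : Fin n → E n → ℝ} {c : E n → ℝ} (hX : ∀ k, ContDiff ℝ 1 (X k)) (hc : ContDiff ℝ 1 c)
    (hs : HasCompactSupport c) :
    ∫ x, c x * ∑ k, pd k (X k) x = - ∫ x, ∑ k, X k x * pd k c x := by
  have cX : ∀ k, Continuous (pd k (X k)) := fun k => ((hX k).continuous_fderiv (by simp)).clm_apply continuous_const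
  have cc : ∀ k, Continuous (pd k c) := fun k => (hc.continuous_fderiv (by simp)).clm_apply continuous_const
  have hs' : ∀ k, HasCompactSupport (pd k c) := fun k => (hs.fderiv_apply ℝ _)
  simp only [Finset.mul_sum]
  rw [integral_finsetSum, integral_finsetSum, ← Finset.sum_neg_distrib]
  · exact Finset.sum_congr rfl fun k _ => ibp1 (hX k) hc hs k
  · exact fun k _ => ((hX k).continuous.mul (cc k)).integrable_of_hasCompactSupport (hs' k).mul_left
  · exact fun k _ => (hc.continuous.mul (cX k)).integrable_of_hasCompactSupport hs.mul_right

noncomputable def tt (ν : Fin n → E n → ℝ) (x : E n) : ℝ := ∑ i, x i ^ 2 + ∑ i, ν i x ^ 2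
noncomputable def xi (ν : Fin n → E n → ℝ) (x : E n) : Fin n → ℝ := x + Pm ν x *ᵥ (fun i => ν i x)
noncomputable def wv (ν : Fin n → E n → ℝ) (x : E n) : Fin n → ℝ := Pm ν x *ᵥ x - (fun i => ν i x)
noncomputable def Lop (ν : Fin n → E n → ℝ) (f : E n → ℝ) (x : E n) : ℝ :=
  ∑ k, ∑ b, Rm (Pm ν x) k b * pd k (pd b f) x

theorem tt_nonneg (ν : Fin n → E n → ℝ) (x : E n) : 0 ≤ tt ν x :=
  add_nonneg (Finset.sum_nonneg fun _ _ => sq_nonneg _) (Finset.sum_nonneg fun _ _ => sq_nonneg _)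
theorem sq_le_tt (ν : Fin n → E n → ℝ) (x : E n) (i : Fin n) : x i ^ 2 ≤ tt ν x := by
  have h1 : x i ^2 ≤ ∑ i, x i ^ 2 := Finset.single_le_sum (f := fun i => x i ^ 2) (fun _ _ => sq_nonneg _) (Finset.mem_univ i)
  have h2 : 0 ≤ ∑ i, ν i x ^ 2 := Finset.sum_nonneg fun _ _ => sq_nonneg _
  unfold tt; linarith
theorem nu_sq_le_tt (ν : Fin n → E n → ℝ) (x : E n) (i : Fin n) : ν i x ^ 2 ≤ tt ν x := by
  have h1 : ν i x ^2 ≤ ∑ i, ν i x ^ 2 := Finset.single_le_sum (f := fun i => ν i x ^ 2) (fun _ _ => sq_nonneg _) (Finset.mem_univ i)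
  have h2 : 0 ≤ ∑ i, x i ^ 2 := Finset.sum_nonneg fun _ _ => sq_nonneg _
  unfold tt; linarith

theorem norm_le_of_tt {ν : Fin n → E n → ℝ} {x : E n} {s : ℝ} (hs : 0 ≤ s) (h : tt ν x ≤ s^2) : ‖x‖ ≤ s := by
  refine (pi_norm_le_iff_of_nonneg hs).2 fun i => ?_
  have := sq_le_tt ν x i
  rw [Real.norm_eq_abs]
  exact abs_le_of_sq_le_sq (this.trans h) hs

theorem Sol.sm_tt {ν : Fin n → E n → ℝ} (h : Sol ν) : Sm (tt ν) :=
  (Sm.sum fun i => (Sm.coord i).pow 2).add (Sm.sum fun i => (h.sm i).pow 2)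
theorem Sol.sm_xi {ν : Fin n → E n → ℝ} (h : Sol ν) (b : Fin n) : Sm (fun x => xi ν x b) := by
  simp only [xi, Pi.add_apply, Matrix.mulVec, dotProduct]
  exact (Sm.coord b).add (Sm.sum fun i => (h.smP b i).mul (h.sm i))
theorem Sol.sm_w {ν : Fin n → E n → ℝ} (h : Sol ν) (b : Fin n) : Sm (fun x => wv ν x b) := by
  simp only [wv, Pi.sub_apply, Matrix.mulVec, dotProduct]
  exact (Sm.sum fun i => (h.smP b i).mul (Sm.coord i)).sub (h.sm b)

theorem Sol.pd_tt {ν : Fin n → E n → ℝ} (h : Sol ν) (b : Fin n) (x : E n) : pd b (tt ν) x = 2 * xi ν x b := by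
  unfold tt
  rw [pd_add b ((Sm.sum fun i => (Sm.coord i).pow 2 : Sm fun x : E n => ∑ i, x i ^2).diff x)
    ((Sm.sum fun i => (h.sm i).pow 2 : Sm fun x : E n => ∑ i, ν i x ^2).diff x),
    pd_sum b (fun i => ((Sm.coord i).pow 2).diff x), pd_sum b (fun i => ((h.sm i).pow 2).diff x)]
  have e1 : ∀ i, pd b (fun y : E n => y i ^ 2) x = 2 * x i * (if i = b then 1 else 0) := fun i => by
    rw [pd_comp (f := fun y : E n => y i) b (hasDerivAt_pow 2 (x i)) ((Sm.coord i).diff x), pd_coord]; simp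
  have e2 : ∀ i, pd b (fun y => ν i y ^ 2) x = 2 * ν i x * Pm ν x b i := fun i => by
    rw [pd_comp b (hasDerivAt_pow 2 (ν i x)) ((h.sm i).diff x), ← (h.sym x).apply]; simp; left; rfl
  simp only [e1, e2, xi, Pi.add_apply, Matrix.mulVec, dotProduct]
  simp only [mul_ite, mul_one, mul_zero, Finset.sum_ite_eq', Finset.mem_univ, if_true, mul_add, Finset.mul_sum]
  congr 1
  exact Finset.sum_congr rfl fun i _ => by ring

theorem Sol.pd_xi {ν : Fin n → E n → ℝ} (h : Sol ν) (k b : Fin n) (x : E n) :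
    pd k (fun y => xi ν y b) x = gM (Pm ν x) k b + ∑ i, ν i x * Tm ν x i k b := by
  simp only [xi, Pi.add_apply, Matrix.mulVec, dotProduct]
  rw [pd_add k ((Sm.coord b).diff x) ((Sm.sum fun i => (h.smP b i).mul (h.sm i) : Sm fun x : E n => ∑ i, Pm ν x b i * ν i x).diff x),
    pd_coord, pd_sum k (fun i => ((h.smP b i).mul (h.sm i)).diff x)]
  have e : ∀ i, pd k (fun y => Pm ν y b i * ν i y) x = ν i x * Tm ν x i k b + Pm ν x k i * Pm ν x i b := fun i => by
    rw [pd_mul k ((h.smP b i).diff x) ((h.sm i).diff x)]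
    have a1 : pd k (fun y => Pm ν y b i) x = Tm ν x i k b := by
      change Tm ν x k b i = _
      rw [(h.ts x).1 k b i, (h.ts x).2 k i b]
    have a2 : pd k (ν i) x = Pm ν x k i := by rw [← (h.sym x).apply]; rfl
    rw [a1, a2, (h.sym x).apply b i]; ring
  simp only [e, Finset.sum_add_distrib, gM, Matrix.add_apply, Matrix.one_apply, Matrix.mul_apply]
  rw [show (if b = k then (1:ℝ) else 0) = if k = b then 1 else 0 by simp [eq_comm]]
  ring

theorem Sol.L_tt {ν : Fin n → E n → ℝ} (h : Sol ν) (x : E n) :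
    ∑ k, ∑ b, Rm (Pm ν x) k b * pd k (fun y => xi ν y b) x = n := by
  simp only [h.pd_xi, mul_add, Finset.sum_add_distrib, Finset.mul_sum]
  have e1 : ∑ k, ∑ b, Rm (Pm ν x) k b * gM (Pm ν x) k b = n := by
    have : (Rm (Pm ν x) * gM (Pm ν x)).trace = n := by rw [Rm_mul_gM (h.sym x)]; simp
    rw [← this, trace_mul_eq]
    exact Finset.sum_congr rfl fun i _ => Finset.sum_congr rfl fun j _ => by rw [(gM_symm (h.sym x)).apply]
  have e2 : ∑ k, ∑ b, ∑ i, Rm (Pm ν x) k b * (ν i x * Tm ν x i k b) = ∑ i, ν i x * (Rm (Pm ν x) * Tm ν x i).trace := by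
    simp only [trace_mul_eq, Finset.mul_sum]
    rw [show ∑ k, ∑ b, ∑ i, Rm (Pm ν x) k b * (ν i x * Tm ν x i k b) = ∑ k, ∑ i, ∑ b, Rm (Pm ν x) k b * (ν i x * Tm ν x i k b) from
      Finset.sum_congr rfl fun k _ => Finset.sum_comm, Finset.sum_comm]
    refine Finset.sum_congr rfl fun i _ => Finset.sum_congr rfl fun k _ => Finset.sum_congr rfl fun b _ => ?_
    rw [(h.ts x).1 i b k]; ring
  rw [e1, e2]
  simp [(h.phase' _ x).1]

theorem Sol.R_xi {ν : Fin n → E n → ℝ} (h : Sol ν) (x : E n) :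
    Rm (Pm ν x) *ᵥ xi ν x = x - Qm (Pm ν x) *ᵥ wv ν x := by
  have h1 : Rm (Pm ν x) * Pm ν x = Qm (Pm ν x) := (p_Rm (h.sym x)).symm
  have h2 : Qm (Pm ν x) * Pm ν x = 1 - Rm (Pm ν x) := by rw [← Rm_add (h.sym x)]; abel
  unfold xi wv
  rw [Matrix.mulVec_add, Matrix.mulVec_mulVec, Matrix.mulVec_sub, Matrix.mulVec_mulVec, h1, h2, Matrix.sub_mulVec, Matrix.one_mulVec]
  abel

theorem Sol.tt_eq {ν : Fin n → E n → ℝ} (h : Sol ν) (x : E n) :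
    xi ν x ⬝ᵥ (Rm (Pm ν x) *ᵥ xi ν x) + wv ν x ⬝ᵥ (Rm (Pm ν x) *ᵥ wv ν x) = tt ν x := by
  have h1 : Rm (Pm ν x) * Pm ν x = Qm (Pm ν x) := (p_Rm (h.sym x)).symm
  have h2 : Pm ν x * Qm (Pm ν x) = 1 - Rm (Pm ν x) := by
    rw [← Rm_add (h.sym x), ← h1, ← mul_assoc, ← p_Rm (h.sym x)]; simp [Qm, mul_assoc]
  set N : Fin n → ℝ := fun i => ν i x with hN
  have tr : ∀ (a b : Fin n → ℝ), (Pm ν x *ᵥ a) ⬝ᵥ b = a ⬝ᵥ (Pm ν x *ᵥ b) := by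
    intro a b; rw [Matrix.dotProduct_mulVec, ← Matrix.mulVec_transpose, (h.sym x).eq]
  have e1 : Rm (Pm ν x) *ᵥ xi ν x = Rm (Pm ν x) *ᵥ x + Qm (Pm ν x) *ᵥ N := by
    unfold xi; rw [Matrix.mulVec_add, Matrix.mulVec_mulVec, h1]
  have e2 : Rm (Pm ν x) *ᵥ wv ν x = Qm (Pm ν x) *ᵥ x - Rm (Pm ν x) *ᵥ N := by
    unfold wv; rw [Matrix.mulVec_sub, Matrix.mulVec_mulVec, h1]
  have ht : tt ν x = x ⬝ᵥ x + N ⬝ᵥ N := by simp [tt, dotProduct, sq, hN]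
  rw [e1, e2, ht]
  unfold xi wv
  rw [add_dotProduct, sub_dotProduct, tr, tr]
  simp only [Matrix.mulVec_add, Matrix.mulVec_sub, Matrix.mulVec_mulVec, h2, Matrix.sub_mulVec, Matrix.one_mulVec, dotProduct_add, dotProduct_sub]
  have h3 : Pm ν x * Rm (Pm ν x) = Qm (Pm ν x) := rfl
  have qs : N ⬝ᵥ (Qm (Pm ν x) *ᵥ x) = x ⬝ᵥ (Qm (Pm ν x) *ᵥ N) := by
    rw [Matrix.dotProduct_mulVec, ← Matrix.mulVec_transpose, (Qm_symm (h.sym x)).eq, dotProduct_comm]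
  rw [h3, qs]
  ring

theorem Sol.pd_w {ν : Fin n → E n → ℝ} (h : Sol ν) (j i : Fin n) (x : E n) :
    pd j (fun y => wv ν y i) x = ∑ b, Tm ν x b i j * x b := by
  simp only [wv, Pi.sub_apply, Matrix.mulVec, dotProduct]
  rw [pd_sub j ((Sm.sum fun b => (h.smP i b).mul (Sm.coord b) : Sm fun x : E n => ∑ b, Pm ν x i b * x b).diff x) ((h.sm i).diff x),
    pd_sum j (fun b => ((h.smP i b).mul (Sm.coord b)).diff x)]
  have e : ∀ b, pd j (fun y => Pm ν y i b * y b) x = Tm ν x b i j * x b + Pm ν x i b * (if b = j then 1 else 0) := fun b => by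
    rw [pd_mul j ((h.smP i b).diff x) ((Sm.coord b).diff x), pd_coord]
    have a1 : pd j (fun y => Pm ν y i b) x = Tm ν x b i j := by
      change Tm ν x j i b = _
      rw [(h.ts x).1 j i b, (h.ts x).2 j b i, (h.ts x).1 b j i]
    rw [a1]
  simp only [e, Finset.sum_add_distrib]
  simp
  rw [show pd j (ν i) x = Pm ν x i j from rfl]; ring

end SL
end

section
set_option autoImplicit false
set_option linter.unusedVariables false
set_option linter.unusedSimpArgs false
namespace SL
open Matrix MeasureTheory Filter Topology
open scoped ContDiff

variable {n : ℕ}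

/-- cutoff function at scale `s` -/
noncomputable def ct (k : ℕ) (s : ℝ) (ν : Fin n → E n → ℝ) (x : E n) : ℝ := pp k (tt ν x / s^2)

theorem ct_nonneg (k : ℕ) (s : ℝ) (ν : Fin n → E n → ℝ) (x : E n) : 0 ≤ ct k s ν x := pp_nonneg _ _
theorem ct_le_one (k : ℕ) (s : ℝ) (ν : Fin n → E n → ℝ) (x : E n) : ct k s ν x ≤ 1 :=
  pp_le_one _ (div_nonneg (tt_nonneg _ _) (sq_nonneg _))
theorem ct_succ_le (k : ℕ) (s : ℝ) (ν : Fin n → E n → ℝ) (x : E n) : ct (k+1) s ν x ≤ ct k s ν x :=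
  pp_succ_le _ (div_nonneg (tt_nonneg _ _) (sq_nonneg _))

theorem ct_supp {k : ℕ} (hk : k ≠ 0) {s : ℝ} (hs : 0 < s) {ν : Fin n → E n → ℝ} {x : E n} (h : ct k s ν x ≠ 0) :
    tt ν x < s^2 := by
  by_contra hcon
  exact h (pp_zero hk (by rw [le_div_iff₀ (by positivity)]; linarith))

theorem ct_hcs {k : ℕ} (hk : k ≠ 0) {s : ℝ} (hs : 0 < s) (ν : Fin n → E n → ℝ) : HasCompactSupport (ct k s ν) := by
  refine HasCompactSupport.intro (isCompact_closedBall (0 : E n) s) fun x hx => ?_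
  by_contra hcon
  exact hx (by rw [mem_closedBall_zero_iff]; exact norm_le_of_tt hs.le (ct_supp hk hs hcon).le)

theorem Sol.ct_cont {ν : Fin n → E n → ℝ} (h : Sol ν) (k : ℕ) (s : ℝ) : Continuous (ct k s ν) :=
  (pp_cont k).comp (h.sm_tt.cont.div_const _)

theorem Sol.ct_c1 {ν : Fin n → E n → ℝ} (h : Sol ν) (k : ℕ) (s : ℝ) : ContDiff ℝ 1 (ct (k+2) s ν) :=
  (pp_contDiff k).comp (h.sm_tt.c1.div_const _)

theorem Sol.pd_ct {ν : Fin n → E n → ℝ} (h : Sol ν) (k : ℕ) (s : ℝ) (j : Fin n) (x : E n) :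
    pd j (ct (k+2) s ν) x = -((k:ℝ)+2) * ct (k+1) s ν x * (2 * xi ν x j / s^2) := by
  have hd : Sm (fun y => tt ν y / s^2) := by
    simp only [div_eq_mul_inv]; exact h.sm_tt.mul (Sm.const _)
  have := pd_comp (f := fun y => tt ν y / s^2) j (pp_deriv k (tt ν x / s^2)) (hd.diff x)
  unfold ct
  rw [this]
  congr 1
  simp only [div_eq_mul_inv]
  rw [pd_mul j (h.sm_tt.diff x) (differentiableAt_const _), pd_const, h.pd_tt]; ring

theorem Sol.ct_int {ν : Fin n → E n → ℝ} (h : Sol ν) {k : ℕ} (hk : k ≠ 0) {s : ℝ} (hs : 0 < s) {g : E n → ℝ} (hg : Continuous g) :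
    Integrable (fun x => ct k s ν x * g x) :=
  ((h.ct_cont k s).mul hg).integrable_of_hasCompactSupport (ct_hcs hk hs ν).mul_right

theorem Sol.Yxi {ν : Fin n → E n → ℝ} (h : Sol ν) (k : Fin n) :
    Sm (fun y => Vd (Pm ν y) * ∑ b, Rm (Pm ν y) k b * xi ν y b) :=
  h.smV.mul (Sm.sum fun b => (h.smR k b).mul (h.sm_xi b))

theorem Sol.mono_id {ν : Fin n → E n → ℝ} (h : Sol ν) {f : E n → ℝ} (hf : Sm f) {s : ℝ} (hs : 0 < s) :
    s^2 * ∫ x, ct 4 s ν x * (Vd (Pm ν x) * Lop ν f x) =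
      ∫ x, (48 / s^2 * (ct 2 s ν x * (f x * Vd (Pm ν x) * (xi ν x ⬝ᵥ (Rm (Pm ν x) *ᵥ xi ν x)))) -
        8 * n * (ct 3 s ν x * (f x * Vd (Pm ν x)))) := by
  have s2 : (s^2) ≠ 0 := by positivity
  set Y : Fin n → E n → ℝ := fun k y => Vd (Pm ν y) * ∑ b, Rm (Pm ν y) k b * xi ν y b with hY
  have smY : ∀ k, Sm (Y k) := h.Yxi
  have divY : ∀ x, ∑ k, pd k (Y k) x = Vd (Pm ν x) * n := fun x => by
    rw [← h.L_tt x]; exact h.divR h.sm_xi x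
  set X : Fin n → E n → ℝ := fun k y => Vd (Pm ν y) * ∑ b, Rm (Pm ν y) k b * pd b f y with hX
  have smX : ∀ k, Sm (X k) := fun k => h.smV.mul (Sm.sum fun b => (h.smR k b).mul (hf.pd b))
  have divX : ∀ x, ∑ k, pd k (X k) x = Vd (Pm ν x) * Lop ν f x := fun x => h.divR (fun b => hf.pd b) x
  have i1 := ibp (fun k => (smX k).c1) (h.ct_c1 2 s) (ct_hcs (by simp) hs ν)
  simp only [divX] at i1
  have i2 := ibp (fun k => (hf.mul (smY k)).c1) (h.ct_c1 1 s) (ct_hcs (by simp) hs ν)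
  have dfY : ∀ x, ∑ k, pd k (fun y => f y * Y k y) x = (∑ k, pd k f x * Y k x) + f x * (Vd (Pm ν x) * n) := fun x => by
    rw [← divY, Finset.mul_sum, ← Finset.sum_add_distrib]
    exact Finset.sum_congr rfl fun k _ => pd_mul k (hf.diff x) ((smY k).diff x)
  simp only [dfY] at i2
  have swap : ∀ x, ∑ k, X k x * xi ν x k = ∑ k, pd k f x * Y k x := fun x => by
    simp only [hX, hY, Finset.mul_sum, Finset.sum_mul]
    rw [Finset.sum_comm]
    refine Finset.sum_congr rfl fun a _ => Finset.sum_congr rfl fun b _ => ?_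
    rw [(Rm_symm (h.sym x)).apply a b]; ring
  have e1 : ∀ x, ∑ k, X k x * pd k (ct 4 s ν) x = -(8 / s^2) * (ct 3 s ν x * ∑ k, pd k f x * Y k x) := fun x => by
    rw [← swap, Finset.mul_sum, Finset.mul_sum]
    refine Finset.sum_congr rfl fun k _ => ?_
    rw [h.pd_ct 2 s k x]; push_cast; field_simp; ring
  have e2 : ∀ x, ∑ k, f x * Y k x * pd k (ct 3 s ν) x = -(6 / s^2) * (ct 2 s ν x * (f x * Vd (Pm ν x) * (xi ν x ⬝ᵥ (Rm (Pm ν x) *ᵥ xi ν x)))) := fun x => by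
    simp only [dotProduct, Matrix.mulVec]
    rw [Finset.mul_sum, Finset.mul_sum, Finset.mul_sum]
    refine Finset.sum_congr rfl fun k _ => ?_
    rw [h.pd_ct 1 s k x]; simp only [hY]; push_cast; field_simp; ring
  have cD : Continuous fun x => ∑ k, pd k f x * Y k x := (Sm.sum fun k => (hf.pd k).mul (smY k) : Sm fun x => ∑ k, pd k f x * Y k x).cont
  have cf := hf.cont
  have cV := h.smV.cont
  have cX : Continuous fun x => xi ν x ⬝ᵥ (Rm (Pm ν x) *ᵥ xi ν x) := by
    simp only [dotProduct, Matrix.mulVec]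
    exact (Sm.sum fun i => (h.sm_xi i).mul (Sm.sum fun j => (h.smR i j).mul (h.sm_xi j)) : Sm fun x => ∑ i, xi ν x i * ∑ j, Rm (Pm ν x) i j * xi ν x j).cont
  simp only [e1, integral_const_mul] at i1
  simp only [e2, integral_const_mul, mul_add] at i2
  rw [integral_add (h.ct_int (by simp) hs cD) (h.ct_int (by simp) hs (by fun_prop))] at i2
  rw [integral_sub ((h.ct_int (by simp) hs (by fun_prop)).const_mul _) ((h.ct_int (by simp) hs (by fun_prop)).const_mul _), integral_const_mul, integral_const_mul]
  have e3 : ∫ x, ct 3 s ν x * (f x * (Vd (Pm ν x) * n)) = n * ∫ x, ct 3 s ν x * (f x * Vd (Pm ν x)) := by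
    rw [← integral_const_mul]; congr 1; funext x; ring
  rw [e3] at i2
  simp only [Nat.reduceAdd] at i1 i2
  rw [i1]
  have i3 : ∫ x, ct 3 s ν x * ∑ k, pd k f x * Y k x = 6 / s^2 * (∫ x, ct 2 s ν x * (f x * Vd (Pm ν x) * (xi ν x ⬝ᵥ (Rm (Pm ν x) *ᵥ xi ν x)))) - n * ∫ x, ct 3 s ν x * (f x * Vd (Pm ν x)) := by
    linarith
  rw [i3]
  field_simp
  ring

theorem param_deriv {ν : Fin n → E n → ℝ} (h : Sol ν) {g : E n → ℝ} (hg : Continuous g) {s : ℝ} (hs : 0 < s) :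
    HasDerivAt (fun s => ∫ x, ct 3 s ν x * g x) (∫ x, 6 / s^3 * (ct 2 s ν x * (g x * tt ν x))) s := by
  have ht := h.sm_tt.cont
  have key := hasDerivAt_integral_of_dominated_loc_of_deriv_le (μ := (volume : Measure (E n)))
    (F := fun s x => ct 3 s ν x * g x) (F' := fun s x => 6 / s^3 * (ct 2 s ν x * (g x * tt ν x))) (x₀ := s)
    (s := Metric.ball s (s/2)) (bound := (Metric.closedBall (0 : E n) (2*s)).indicator (fun x => 6 / (s/2)^3 * (|g x| * tt ν x)))
    (Metric.ball_mem_nhds s (by linarith)) (Eventually.of_forall fun r => ((h.ct_cont 3 r).mul hg).aestronglyMeasurable)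
    (h.ct_int (by simp) hs hg) (by
      exact (continuous_const.mul ((h.ct_cont 2 s).mul (hg.mul ht))).aestronglyMeasurable)
    (Eventually.of_forall fun x r hr => ?_) ?_ (Eventually.of_forall fun x r hr => ?_)
  · exact key.2
  · have hr' : s/2 < r ∧ r < 2*s := by
      rw [Metric.mem_ball, Real.dist_eq, abs_lt] at hr; constructor <;> linarith
    have hr0 : 0 < r := by linarith
    by_cases h0 : ct 2 r ν x = 0
    · simp only [h0, zero_mul, mul_zero, norm_zero]
      refine Set.indicator_nonneg (fun x _ => ?_) x
      have := tt_nonneg ν x; positivity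
    · have hx : x ∈ Metric.closedBall (0 : E n) (2*s) := by
        rw [mem_closedBall_zero_iff]
        exact (norm_le_of_tt hr0.le (ct_supp (by simp) hr0 h0).le).trans hr'.2.le
      rw [Set.indicator_of_mem hx]
      have t0 := tt_nonneg ν x
      have c0 := ct_nonneg 2 r ν x
      have c1 := ct_le_one 2 r ν x
      rw [norm_mul, norm_mul, norm_mul, Real.norm_eq_abs, Real.norm_eq_abs, Real.norm_eq_abs, Real.norm_eq_abs,
        abs_of_pos (by positivity), abs_of_nonneg c0, abs_of_nonneg t0]
      have h1 : 6 / r^3 ≤ 6 / (s/2)^3 := by gcongr; exact hr'.1.le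
      have h2 : ct 2 r ν x * (|g x| * tt ν x) ≤ 1 * (|g x| * tt ν x) := by gcongr
      rw [one_mul] at h2
      exact mul_le_mul h1 h2 (by positivity) (by positivity)
  · rw [integrable_indicator_iff measurableSet_closedBall]
    exact (continuous_const.mul (hg.abs.mul ht)).continuousOn.integrableOn_compact (isCompact_closedBall _ _)
  · have hr' : s/2 < r := by
      rw [Metric.mem_ball, Real.dist_eq, abs_lt] at hr; linarith
    have hr0 : 0 < r := by linarith
    have d1 : HasDerivAt (fun r : ℝ => tt ν x / r^2) (-(2 * tt ν x / r^3)) r := by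
      have := (hasDerivAt_pow 2 r).inv (by positivity) |>.const_mul (tt ν x)
      refine this.congr_deriv ?_
      field_simp; simp; ring
    have d2 := (pp_deriv 1 (tt ν x / r^2)).comp r d1
    have d3 := d2.mul_const (g x)
    refine d3.congr_deriv ?_
    unfold ct; push_cast; field_simp; ring

noncomputable def If (ν : Fin n → E n → ℝ) (f : E n → ℝ) (s : ℝ) : ℝ :=
  (s^n)⁻¹ * ∫ x, ct 3 s ν x * (f x * Vd (Pm ν x))

theorem Sol.If_deriv {ν : Fin n → E n → ℝ} (h : Sol ν) {f : E n → ℝ} (hf : Sm f) {s : ℝ} (hs : 0 < s) :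
    HasDerivAt (If ν f) ((8 * s^(n+1))⁻¹ * (s^2 * (∫ x, ct 4 s ν x * (Vd (Pm ν x) * Lop ν f x))
      + 48 / s^2 * ∫ x, ct 2 s ν x * (f x * Vd (Pm ν x) * (wv ν x ⬝ᵥ (Rm (Pm ν x) *ᵥ wv ν x))))) s := by
  have cf := hf.cont
  have cV := h.smV.cont
  have cX : Continuous fun x => xi ν x ⬝ᵥ (Rm (Pm ν x) *ᵥ xi ν x) := by
    simp only [dotProduct, Matrix.mulVec]
    exact (Sm.sum fun i => (h.sm_xi i).mul (Sm.sum fun j => (h.smR i j).mul (h.sm_xi j)) : Sm fun x => ∑ i, xi ν x i * ∑ j, Rm (Pm ν x) i j * xi ν x j).cont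
  have cW : Continuous fun x => wv ν x ⬝ᵥ (Rm (Pm ν x) *ᵥ wv ν x) := by
    simp only [dotProduct, Matrix.mulVec]
    exact (Sm.sum fun i => (h.sm_w i).mul (Sm.sum fun j => (h.smR i j).mul (h.sm_w j)) : Sm fun x => ∑ i, wv ν x i * ∑ j, Rm (Pm ν x) i j * wv ν x j).cont
  have ht := h.sm_tt.cont
  have d1 := param_deriv h (g := fun x => f x * Vd (Pm ν x)) (by fun_prop) hs
  have d0 : HasDerivAt (fun r : ℝ => (r^n)⁻¹) (-(n * (s^(n+1))⁻¹)) s := by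
    refine ((hasDerivAt_pow n s).inv (by positivity)).congr_deriv ?_
    rcases n with _ | m
    · simp
    · simp only [Nat.add_sub_cancel]; field_simp; ring
  refine (d0.mul d1).congr_deriv ?_
  rw [h.mono_id hf hs]
  rw [integral_sub ((h.ct_int (by simp) hs (by fun_prop)).const_mul _) ((h.ct_int (by simp) hs (by fun_prop)).const_mul _), integral_const_mul (48/s^2), integral_const_mul (8*(n:ℝ))]
  have e : ∫ x, 6 / s^3 * (ct 2 s ν x * (f x * Vd (Pm ν x) * tt ν x)) = 6 / s^3 *
     ((∫ x, ct 2 s ν x * (f x * Vd (Pm ν x) * (xi ν x ⬝ᵥ (Rm (Pm ν x) *ᵥ xi ν x)))) +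
      ∫ x, ct 2 s ν x * (f x * Vd (Pm ν x) * (wv ν x ⬝ᵥ (Rm (Pm ν x) *ᵥ wv ν x)))) := by
    rw [integral_const_mul, ← integral_add (h.ct_int (by simp) hs (by fun_prop)) (h.ct_int (by simp) hs (by fun_prop))]
    congr 2; funext x; rw [← h.tt_eq x]; ring
  rw [e]
  field_simp
  ring

end SL
end

section
set_option autoImplicit false
set_option linter.unusedVariables false
set_option linter.unusedSimpArgs false
namespace SL
open Matrix MeasureTheory Filter Topology
open scoped ContDiff

variable {n : ℕ}

/-- rescaled gradient map -/
noncomputable def sc (ν : Fin n → E n → ℝ) (x0 : E n) (r : ℝ) : Fin n → E n → ℝ :=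
  fun i x => (ν i (x0 + r • x) - ν i x0) * r⁻¹

theorem Sm.comp_aff {f : E n → ℝ} (hf : Sm f) (x0 : E n) (r : ℝ) : Sm (fun x => f (x0 + r • x)) := by
  refine ContDiff.comp (g := f) hf ?_
  fun_prop

theorem pd_aff {f : E n → ℝ} (hf : Sm f) (x0 : E n) (r : ℝ) (k : Fin n) (x : E n) :
    pd k (fun x => f (x0 + r • x)) x = r * pd k f (x0 + r • x) := by
  unfold pd
  have h1 : HasFDerivAt (fun x : E n => x0 + r • x) (r • ContinuousLinearMap.id ℝ (E n)) x :=
    ((hasFDerivAt_id x).const_smul r).const_add x0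
  have h2 := (hf.diff (x0 + r • x)).hasFDerivAt.comp x h1
  rw [show (fun x => f (x0 + r • x)) = f ∘ (fun x : E n => x0 + r • x) from rfl, h2.fderiv]
  simp

theorem Sol.sc_sm {ν : Fin n → E n → ℝ} (h : Sol ν) (x0 : E n) (r : ℝ) (i : Fin n) : Sm (sc ν x0 r i) :=
  (((h.sm i).comp_aff x0 r).sub (Sm.const _)).mul (Sm.const _)

theorem Sol.sc_P {ν : Fin n → E n → ℝ} (h : Sol ν) (x0 : E n) {r : ℝ} (hr : r ≠ 0) (x : E n) :
    Pm (sc ν x0 r) x = Pm ν (x0 + r • x) := by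
  ext i j
  change pd j (sc ν x0 r i) x = pd j (ν i) (x0 + r • x)
  unfold sc
  rw [pd_mul j ((((h.sm i).comp_aff x0 r).sub (Sm.const _)).diff x) (differentiableAt_const _), pd_const,
    pd_sub j (((h.sm i).comp_aff x0 r).diff x) (differentiableAt_const _), pd_const, pd_aff (h.sm i)]
  field_simp; ring

theorem Sol.sc_T {ν : Fin n → E n → ℝ} (h : Sol ν) (x0 : E n) {r : ℝ} (hr : r ≠ 0) (x : E n) :
    Tm (sc ν x0 r) x = r • Tm ν (x0 + r • x) := by
  funext k
  ext i j
  change pd k (fun y => Pm (sc ν x0 r) y i j) x = r * pd k (fun y => Pm ν y i j) (x0 + r • x)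
  simp only [h.sc_P x0 hr]
  exact pd_aff (h.smP i j) x0 r k x

theorem Sol.sc {ν : Fin n → E n → ℝ} (h : Sol ν) (x0 : E n) {r : ℝ} (hr : r ≠ 0) : Sol (sc ν x0 r) where
  sm := h.sc_sm x0 r
  sym := fun x => by rw [h.sc_P x0 hr]; exact h.sym _
  bd := fun x => by rw [h.sc_P x0 hr]; exact h.bd _
  phase := by
    obtain ⟨om, ho⟩ := h.phase
    exact ⟨om, fun x => by rw [h.sc_P x0 hr]; exact ho _⟩

theorem sc_zero (ν : Fin n → E n → ℝ) (x0 : E n) (r : ℝ) (i : Fin n) : SL.sc ν x0 r i 0 = 0 := by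
  simp [SL.sc]

theorem sc_sc (ν : Fin n → E n → ℝ) (x0 x1 : E n) (r s : ℝ) :
    SL.sc (SL.sc ν x0 r) x1 s = SL.sc ν (x0 + r • x1) (r * s) := by
  funext i x
  simp only [SL.sc, mul_inv, smul_add, smul_smul, add_assoc]
  ring

theorem tt_sc {ν : Fin n → E n → ℝ} (h0 : ∀ i, ν i 0 = 0) {r : ℝ} (hr : r ≠ 0) (x : E n) :
    tt (SL.sc ν 0 r) x = tt ν (r • x) / r^2 := by
  simp only [tt, SL.sc, h0, sub_zero, zero_add, Pi.smul_apply, smul_eq_mul, mul_pow, ← Finset.mul_sum, ← Finset.sum_mul]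
  field_simp

/-- density ratio -/
noncomputable def Th (ν : Fin n → E n → ℝ) (s : ℝ) : ℝ := If ν (fun _ => 1) s

theorem Th_sc {ν : Fin n → E n → ℝ} (h : Sol ν) (h0 : ∀ i, ν i 0 = 0) {r s : ℝ} (hr : 0 < r) (hs : 0 < s) :
    Th (SL.sc ν 0 r) s = Th ν (r * s) := by
  unfold Th If
  have h1 : ∀ x, ct 3 s (SL.sc ν 0 r) x * (1 * Vd (Pm (SL.sc ν 0 r) x)) =
      (fun y => ct 3 (r*s) ν y * (1 * Vd (Pm ν y))) (r • x) := fun x => by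
    simp only [ct, tt_sc h0 hr.ne', h.sc_P 0 hr.ne', zero_add]
    congr 2
    field_simp
  rw [integral_congr_ae (Eventually.of_forall h1), Measure.integral_comp_smul_of_nonneg volume (fun y => ct 3 (r*s) ν y * (1 * Vd (Pm ν y))) r (hR := hr.le)]
  simp only [Module.finrank_fintype_fun_eq_card, Fintype.card_fin, smul_eq_mul, mul_pow, mul_inv]
  ring

theorem Lop_one (ν : Fin n → E n → ℝ) (x : E n) : Lop ν (fun _ => 1) x = 0 := by
  unfold Lop
  have : ∀ b : Fin n, pd b (fun _ : E n => (1:ℝ)) = fun _ => 0 := fun b => funext fun y => pd_const b 1 y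
  simp [this, pd_const]

theorem Th_deriv {ν : Fin n → E n → ℝ} (h : Sol ν) {s : ℝ} (hs : 0 < s) :
    HasDerivAt (Th ν) (6 / s^(n+3) * ∫ x, ct 2 s ν x * (Vd (Pm ν x) * (wv ν x ⬝ᵥ (Rm (Pm ν x) *ᵥ wv ν x)))) s := by
  refine (h.If_deriv (Sm.const 1) hs).congr_deriv ?_
  simp only [Lop_one, mul_zero, integral_zero, zero_add, one_mul]
  field_simp; ring

theorem Th_mono {ν : Fin n → E n → ℝ} (h : Sol ν) : MonotoneOn (Th ν) (Set.Ioi 0) := by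
  refine monotoneOn_of_deriv_nonneg (convex_Ioi 0) (fun s hs => (Th_deriv h hs).continuousAt.continuousWithinAt)
    (fun s hs => ?_) (fun s hs => ?_)
  · rw [interior_Ioi] at hs; exact (Th_deriv h hs).differentiableAt.differentiableWithinAt
  · rw [interior_Ioi] at hs
    have hs' : 0 < s := hs
    rw [(Th_deriv h hs).deriv]
    refine mul_nonneg (by positivity) (integral_nonneg fun x => ?_)
    exact mul_nonneg (ct_nonneg _ _ _ _) (mul_nonneg (h.V_pos x).le (dotR_nonneg (h.sym x) _))

theorem Th_nonneg {ν : Fin n → E n → ℝ} (h : Sol ν) {s : ℝ} (hs : 0 < s) : 0 ≤ Th ν s := by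
  unfold Th If
  refine mul_nonneg (by positivity) (integral_nonneg fun x => ?_)
  exact mul_nonneg (ct_nonneg _ _ _ _) (mul_nonneg (by simp) (h.V_pos x).le)

theorem Th_le {ν : Fin n → E n → ℝ} (h : Sol ν) {s : ℝ} (hs : 0 < s) : Th ν s ≤ KK n * 2^n := by
  unfold Th If
  have h1 : ∫ x, ct 3 s ν x * (1 * Vd (Pm ν x)) ≤ ∫ x, (Metric.closedBall (0 : E n) s).indicator (fun _ => KK n) x := by
    refine integral_mono (h.ct_int (by simp) hs (by simpa using h.smV.cont)) ?_ fun x => ?_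
    · rw [integrable_indicator_iff measurableSet_closedBall]
      exact continuousOn_const.integrableOn_compact (isCompact_closedBall _ _)
    · by_cases h0 : ct 3 s ν x = 0
      · simp only [h0, zero_mul]
        exact Set.indicator_nonneg (fun _ _ => (KK_pos n).le) _
      · rw [Set.indicator_of_mem (by rw [mem_closedBall_zero_iff]; exact norm_le_of_tt hs.le (ct_supp (by simp) hs h0).le)]
        have a := ct_nonneg 3 s ν x
        have b := ct_le_one 3 s ν x
        have c := h.V_le x
        have d := h.V_pos x
        nlinarith
  rw [integral_indicator measurableSet_closedBall, setIntegral_const, smul_eq_mul, Measure.real, Real.volume_pi_closedBall _ hs.le,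
    ENNReal.toReal_ofReal (by positivity), Fintype.card_fin] at h1
  calc _ ≤ (s^n)⁻¹ * ((2*s)^n * KK n) := by gcongr
    _ = _ := by rw [mul_pow]; field_simp

noncomputable def Wf (ν : Fin n → E n → ℝ) : ℝ := ∫ x, ct 2 1 ν x * (wv ν x ⬝ᵥ wv ν x)

theorem Sol.w_cont {ν : Fin n → E n → ℝ} (h : Sol ν) : Continuous fun x => wv ν x ⬝ᵥ wv ν x := by
  simp only [dotProduct]
  exact (Sm.sum fun i => (h.sm_w i).mul (h.sm_w i) : Sm fun x => ∑ i, wv ν x i * wv ν x i).cont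

theorem Wf_le (n : ℕ) : ∃ C : ℝ, 0 < C ∧ ∀ ν : Fin n → E n → ℝ, Sol ν → Wf ν ≤ C * (Th ν 2 - Th ν 1) := by
  refine ⟨KK n ^2 * 2^(n+3) / 6, by have := KK_pos n; positivity, fun ν h => ?_⟩
  obtain ⟨s, hs, he⟩ := exists_hasDerivAt_eq_slope (Th ν) (fun s => 6 / s^(n+3) * ∫ x, ct 2 s ν x * (Vd (Pm ν x) * (wv ν x ⬝ᵥ (Rm (Pm ν x) *ᵥ wv ν x))))
    (show (1:ℝ) < 2 by norm_num) (fun s hs => (Th_deriv h (by linarith [hs.1])).continuousAt.continuousWithinAt)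
    (fun s hs => Th_deriv h (by linarith [hs.1]))
  have s1 : 1 < s := hs.1
  have s2 : s < 2 := hs.2
  have hK := KK_pos n
  have cW : Continuous fun x => wv ν x ⬝ᵥ (Rm (Pm ν x) *ᵥ wv ν x) := by
    simp only [dotProduct, Matrix.mulVec]
    exact (Sm.sum fun i => (h.sm_w i).mul (Sm.sum fun j => (h.smR i j).mul (h.sm_w j)) : Sm fun x => ∑ i, wv ν x i * ∑ j, Rm (Pm ν x) i j * wv ν x j).cont
  have cV := h.smV.cont
  have h1 : Wf ν ≤ ∫ x, KK n^2 * (ct 2 s ν x * (Vd (Pm ν x) * (wv ν x ⬝ᵥ (Rm (Pm ν x) *ᵥ wv ν x)))) := by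
    refine integral_mono (h.ct_int (by simp) (by norm_num) h.w_cont) ((h.ct_int (by simp) (by linarith) (by fun_prop)).const_mul _) fun x => ?_
    have a : ct 2 1 ν x ≤ ct 2 s ν x := by
      refine pp_anti 2 ?_
      rw [one_pow, div_one]
      exact div_le_self (tt_nonneg _ _) (by nlinarith)
    have b := h.R_ge x (wv ν x)
    have c := dotR_nonneg (h.sym x) (wv ν x)
    have d := h.V_ge x
    have e := ct_nonneg 2 1 ν x
    have f := ct_nonneg 2 s ν x
    have g := dot_nonneg (wv ν x)
    calc ct 2 1 ν x * (wv ν x ⬝ᵥ wv ν x) ≤ ct 2 s ν x * (KK n * (wv ν x ⬝ᵥ (Rm (Pm ν x) *ᵥ wv ν x))) := by gcongr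
      _ ≤ (ct 2 s ν x * (KK n * (wv ν x ⬝ᵥ (Rm (Pm ν x) *ᵥ wv ν x)))) * (Vd (Pm ν x) * KK n) := le_mul_of_one_le_right (by positivity) d
      _ = _ := by ring
  rw [integral_const_mul] at h1
  have h2 : (∫ x, ct 2 s ν x * (Vd (Pm ν x) * (wv ν x ⬝ᵥ (Rm (Pm ν x) *ᵥ wv ν x)))) = s^(n+3)/6 * (Th ν 2 - Th ν 1) := by
    have : (2:ℝ) - 1 = 1 := by norm_num
    rw [this, div_one] at he
    rw [← he]; field_simp
  rw [h2] at h1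
  have h3 : 0 ≤ Th ν 2 - Th ν 1 := sub_nonneg.2 (Th_mono h (by simp) (by simp) (by norm_num))
  refine h1.trans ?_
  calc KK n^2 * (s^(n+3)/6 * (Th ν 2 - Th ν 1)) ≤ KK n^2 * (2^(n+3)/6 * (Th ν 2 - Th ν 1)) := by gcongr
    _ = _ := by ring

end SL
end

section
set_option autoImplicit false
set_option linter.unusedVariables false
set_option linter.unusedSimpArgs false
namespace SL
open Matrix MeasureTheory Filter Topology
open scoped ContDiff

variable {n : ℕ}

noncomputable def Th0 (n : ℕ) : ℝ := ∫ y : E n, pp 3 (y ⬝ᵥ y)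

theorem integral_comp_mat {B : Mt n} (hB : B.det ≠ 0) (f : E n → ℝ) (hf : Continuous f) :
    |B.det| * ∫ x, f (B *ᵥ x) = ∫ y, f y := by
  have h1 := Real.map_matrix_volume_pi_eq_smul_volume_pi hB
  have h2 : ∫ y, f y ∂(Measure.map (Matrix.toLin' B) volume) = ∫ x, f (Matrix.toLin' B x) :=
    integral_map (LinearMap.continuous_of_finiteDimensional _).aemeasurable hf.aestronglyMeasurable
  rw [h1, integral_smul_measure, ENNReal.toReal_ofReal (abs_nonneg _)] at h2
  simp only [Matrix.toLin'_apply] at h2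
  rw [← h2, abs_inv, smul_eq_mul]
  have : |B.det| ≠ 0 := abs_ne_zero.2 hB
  field_simp

theorem plane_id {p : Mt n} (hp : p.IsSymm) :
    ∫ x : E n, pp 3 (x ⬝ᵥ x + (p *ᵥ x) ⬝ᵥ (p *ᵥ x)) * Vd p = Th0 n := by
  obtain ⟨O, l, h1, h2, h3⟩ := exists_diag hp
  set B : Mt n := diagonal (fun i => √(1 + l i^2)) * Oᵀ with hB
  have hBB : Bᵀ * B = gM p := by
    rw [hB, Matrix.transpose_mul, Matrix.diagonal_transpose, Matrix.transpose_transpose]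
    have e : diagonal (fun i => √(1 + l i^2)) * diagonal (fun i => √(1 + l i^2)) = (1 : Mt n) + diagonal l * diagonal l := by
      rw [diagonal_mul_diagonal, diagonal_mul_diagonal, ← diagonal_one, diagonal_add]
      congr 1; funext i; rw [Real.mul_self_sqrt (by positivity)]; ring
    calc _ = O * (diagonal (fun i => √(1 + l i^2)) * diagonal (fun i => √(1 + l i^2))) * Oᵀ := by simp only [mul_assoc]
      _ = O * Oᵀ + O * diagonal l * (1 : Mt n) * diagonal l * Oᵀ := by rw [e]; simp [mul_add, add_mul, mul_assoc]
      _ = _ := by rw [← h2, h1, gM, h3]; simp only [mul_assoc]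
  have hdet : B.det ^2 = (gM p).det := by rw [← hBB, Matrix.det_mul Bᵀ B, Matrix.det_transpose]; ring
  have hpos := gM_det_pos hp
  have hne : B.det ≠ 0 := by intro h0; rw [h0] at hdet; norm_num at hdet; linarith
  have hV : Vd p = |B.det| := by unfold Vd; rw [← hdet, Real.sqrt_sq_eq_abs]
  have hc : Continuous fun y : E n => pp 3 (y ⬝ᵥ y) := (pp_cont 3).comp (by fun_prop)
  have key := integral_comp_mat hne _ hc
  unfold Th0
  rw [← key, ← hV, ← integral_const_mul]
  congr 1; funext x
  rw [mul_comm]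
  congr 2
  rw [Matrix.dotProduct_mulVec, Matrix.vecMul_mulVec, ← Matrix.dotProduct_mulVec,
    Matrix.dotProduct_mulVec (B *ᵥ x), Matrix.vecMul_mulVec, ← Matrix.dotProduct_mulVec, hBB, gM, hp.eq, Matrix.add_mulVec, dotProduct_add, Matrix.one_mulVec]

theorem Th0_pos (n : ℕ) : 0 < Th0 n := by
  unfold Th0
  have hc : Continuous fun y : E n => pp 3 (y ⬝ᵥ y) := (pp_cont 3).comp (by fun_prop)
  refine hc.integral_pos_of_hasCompactSupport_nonneg_nonzero ?_ (fun y => pp_nonneg _ _) (x := 0) ?_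
  · refine HasCompactSupport.intro (isCompact_closedBall (0 : E n) 1) fun x hx => ?_
    refine pp_zero (by simp) ?_
    by_contra hcon
    refine hx (mem_closedBall_zero_iff.2 ((pi_norm_le_iff_of_nonneg zero_le_one).2 fun i => ?_))
    rw [Real.norm_eq_abs]
    refine abs_le_of_sq_le_sq ?_ zero_le_one
    have : x i * x i ≤ x ⬝ᵥ x := Finset.single_le_sum (f := fun i => x i * x i) (fun _ _ => mul_self_nonneg _) (Finset.mem_univ i)
    nlinarith
  · simp [pp]

theorem If_sc {ν : Fin n → E n → ℝ} (h : Sol ν) (h0 : ∀ i, ν i 0 = 0) (f : E n → ℝ) {r : ℝ} (hr : 0 < r) :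
    If ν f r = ∫ y, ct 3 1 (SL.sc ν 0 r) y * (f (r • y) * Vd (Pm ν (r • y))) := by
  unfold If
  have h1 : ∀ x, ct 3 1 (SL.sc ν 0 r) x * (f (r • x) * Vd (Pm ν (r • x))) =
      (fun y => ct 3 r ν y * (f y * Vd (Pm ν y))) (r • x) := fun x => by
    simp only [ct, tt_sc h0 hr.ne', one_pow, div_one]
  rw [integral_congr_ae (Eventually.of_forall h1), Measure.integral_comp_smul_of_nonneg volume (fun y => ct 3 r ν y * (f y * Vd (Pm ν y))) r (hR := hr.le)]
  simp only [Module.finrank_fintype_fun_eq_card, Fintype.card_fin, smul_eq_mul]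

theorem fderiv_eq_sum {f : E n → ℝ} (x v : E n) : fderiv ℝ f x v = ∑ j, pd j f x * v j := by
  conv_lhs => rw [← Finset.univ_sum_single v]
  rw [map_sum]
  refine Finset.sum_congr rfl fun j _ => ?_
  rw [show (Pi.single j (v j) : E n) = v j • Pi.single j 1 by ext k; simp [Pi.single_apply], map_smul, smul_eq_mul, mul_comm]; rfl

theorem sc_lim {ν : Fin n → E n → ℝ} (h : Sol ν) (h0 : ∀ i, ν i 0 = 0) (i : Fin n) (y : E n) :
    Tendsto (fun r : ℝ => SL.sc ν 0 r i y) (𝓝[>] 0) (𝓝 ((Pm ν 0 *ᵥ y) i)) := by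
  have h1 : HasDerivAt (fun r : ℝ => ν i (r • y)) (fderiv ℝ (ν i) 0 y) 0 := by
    have a : HasDerivAt (fun r : ℝ => r • y) y 0 := by simpa using (hasDerivAt_id (0:ℝ)).smul_const y
    have b : HasFDerivAt (ν i) (fderiv ℝ (ν i) 0) ((fun r : ℝ => r • y) 0) := by
      simpa using ((h.sm i).diff 0).hasFDerivAt
    exact b.comp_hasDerivAt (0:ℝ) a
  rw [hasDerivAt_iff_tendsto_slope] at h1
  have h2 := h1.mono_left (nhdsWithin_mono (0:ℝ) (fun r hr => (ne_of_gt hr : r ≠ 0)) : 𝓝[>] (0:ℝ) ≤ 𝓝[≠] 0)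
  rw [fderiv_eq_sum] at h2
  refine h2.congr fun r => ?_
  simp [SL.sc, slope_def_field, h0, div_eq_mul_inv]

theorem If_lim {ν : Fin n → E n → ℝ} (h : Sol ν) (h0 : ∀ i, ν i 0 = 0) {f : E n → ℝ} (hf : Continuous f) :
    Tendsto (If ν f) (𝓝[>] 0) (𝓝 (f 0 * Th0 n)) := by
  have e : f 0 * Th0 n = ∫ y : E n, pp 3 (y ⬝ᵥ y + (Pm ν 0 *ᵥ y) ⬝ᵥ (Pm ν 0 *ᵥ y)) * (f 0 * Vd (Pm ν 0)) := by
    rw [← plane_id (h.sym 0), ← integral_const_mul]; congr 1; funext y; ring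
  rw [e]
  obtain ⟨C, hC⟩ := (isCompact_closedBall (0 : E n) 1).exists_bound_of_continuousOn (f := fun x => f x * Vd (Pm ν x))
    (hf.mul h.smV.cont).continuousOn
  have hev : (fun r => ∫ y, ct 3 1 (SL.sc ν 0 r) y * (f (r • y) * Vd (Pm ν (r • y)))) =ᶠ[𝓝[>] 0] If ν f := by
    filter_upwards [self_mem_nhdsWithin] with r hr
    exact (If_sc h h0 f hr).symm
  refine Tendsto.congr' hev ?_
  have cV := h.smV.cont
  refine tendsto_integral_filter_of_dominated_convergence ((Metric.closedBall (0 : E n) 1).indicator fun _ => C) ?_ ?_ ?_ ?_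
  · filter_upwards [self_mem_nhdsWithin] with r hr
    have c1 := (h.sc 0 (ne_of_gt hr : r ≠ 0)).ct_cont 3 1
    have c2 : Continuous fun y : E n => r • y := by fun_prop
    exact (c1.mul ((hf.comp c2).mul (cV.comp c2))).aestronglyMeasurable
  · filter_upwards [Ioo_mem_nhdsGT (show (0:ℝ) < 1 by norm_num)] with r hr
    refine Eventually.of_forall fun y => ?_
    by_cases hz : ct 3 1 (SL.sc ν 0 r) y = 0
    · simp only [hz, zero_mul, norm_zero]
      refine Set.indicator_nonneg (fun x hx => (norm_nonneg _).trans (hC x hx)) _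
    · have hy : y ∈ Metric.closedBall (0 : E n) 1 := by
        rw [mem_closedBall_zero_iff]; exact norm_le_of_tt zero_le_one (ct_supp (by simp) one_pos hz).le
      rw [Set.indicator_of_mem hy, norm_mul, Real.norm_eq_abs, abs_of_nonneg (ct_nonneg _ _ _ _)]
      have hry : r • y ∈ Metric.closedBall (0 : E n) 1 := by
        rw [mem_closedBall_zero_iff] at hy ⊢
        rw [norm_smul, Real.norm_eq_abs, abs_of_pos hr.1]
        nlinarith [hr.1, hr.2, norm_nonneg y]
      have a := hC _ hry
      have b := ct_le_one 3 1 (SL.sc ν 0 r) y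
      have c := ct_nonneg 3 1 (SL.sc ν 0 r) y
      calc _ ≤ 1 * C := mul_le_mul b a (norm_nonneg _) zero_le_one
        _ = C := one_mul C
  · rw [integrable_indicator_iff measurableSet_closedBall]
    exact continuousOn_const.integrableOn_compact (isCompact_closedBall _ _)
  · refine Eventually.of_forall fun y => ?_
    refine Tendsto.mul ?_ ?_
    · refine ((pp_cont 3).tendsto _).comp ?_
      simp only [one_pow, div_one, tt, dotProduct, ← pow_two]
      refine tendsto_const_nhds.add (tendsto_finsetSum _ fun i _ => ?_)
      exact (sc_lim h h0 i y).pow 2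
    · have c3 : Continuous fun r : ℝ => f (r • y) * Vd (Pm ν (r • y)) := by
        have c2 : Continuous fun r : ℝ => r • y := by fun_prop
        exact (hf.comp c2).mul (cV.comp c2)
      have := c3.tendsto 0
      simp only [zero_smul] at this
      exact this.mono_left nhdsWithin_le_nhds

theorem mean_value {ν : Fin n → E n → ℝ} (h : Sol ν) (h0 : ∀ i, ν i 0 = 0) {f : E n → ℝ} (hf : Sm f) (fp : ∀ x, 0 ≤ f x)
    {lam : ℝ} (hl : 0 ≤ lam) (hL : ∀ x, ‖x‖ ≤ 1 → -lam * f x ≤ Lop ν f x) :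
    f 0 * Th0 n ≤ Real.exp (lam / 16) * If ν f 1 := by
  set J : ℝ → ℝ := fun s => Real.exp (lam * s^2 / 16) * If ν f s with hJ
  have cV := h.smV.cont
  have cf := hf.cont
  have cL : Continuous (Lop ν f) :=
    (Sm.sum fun k => Sm.sum fun b => (h.smR k b).mul ((hf.pd b).pd k) : Sm fun x => ∑ k, ∑ b, Rm (Pm ν x) k b * pd k (pd b f) x).cont
  have dJ : ∀ s, 0 < s → HasDerivAt J (Real.exp (lam * s^2 / 16) * (lam * s / 8 * If ν f s + (8 * s^(n+1))⁻¹ * (s^2 * (∫ x, ct 4 s ν x * (Vd (Pm ν x) * Lop ν f x))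
      + 48 / s^2 * ∫ x, ct 2 s ν x * (f x * Vd (Pm ν x) * (wv ν x ⬝ᵥ (Rm (Pm ν x) *ᵥ wv ν x)))))) s := by
    intro s hs
    have d1 : HasDerivAt (fun s : ℝ => lam * s^2 / 16) (lam * s / 8) s := by
      refine (((hasDerivAt_pow 2 s).const_mul lam).div_const 16).congr_deriv ?_
      push_cast; ring
    refine (d1.exp.mul (h.If_deriv hf hs)).congr_deriv ?_
    ring
  have mono : MonotoneOn J (Set.Ioc 0 1) := by
    refine monotoneOn_of_deriv_nonneg (convex_Ioc 0 1) (fun s hs => (dJ s hs.1).continuousAt.continuousWithinAt)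
      (fun s hs => ?_) (fun s hs => ?_)
    · rw [interior_Ioc] at hs; exact (dJ s hs.1).differentiableAt.differentiableWithinAt
    · rw [interior_Ioc] at hs
      have hs0 := hs.1
      rw [(dJ s hs0).deriv]
      refine mul_nonneg (Real.exp_pos _).le ?_
      have i1 : -lam * ∫ x, ct 3 s ν x * (f x * Vd (Pm ν x)) ≤ ∫ x, ct 4 s ν x * (Vd (Pm ν x) * Lop ν f x) := by
        rw [← integral_const_mul]
        refine integral_mono ((h.ct_int (by simp) hs0 (by fun_prop)).const_mul _) (h.ct_int (by simp) hs0 (by fun_prop)) fun x => ?_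
        have c4 := ct_nonneg 4 s ν x
        have c43 := ct_succ_le 3 s ν x
        have v := (h.V_pos x).le
        have q := fp x
        by_cases hz : ct 4 s ν x = 0
        · simp only [hz, zero_mul]
          have := ct_nonneg 3 s ν x
          have : 0 ≤ lam * (ct 3 s ν x * (f x * Vd (Pm ν x))) := by positivity
          linarith
        · have hx := norm_le_of_tt hs0.le (ct_supp (by simp) hs0 hz).le
          have l := hL x (hx.trans hs.2.le)
          have e1 : lam * (ct 4 s ν x * (f x * Vd (Pm ν x))) ≤ lam * (ct 3 s ν x * (f x * Vd (Pm ν x))) := by gcongr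
          have e2 : ct 4 s ν x * (Vd (Pm ν x) * (-lam * f x)) ≤ ct 4 s ν x * (Vd (Pm ν x) * Lop ν f x) := by gcongr
          simp only []
          linarith
      have i2 : 0 ≤ ∫ x, ct 2 s ν x * (f x * Vd (Pm ν x) * (wv ν x ⬝ᵥ (Rm (Pm ν x) *ᵥ wv ν x))) :=
        integral_nonneg fun x => mul_nonneg (ct_nonneg _ _ _ _) (mul_nonneg (mul_nonneg (fp x) (h.V_pos x).le) (dotR_nonneg (h.sym x) _))
      have i3 : (8 * s^(n+1))⁻¹ * (s^2 * (-lam * ∫ x, ct 3 s ν x * (f x * Vd (Pm ν x)))) ≤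
         (8 * s^(n+1))⁻¹ * (s^2 * (∫ x, ct 4 s ν x * (Vd (Pm ν x) * Lop ν f x))
      + 48 / s^2 * ∫ x, ct 2 s ν x * (f x * Vd (Pm ν x) * (wv ν x ⬝ᵥ (Rm (Pm ν x) *ᵥ wv ν x)))) := by
        refine mul_le_mul_of_nonneg_left ?_ (by positivity)
        have a : s^2 * (-lam * ∫ x, ct 3 s ν x * (f x * Vd (Pm ν x))) ≤ s^2 * (∫ x, ct 4 s ν x * (Vd (Pm ν x) * Lop ν f x)) :=
          mul_le_mul_of_nonneg_left i1 (by positivity)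
        have b : 0 ≤ 48 / s^2 * ∫ x, ct 2 s ν x * (f x * Vd (Pm ν x) * (wv ν x ⬝ᵥ (Rm (Pm ν x) *ᵥ wv ν x))) :=
          mul_nonneg (by positivity) i2
        linarith
      have e : (8 * s^(n+1))⁻¹ * (s^2 * (-lam * ∫ x, ct 3 s ν x * (f x * Vd (Pm ν x)))) = - (lam * s / 8 * If ν f s) := by
        unfold If; rw [pow_succ]; field_simp
      linarith
  have lim : Tendsto J (𝓝[>] 0) (𝓝 (f 0 * Th0 n)) := by
    have c : Tendsto (fun s : ℝ => Real.exp (lam * s^2/16)) (𝓝[>] 0) (𝓝 1) := by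
      have : Continuous fun s : ℝ => Real.exp (lam * s^2/16) := by fun_prop
      have := this.tendsto 0
      simp only [ne_eq, OfNat.ofNat_ne_zero, not_false_eq_true, zero_pow, mul_zero, zero_div, Real.exp_zero] at this
      exact this.mono_left nhdsWithin_le_nhds
    have := c.mul (If_lim h h0 cf)
    rwa [one_mul] at this
  have e1 : Real.exp (lam/16) * If ν f 1 = J 1 := by simp [hJ]
  rw [e1]
  refine le_of_tendsto lim ?_
  filter_upwards [Ioo_mem_nhdsGT (show (0:ℝ) < 1 by norm_num)] with s hs
  exact mono ⟨hs.1, hs.2.le⟩ ⟨one_pos, le_refl _⟩ hs.2.le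

theorem Th0_le {ν : Fin n → E n → ℝ} (h : Sol ν) (h0 : ∀ i, ν i 0 = 0) : Th0 n ≤ Th ν 1 := by
  have := mean_value h h0 (Sm.const 1) (fun _ => zero_le_one) (le_refl 0) (fun x _ => by rw [Lop_one]; simp)
  simpa [Th] using this

theorem If_le {ν : Fin n → E n → ℝ} (h : Sol ν) {f : E n → ℝ} (hf : Continuous f) (fp : ∀ x, 0 ≤ f x) :
    If ν f 1 ≤ KK n * ∫ x in Metric.closedBall (0 : E n) 1, f x := by
  unfold If
  rw [one_pow, inv_one, one_mul, ← integral_const_mul, ← integral_indicator measurableSet_closedBall]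
  have cV := h.smV.cont
  refine integral_mono (h.ct_int (by simp) one_pos (by fun_prop)) ?_ fun x => ?_
  · rw [integrable_indicator_iff measurableSet_closedBall]
    exact (continuous_const.mul hf).continuousOn.integrableOn_compact (isCompact_closedBall _ _)
  · have q := fp x
    have hK := KK_pos n
    by_cases hz : ct 3 1 ν x = 0
    · simp only [hz, zero_mul]
      refine Set.indicator_nonneg (fun x _ => mul_nonneg hK.le (fp x)) _
    · have hx := norm_le_of_tt zero_le_one (ct_supp (by simp) one_pos hz).le
      rw [Set.indicator_of_mem (mem_closedBall_zero_iff.2 hx)]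
      have v := (h.V_pos x).le
      calc ct 3 1 ν x * (f x * Vd (Pm ν x)) ≤ 1 * (f x * KK n) := by
            have := ct_le_one 3 1 ν x; have := h.V_le x; have := ct_nonneg 3 1 ν x
            gcongr
        _ = _ := by ring

end SL
end

section
set_option autoImplicit false
set_option linter.unusedVariables false
set_option linter.unusedSimpArgs false
namespace SL
open Matrix MeasureTheory Filter Topology
open scoped ContDiff

variable {n : ℕ}

theorem abs_sum_le {g : Fin n → ℝ} {c : ℝ} (h : ∀ i, |g i| ≤ c) : |∑ i, g i| ≤ n * c := by
  refine (Finset.abs_sum_le_sum_abs _ _).trans ?_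
  refine (Finset.sum_le_sum fun i _ => h i).trans ?_
  simp

theorem abs_mul_le' {a b c d : ℝ} (h1 : |a| ≤ c) (h2 : |b| ≤ d) : |a * b| ≤ c * d := by
  rw [abs_mul]; exact mul_le_mul h1 h2 (abs_nonneg _) ((abs_nonneg _).trans h1)

theorem abs_mulM_le {A B : Mt n} {c d : ℝ} (h1 : ∀ i j, |A i j| ≤ c) (h2 : ∀ i j, |B i j| ≤ d) (i j : Fin n) :
    |(A * B) i j| ≤ n * (c * d) := by
  rw [Matrix.mul_apply]
  exact abs_sum_le fun k => abs_mul_le' (h1 i k) (h2 k j)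

theorem abs_mulVec_le {A : Mt n} {v : Fin n → ℝ} {c d : ℝ} (h1 : ∀ i j, |A i j| ≤ c) (h2 : ∀ i, |v i| ≤ d) (i : Fin n) :
    |(A *ᵥ v) i| ≤ n * (c * d) :=
  abs_sum_le fun k => abs_mul_le' (h1 i k) (h2 k)

theorem abs_trace_le {A : Mt n} {c : ℝ} (h : ∀ i j, |A i j| ≤ c) : |A.trace| ≤ n * c :=
  abs_sum_le fun k => h k k

/-- `|T|` -/
noncomputable def Ta (ν : Fin n → E n → ℝ) (x : E n) : ℝ := √(T2 (Tm ν x))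
noncomputable def wa (ν : Fin n → E n → ℝ) (x : E n) : ℝ := √(wv ν x ⬝ᵥ wv ν x)

theorem Ta_nonneg (ν : Fin n → E n → ℝ) (x : E n) : 0 ≤ Ta ν x := Real.sqrt_nonneg _
theorem wa_nonneg (ν : Fin n → E n → ℝ) (x : E n) : 0 ≤ wa ν x := Real.sqrt_nonneg _
theorem Ta_sq (ν : Fin n → E n → ℝ) (x : E n) : Ta ν x ^ 2 = T2 (Tm ν x) := Real.sq_sqrt (T2_nonneg _)
theorem wa_sq (ν : Fin n → E n → ℝ) (x : E n) : wa ν x ^ 2 = wv ν x ⬝ᵥ wv ν x := Real.sq_sqrt (dot_nonneg _)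
theorem T_le (ν : Fin n → E n → ℝ) (x : E n) (k i j : Fin n) : |Tm ν x k i j| ≤ Ta ν x :=
  Real.abs_le_sqrt (sq_le_T2 _ _ _ _)
theorem w_le (ν : Fin n → E n → ℝ) (x : E n) (i : Fin n) : |wv ν x i| ≤ wa ν x := by
  refine Real.abs_le_sqrt ?_
  rw [pow_two]
  exact Finset.single_le_sum (f := fun i => wv ν x i * wv ν x i) (fun _ _ => mul_self_nonneg _) (Finset.mem_univ i)

theorem Sol.T2_cont {ν : Fin n → E n → ℝ} (h : Sol ν) : Continuous fun x => T2 (Tm ν x) := by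
  unfold T2
  exact (Sm.sum fun k => Sm.sum fun i => Sm.sum fun j => (h.smT k i j).pow 2 : Sm fun x => ∑ k, ∑ i, ∑ j, Tm ν x k i j ^2).cont

theorem ct_pow (k : ℕ) (s : ℝ) (ν : Fin n → E n → ℝ) (x : E n) : ct k s ν x = (ct 1 s ν x)^k := by
  simp [ct, pp]

theorem Sol.xi_le {ν : Fin n → E n → ℝ} (h : Sol ν) {x : E n} (ht : tt ν x ≤ 1) (j : Fin n) : |xi ν x j| ≤ 1 + n * KK n := by
  have a : |x j| ≤ 1 := abs_le_of_sq_le_sq (by simpa using (sq_le_tt ν x j).trans ht) zero_le_one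
  have b : |(Pm ν x *ᵥ fun i => ν i x) j| ≤ n * (KK n * 1) := abs_mulVec_le (h.P_le x)
    (fun i => abs_le_of_sq_le_sq (by simpa using (nu_sq_le_tt ν x i).trans ht) zero_le_one) j
  rw [mul_one] at b
  unfold xi
  exact (abs_add_le _ _).trans (add_le_add a b)

noncomputable def DD (n : ℕ) : ℝ := 8 * (n^2 * (6 * KK n^2 * (1 + n * KK n)) + 4 * n^4 * KK n^3)

theorem DD_nonneg (n : ℕ) : 0 ≤ DD n := by have := KK_pos n; unfold DD; positivity

theorem FB_id {ν : Fin n → E n → ℝ} (h : Sol ν) {B : E n → Mt n} (sB : SmM B) (symB : ∀ x, (B x).IsSymm) {F : E n → ℝ}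
    (hF : ∀ x, ∑ k, pd k (fun y => Vd (Pm ν y) * ∑ b, Rm (Pm ν y) k b * (B y * Tm ν y b).trace) x = Vd (Pm ν x) * F x) :
    ∫ x, ct 4 1 ν x * (Vd (Pm ν x) * F x) = ∫ x,
       (-8) * (∑ i, ∑ j, wv ν x i * pd j (fun y => ct 3 1 ν y * (Vd (Pm ν y) * B y i j)) x +
        ct 3 1 ν x * (Vd (Pm ν x) * ∑ b, (Qm (Pm ν x) *ᵥ wv ν x) b * (B x * Tm ν x b).trace)) := by
  have sf : ∀ b, Sm fun x => (B x * Tm ν x b).trace := fun b => (sB.mul (h.smT b)).trace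
  have sX : ∀ k, Sm fun y => Vd (Pm ν y) * ∑ b, Rm (Pm ν y) k b * (B y * Tm ν y b).trace :=
    fun k => h.smV.mul (Sm.sum fun b => (h.smR k b).mul (sf b))
  have i1 := ibp (fun k => (sX k).c1) (h.ct_c1 2 1) (ct_hcs (by simp) one_pos ν)
  simp only [hF, Nat.reduceAdd] at i1
  rw [i1]
  have e1 : ∀ x, ∑ k, Vd (Pm ν x) * (∑ b, Rm (Pm ν x) k b * (B x * Tm ν x b).trace) * pd k (ct 4 1 ν) x =
     (-8) * (ct 3 1 ν x * (Vd (Pm ν x) * ∑ i, ∑ j, B x i j * pd j (fun y => wv ν y i) x) -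
      ct 3 1 ν x * (Vd (Pm ν x) * ∑ b, (Qm (Pm ν x) *ᵥ wv ν x) b * (B x * Tm ν x b).trace)) := by
    intro x
    have a1 : ∑ i, ∑ j, B x i j * pd j (fun y => wv ν y i) x = ∑ b, x b * (B x * Tm ν x b).trace := by
      simp only [h.pd_w, Matrix.trace, Matrix.diag, Matrix.mul_apply, Finset.mul_sum]
      rw [Finset.sum_congr rfl fun i _ => Finset.sum_comm, Finset.sum_comm]
      refine Finset.sum_congr rfl fun b _ => Finset.sum_congr rfl fun i _ => Finset.sum_congr rfl fun j _ => ?_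
      rw [(h.ts x).1 b i j]; ring
    have a2 : ∑ b, (Rm (Pm ν x) *ᵥ xi ν x) b * (B x * Tm ν x b).trace =
       ∑ b, x b * (B x * Tm ν x b).trace - ∑ b, (Qm (Pm ν x) *ᵥ wv ν x) b * (B x * Tm ν x b).trace := by
      rw [h.R_xi, ← Finset.sum_sub_distrib]
      exact Finset.sum_congr rfl fun b _ => by rw [Pi.sub_apply]; ring
    rw [a1, ← mul_sub, ← mul_sub, ← a2]
    simp only [Matrix.mulVec, dotProduct, Finset.sum_mul, Finset.mul_sum, h.pd_ct 2 1]
    rw [Finset.sum_comm]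
    refine Finset.sum_congr rfl fun b _ => Finset.sum_congr rfl fun k _ => ?_
    rw [(Rm_symm (h.sym x)).apply k b]
    push_cast; ring
  have cw : ∀ i, Continuous fun x => wv ν x i := fun i => (h.sm_w i).cont
  have c1c : ∀ i j, ContDiff ℝ 1 fun y => ct 3 1 ν y * (Vd (Pm ν y) * B y i j) := fun i j =>
    (h.ct_c1 1 1).mul (h.smV.mul (sB i j)).c1
  have cs : ∀ i j, HasCompactSupport fun y => ct 3 1 ν y * (Vd (Pm ν y) * B y i j) := fun i j =>
    (ct_hcs (by simp) one_pos ν).mul_right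
  have cpd : ∀ i j, Continuous (pd j fun y => ct 3 1 ν y * (Vd (Pm ν y) * B y i j)) := fun i j =>
    ((c1c i j).continuous_fderiv (by simp)).clm_apply continuous_const
  have cspd : ∀ i j, HasCompactSupport (pd j fun y => ct 3 1 ν y * (Vd (Pm ν y) * B y i j)) := fun i j =>
    (cs i j).fderiv_apply ℝ _
  have int1 : ∀ i j, Integrable fun x => wv ν x i * pd j (fun y => ct 3 1 ν y * (Vd (Pm ν y) * B y i j)) x := fun i j =>
    ((cw i).mul (cpd i j)).integrable_of_hasCompactSupport (cspd i j).mul_left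
  have int2 : ∀ i j, Integrable fun x => (ct 3 1 ν x * (Vd (Pm ν x) * B x i j)) * pd j (fun y => wv ν y i) x := fun i j =>
    ((c1c i j).continuous.mul ((h.sm_w i).pd j).cont).integrable_of_hasCompactSupport (cs i j).mul_right
  have e2 : ∫ x, ct 3 1 ν x * (Vd (Pm ν x) * ∑ i, ∑ j, B x i j * pd j (fun y => wv ν y i) x) =
      - ∫ x, ∑ i, ∑ j, wv ν x i * pd j (fun y => ct 3 1 ν y * (Vd (Pm ν y) * B y i j)) x := by
    have a : ∀ x, ct 3 1 ν x * (Vd (Pm ν x) * ∑ i, ∑ j, B x i j * pd j (fun y => wv ν y i) x) =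
        ∑ i, ∑ j, (ct 3 1 ν x * (Vd (Pm ν x) * B x i j)) * pd j (fun y => wv ν y i) x := fun x => by
      simp only [Finset.mul_sum, mul_assoc]
    simp only [a]
    rw [integral_finsetSum _ fun i _ => integrable_finsetSum _ fun j _ => int2 i j,
      integral_finsetSum _ fun i _ => integrable_finsetSum _ fun j _ => int1 i j, ← Finset.sum_neg_distrib]
    refine Finset.sum_congr rfl fun i _ => ?_
    rw [integral_finsetSum _ fun j _ => int2 i j,
      integral_finsetSum _ fun j _ => int1 i j, ← Finset.sum_neg_distrib]
    refine Finset.sum_congr rfl fun j _ => ?_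
    exact ibp1 (h.sm_w i).c1 (c1c i j) (cs i j) j
  have int3 : Integrable fun x => ct 3 1 ν x * (Vd (Pm ν x) * ∑ b, (Qm (Pm ν x) *ᵥ wv ν x) b * (B x * Tm ν x b).trace) := by
    refine h.ct_int (by simp) one_pos ?_
    refine (h.smV.mul (Sm.sum fun b => Sm.mul ?_ (sf b))).cont
    simp only [Matrix.mulVec, dotProduct]
    exact Sm.sum fun j => (h.smQ b j).mul (h.sm_w j)
  have int4 : Integrable fun x => ct 3 1 ν x * (Vd (Pm ν x) * ∑ i, ∑ j, B x i j * pd j (fun y => wv ν y i) x) :=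
    h.ct_int (by simp) one_pos (h.smV.mul (Sm.sum fun i => Sm.sum fun j => (sB i j).mul ((h.sm_w i).pd j))).cont
  simp only [e1]
  rw [integral_const_mul, integral_const_mul, integral_sub int4 int3, e2,
    integral_add (integrable_finsetSum _ fun i _ => integrable_finsetSum _ fun j _ => int1 i j) int3]
  ring

theorem FB_pt {ν : Fin n → E n → ℝ} (h : Sol ν) {B : E n → Mt n} (sB : SmM B) (hB : ∀ x i j, |B x i j| ≤ KK n)
    (hdB : ∀ x k i j, |pd k (fun y => B y i j) x| ≤ 2 * n^2 * KK n^2 * Ta ν x) (x : E n) :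
    |(-8) * (∑ i, ∑ j, wv ν x i * pd j (fun y => ct 3 1 ν y * (Vd (Pm ν y) * B y i j)) x +
        ct 3 1 ν x * (Vd (Pm ν x) * ∑ b, (Qm (Pm ν x) *ᵥ wv ν x) b * (B x * Tm ν x b).trace))|
      ≤ DD n * (wa ν x * (ct 2 1 ν x + ct 3 1 ν x * Ta ν x)) := by
  have hK := KK_pos n
  have c2 := ct_nonneg 2 1 ν x
  have c3 := ct_nonneg 3 1 ν x
  have ha := Ta_nonneg ν x
  have hw := wa_nonneg ν x
  have hV : |Vd (Pm ν x)| ≤ KK n := by rw [abs_of_pos (h.V_pos x)]; exact h.V_le x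
  have hct : ∀ j, |pd j (ct 3 1 ν) x| ≤ 6 * (1 + n * KK n) * ct 2 1 ν x := fun j => by
    have e := h.pd_ct 1 1 j x
    simp only [Nat.reduceAdd] at e
    rw [e]
    by_cases hz : ct 2 1 ν x = 0
    · simp [hz]
    · have := h.xi_le (by simpa using (ct_supp (by simp) one_pos hz).le) j
      rw [abs_mul, abs_mul, abs_of_nonneg c2]
      have e2 : |2 * xi ν x j / 1^2| = 2 * |xi ν x j| := by simp [abs_mul]
      rw [e2]
      have e3 : |-(((1:ℕ):ℝ)+2)| = 3 := by norm_num
      rw [e3]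
      nlinarith
  have htr : ∀ b, |(B x * Tm ν x b).trace| ≤ n * (n * (KK n * Ta ν x)) := fun b =>
    abs_trace_le (abs_mulM_le (hB x) (T_le ν x b))
  have htrQ : ∀ b, |(Qm (Pm ν x) * Tm ν x b).trace| ≤ n * (n * (KK n * Ta ν x)) := fun b =>
    abs_trace_le (abs_mulM_le (h.Q_le x) (T_le ν x b))
  have hpd : ∀ i j, |pd j (fun y => ct 3 1 ν y * (Vd (Pm ν y) * B y i j)) x| ≤
      6 * (1 + n * KK n) * ct 2 1 ν x * (KK n * KK n) + ct 3 1 ν x * (KK n * (n * (n * (KK n * Ta ν x))) * KK n + KK n * (2 * n^2 * KK n^2 * Ta ν x)) := fun i j => by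
    rw [pd_mul j ((h.ct_c1 1 1).differentiable (by simp) x) ((h.smV.mul (sB i j)).diff x),
      pd_mul j (h.smV.diff x) ((sB i j).diff x), (h.phase' j x).2]
    refine (abs_add_le _ _).trans (add_le_add (abs_mul_le' (hct j) (abs_mul_le' hV (hB x i j))) ?_)
    refine abs_mul_le' (abs_of_nonneg c3).le ((abs_add_le _ _).trans (add_le_add ?_ ?_))
    · exact abs_mul_le' (abs_mul_le' hV (htrQ j)) (hB x i j)
    · exact abs_mul_le' hV (hdB x j i j)
  have t1 := abs_sum_le fun i => abs_sum_le fun j => abs_mul_le' (w_le ν x i) (hpd i j)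
  have t2 : |ct 3 1 ν x * (Vd (Pm ν x) * ∑ b, (Qm (Pm ν x) *ᵥ wv ν x) b * (B x * Tm ν x b).trace)| ≤
      ct 3 1 ν x * (KK n * (n * ((n * (KK n * wa ν x)) * (n * (n * (KK n * Ta ν x)))))) :=
    abs_mul_le' (abs_of_nonneg c3).le (abs_mul_le' hV (abs_sum_le fun b => abs_mul_le' (abs_mulVec_le (h.Q_le x) (w_le ν x) b) (htr b)))
  rw [abs_mul]
  have e8 : |(-8:ℝ)| = 8 := by norm_num
  rw [e8]
  have t3 := (abs_add_le _ _).trans (add_le_add t1 t2)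
  refine (mul_le_mul_of_nonneg_left t3 (by norm_num)).trans ?_
  have key : DD n * (wa ν x * (ct 2 1 ν x + ct 3 1 ν x * Ta ν x)) - 8 * (n * (n * (wa ν x * (6 * (1 + n * KK n) * ct 2 1 ν x * (KK n * KK n) + ct 3 1 ν x * (KK n * (n * (n * (KK n * Ta ν x))) * KK n + KK n * (2 * n^2 * KK n^2 * Ta ν x))))) +
     ct 3 1 ν x * (KK n * (n * ((n * (KK n * wa ν x)) * (n * (n * (KK n * Ta ν x))))))) =
     8 * wa ν x * (4 * n^4 * KK n^3 * ct 2 1 ν x + 6 * n^2 * KK n ^2 * (1 + n * KK n) * (ct 3 1 ν x * Ta ν x)) := by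
    unfold DD; ring
  have : 0 ≤ 8 * wa ν x * (4 * n^4 * KK n^3 * ct 2 1 ν x + 6 * n^2 * KK n ^2 * (1 + n * KK n) * (ct 3 1 ν x * Ta ν x)) := by positivity
  linarith

theorem ct2_int {ν : Fin n → E n → ℝ} (h : Sol ν) : ∫ x, ct 2 1 ν x ≤ 2^n := by
  have h1 : ∫ x, ct 2 1 ν x ≤ ∫ x, (Metric.closedBall (0 : E n) 1).indicator (fun _ => (1:ℝ)) x := by
    refine integral_mono (by simpa using h.ct_int (k := 2) (by simp) one_pos (g := fun _ => 1) continuous_const) ?_ fun x => ?_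
    · rw [integrable_indicator_iff measurableSet_closedBall]
      exact continuousOn_const.integrableOn_compact (isCompact_closedBall _ _)
    · by_cases h0 : ct 2 1 ν x = 0
      · rw [h0]
        exact Set.indicator_nonneg (fun _ _ => zero_le_one) _
      · rw [Set.indicator_of_mem (by rw [mem_closedBall_zero_iff]; exact norm_le_of_tt zero_le_one (ct_supp (by simp) one_pos h0).le)]
        exact ct_le_one 2 1 ν x
  rw [integral_indicator measurableSet_closedBall, setIntegral_const, smul_eq_mul, Measure.real, Real.volume_pi_closedBall _ zero_le_one,
    ENNReal.toReal_ofReal (by positivity), Fintype.card_fin] at h1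
  simpa using h1

noncomputable def Ecal (ν : Fin n → E n → ℝ) : ℝ := ∫ x, ct 4 1 ν x * (Vd (Pm ν x) * T2 (Tm ν x))

theorem FB_bd {ν : Fin n → E n → ℝ} (h : Sol ν) {B : E n → Mt n} (sB : SmM B) (symB : ∀ x, (B x).IsSymm) (hB : ∀ x i j, |B x i j| ≤ KK n)
    (hdB : ∀ x k i j, |pd k (fun y => B y i j) x| ≤ 2 * n^2 * KK n^2 * Ta ν x) {F : E n → ℝ}
    (hF : ∀ x, ∑ k, pd k (fun y => Vd (Pm ν y) * ∑ b, Rm (Pm ν y) k b * (B y * Tm ν y b).trace) x = Vd (Pm ν x) * F x)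
    {mu : ℝ} (hm : 0 < mu) :
    ∫ x, ct 4 1 ν x * (Vd (Pm ν x) * F x) ≤ DD n * (mu * 2^n + mu * KK n * Ecal ν + 2 / mu * Wf ν) := by
  rw [FB_id h sB symB hF]
  have hK := KK_pos n
  have cV := h.smV.cont
  have cT := h.T2_cont
  have cw := h.w_cont
  have I2 : Integrable (ct 2 1 ν) := by simpa using h.ct_int (k := 2) (by simp) one_pos (g := fun _ => 1) continuous_const
  have Iw : Integrable fun x => ct 2 1 ν x * (wv ν x ⬝ᵥ wv ν x) := h.ct_int (by simp) one_pos cw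
  have IT : Integrable fun x => ct 4 1 ν x * (Vd (Pm ν x) * T2 (Tm ν x)) := h.ct_int (by simp) one_pos (by fun_prop)
  have Ibig : Integrable fun x => DD n * (mu * ct 2 1 ν x + mu * KK n * (ct 4 1 ν x * (Vd (Pm ν x) * T2 (Tm ν x))) + 2/mu * (ct 2 1 ν x * (wv ν x ⬝ᵥ wv ν x))) :=
    (((I2.const_mul mu).add (IT.const_mul _)).add (Iw.const_mul _)).const_mul _
  have pt : ∀ x, DD n * (wa ν x * (ct 2 1 ν x + ct 3 1 ν x * Ta ν x)) ≤ DD n * (mu * ct 2 1 ν x + mu * KK n * (ct 4 1 ν x * (Vd (Pm ν x) * T2 (Tm ν x))) + 2/mu * (ct 2 1 ν x * (wv ν x ⬝ᵥ wv ν x))) := fun x => by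
    refine mul_le_mul_of_nonneg_left ?_ (DD_nonneg n)
    rw [← Ta_sq, ← wa_sq, ct_pow 2, ct_pow 3, ct_pow 4]
    have v := h.V_ge x
    set c := ct 1 1 ν x
    set w := wa ν x
    set a := Ta ν x
    have amgm : ∀ y z : ℝ, y * z ≤ mu * y^2 + 1/mu * z^2 := fun y z => by
      have h1 : 0 ≤ (mu * y - z)^2 / mu := by positivity
      have h2 : (mu * y - z)^2 / mu = mu * y^2 + 1/mu * z^2 - 2 * (y * z) := by field_simp; ring
      have h3 : 0 ≤ mu * y^2 + 1/mu * z^2 := by positivity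
      linarith
    have b1 := amgm c (c * w)
    have b2 := amgm (c^2 * a) (c * w)
    have b3 : mu * (c^2*a)^2 * 1 ≤ mu * (c^2*a)^2 * (Vd (Pm ν x) * KK n) := by gcongr
    have e : mu * KK n * (c^4 * (Vd (Pm ν x) * a^2)) = mu * (c^2*a)^2 * (Vd (Pm ν x) * KK n) := by ring
    have e2 : 2/mu * (c^2 * w^2) = 1/mu * (c*w)^2 + 1/mu * (c*w)^2 := by ring
    have e3 : w * (c^2 + c^3*a) = c * (c*w) + c^2*a*(c*w) := by ring
    rw [e, e2, e3]
    linarith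
  refine (le_abs_self _).trans ((norm_integral_le_of_norm_le Ibig (Eventually.of_forall fun x => by
    rw [Real.norm_eq_abs]; exact (FB_pt h sB hB hdB x).trans (pt x))).trans ?_)
  have J1 : Integrable fun x => mu * ct 2 1 ν x + mu * KK n * (ct 4 1 ν x * (Vd (Pm ν x) * T2 (Tm ν x))) := (I2.const_mul mu).add (IT.const_mul _)
  rw [integral_const_mul, integral_add J1 (Iw.const_mul _), integral_add (I2.const_mul mu) (IT.const_mul _),
    integral_const_mul, integral_const_mul, integral_const_mul]
  refine mul_le_mul_of_nonneg_left ?_ (DD_nonneg n)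
  have := ct2_int h
  unfold Ecal Wf
  gcongr

theorem F0_bd {ν : Fin n → E n → ℝ} (h : Sol ν) {mu : ℝ} (hm : 0 < mu) :
    ∫ x, ct 4 1 ν x * (Vd (Pm ν x) * F0 (Pm ν x) (Tm ν x)) ≤ DD n * (mu * 2^n + mu * KK n * Ecal ν + 2 / mu * Wf ν) := by
  refine FB_bd h h.smQ (fun x => Qm_symm (h.sym x)) h.Q_le (fun x k i j => ?_) h.divF0 hm
  have := congrFun (congrFun (h.pdQ k x) i) j
  rw [pdM_apply] at this
  rw [this, Matrix.sub_apply]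
  have a1 := abs_mulM_le (abs_mulM_le (h.R_le x) (T_le ν x k)) (h.R_le x) i j
  have a2 := abs_mulM_le (abs_mulM_le (h.Q_le x) (T_le ν x k)) (h.Q_le x) i j
  refine (abs_sub _ _).trans ((add_le_add a1 a2).trans (le_of_eq ?_))
  ring

theorem F1_bd {ν : Fin n → E n → ℝ} (h : Sol ν) {mu : ℝ} (hm : 0 < mu) :
    ∫ x, ct 4 1 ν x * (Vd (Pm ν x) * F1 (Pm ν x) (Tm ν x)) ≤ DD n * (mu * 2^n + mu * KK n * Ecal ν + 2 / mu * Wf ν) := by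
  refine FB_bd h h.smP h.sym h.P_le (fun x k i j => ?_) h.divF1 hm
  refine (T_le ν x k i j).trans (le_mul_of_one_le_left (Ta_nonneg _ _) ?_)
  have h1 : (1:ℝ) ≤ n := by
    have := i.pos
    exact_mod_cast this
  have h2 := KK_ge n
  have h3 : (1:ℝ) ≤ n^2 := one_le_pow₀ h1
  have h4 : 1 ≤ KK n ^2 := one_le_pow₀ h2
  nlinarith

theorem Sol.P_cont {ν : Fin n → E n → ℝ} (h : Sol ν) : Continuous (Pm ν) :=
  continuous_matrix fun i j => (h.smP i j).cont
theorem Sol.T_cont {ν : Fin n → E n → ℝ} (h : Sol ν) : Continuous (Tm ν) :=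
  continuous_pi fun k => continuous_matrix fun i j => (h.smT k i j).cont

theorem Sol.Gf_cont {ν : Fin n → E n → ℝ} (h : Sol ν) : Continuous (fun x => Gf (Pm ν x) (Tm ν x)) ∧
   Continuous (fun x => F0 (Pm ν x) (Tm ν x)) ∧ Continuous (fun x => F1 (Pm ν x) (Tm ν x)) := by
  have cp := h.P_cont
  have cT := h.T_cont
  have cR := continuous_Rm cp h.sym
  have cQ := continuous_Qm cp h.sym
  have one : Continuous fun z : E n => (1 : Mt n) := continuous_const
  refine ⟨?_, ?_, ?_⟩
  · exact ((continuous_CC one cR cR cT).sub (continuous_CC one cQ cQ cT))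
  · exact (((continuous_CC cR cR cR cT).sub (continuous_CC cR cQ cQ cT)).add (continuous_CC cQ cR cQ cT) |>.add (continuous_CC cQ cQ cR cT))
  · exact (((continuous_CC cR one one cT).add (continuous_CC cp cR cQ cT)).add (continuous_CC cp cQ cR cT))

end SL
end

section
set_option autoImplicit false
set_option linter.unusedVariables false
set_option linter.unusedSimpArgs false
namespace SL
open Matrix MeasureTheory Filter Topology
open scoped ContDiff

variable {n : ℕ}

noncomputable def AA (n : ℕ) : ℝ := 8 * KK n * n * (1 + n * KK n)^2 * 2^n

theorem AA_nonneg (n : ℕ) : 0 ≤ AA n := by have := KK_pos n; unfold AA; positivity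

theorem G_bd {ν : Fin n → E n → ℝ} (h : Sol ν) {a : ℝ} (ha : 0 < a) :
    ∫ x, ct 4 1 ν x * (Vd (Pm ν x) * Gf (Pm ν x) (Tm ν x)) ≤ a * AA n + 8 / a * ∫ x, ct 4 1 ν x * (Vd (Pm ν x) * ∑ k, Y2 (Pm ν x) (Tm ν x) k ^ 2) := by
  have hK := KK_pos n
  have cV := h.smV.cont
  have cG := h.Gf_cont.1
  have ctq : Continuous fun x => ∑ k, (Qm (Pm ν x) * Tm ν x k).trace ^ 2 := (Sm.sum fun k => (h.smTQ k).pow 2).cont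
  have cY : Continuous fun x => ∑ k, Y2 (Pm ν x) (Tm ν x) k ^ 2 := (Sm.sum fun k => (h.smY k).pow 2).cont
  have I0 : Integrable fun x => ct 4 1 ν x * (Vd (Pm ν x) * Gf (Pm ν x) (Tm ν x)) := h.ct_int (by simp) one_pos (by fun_prop)
  have I1 : Integrable fun x => ct 4 1 ν x * (Vd (Pm ν x) * (Gf (Pm ν x) (Tm ν x) + ∑ k, (Qm (Pm ν x) * Tm ν x k).trace ^ 2)) :=
    h.ct_int (by simp) one_pos (cV.mul (cG.add ctq))
  have I2 : Integrable (ct 2 1 ν) := by simpa using h.ct_int (k := 2) (by simp) one_pos (g := fun _ => 1) continuous_const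
  have IY : Integrable fun x => ct 4 1 ν x * (Vd (Pm ν x) * ∑ k, Y2 (Pm ν x) (Tm ν x) k ^ 2) := h.ct_int (by simp) one_pos (by fun_prop)
  have s1 : ∫ x, ct 4 1 ν x * (Vd (Pm ν x) * Gf (Pm ν x) (Tm ν x)) ≤
      ∫ x, ct 4 1 ν x * (Vd (Pm ν x) * (Gf (Pm ν x) (Tm ν x) + ∑ k, (Qm (Pm ν x) * Tm ν x k).trace ^ 2)) := by
    refine integral_mono I0 I1 fun x => ?_
    have := (h.V_pos x).le
    have := ct_nonneg 4 1 ν x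
    have : 0 ≤ ∑ k, (Qm (Pm ν x) * Tm ν x k).trace ^ 2 := Finset.sum_nonneg fun _ _ => sq_nonneg _
    dsimp only
    gcongr
    linarith
  have i1 := ibp (fun k => (h.smV.mul (h.smY k)).c1) (h.ct_c1 2 1) (ct_hcs (by simp) one_pos ν)
  simp only [h.divF2, Nat.reduceAdd] at i1
  refine s1.trans ?_
  rw [i1]
  have Ibig : Integrable fun x => a * (8 * KK n * n * (1 + n * KK n)^2) * ct 2 1 ν x + 8 / a * (ct 4 1 ν x * (Vd (Pm ν x) * ∑ k, Y2 (Pm ν x) (Tm ν x) k ^ 2)) :=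
    (I2.const_mul _).add (IY.const_mul _)
  refine (neg_le_abs _).trans ?_
  rw [← Real.norm_eq_abs]
  refine (norm_integral_le_of_norm_le Ibig (Eventually.of_forall fun x => ?_)).trans ?_
  · rw [Real.norm_eq_abs]
    have e : ∑ k, Vd (Pm ν x) * Y2 (Pm ν x) (Tm ν x) k * pd k (ct 4 1 ν) x = ∑ k, (-8) * (Vd (Pm ν x) * (ct 3 1 ν x * xi ν x k * Y2 (Pm ν x) (Tm ν x) k)) := by
      refine Finset.sum_congr rfl fun k _ => ?_
      have := h.pd_ct 2 1 k x
      simp only [Nat.reduceAdd] at this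
      rw [this]; push_cast; ring
    rw [e]
    refine (Finset.abs_sum_le_sum_abs _ _).trans ?_
    have e2 : a * (8 * KK n * n * (1 + n * KK n)^2) * ct 2 1 ν x + 8 / a * (ct 4 1 ν x * (Vd (Pm ν x) * ∑ k, Y2 (Pm ν x) (Tm ν x) k ^ 2)) =
       ∑ k : Fin n, (a * (8 * KK n * (1 + n * KK n)^2) * ct 2 1 ν x + 8 / a * (ct 4 1 ν x * (Vd (Pm ν x) * Y2 (Pm ν x) (Tm ν x) k ^ 2))) := by
      rw [Finset.sum_add_distrib, Finset.sum_const, Finset.card_univ, Fintype.card_fin, ← Finset.mul_sum, ← Finset.mul_sum, ← Finset.mul_sum, nsmul_eq_mul]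
      ring
    rw [e2]
    refine Finset.sum_le_sum fun k _ => ?_
    have hV := h.V_pos x
    have hVl := h.V_le x
    set y := Y2 (Pm ν x) (Tm ν x) k
    by_cases hz : ct 1 1 ν x = 0
    · rw [ct_pow 3, ct_pow 2, ct_pow 4, hz]; simp
    have hxi := h.xi_le (by simpa using (ct_supp (by simp) one_pos hz).le) k
    rw [ct_pow 3, ct_pow 2, ct_pow 4]
    set c := ct 1 1 ν x
    set t := xi ν x k
    set V := Vd (Pm ν x)
    set K := KK n
    have ht : t^2 ≤ (1 + n*K)^2 := by rw [← sq_abs]; gcongr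
    have amgm : ∀ y z : ℝ, |y * z| ≤ a * y^2 + 1/a * z^2 := fun y z => by
      have h1 : 0 ≤ (a * |y| - |z|)^2 / a := by positivity
      have h2 : (a * |y| - |z|)^2 / a = a * |y|^2 + 1/a * |z|^2 - 2 * (|y| * |z|) := by field_simp; ring
      have h3 : 0 ≤ |y| * |z| := by positivity
      rw [abs_mul, ← sq_abs y, ← sq_abs z]
      linarith
    have e4 : -8 * (V * (c^3 * t * y)) = (-8 * V) * ((c * t) * (c^2*y)) := by ring
    have e5 : |-8 * V| = 8 * V := by rw [abs_mul, abs_of_pos hV]; norm_num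
    rw [e4, abs_mul, e5]
    calc 8 * V * |(c * t) * (c^2*y)| ≤ 8 * V * (a * (c*t)^2 + 1/a * (c^2*y)^2) := by gcongr; exact amgm _ _
      _ = 8 * a * c^2 * (V * t^2) + 8/a * (c^4 * (V * y^2)) := by ring
      _ ≤ 8 * a * c^2 * (K * (1 + n*K)^2) + 8/a * (c^4 * (V * y^2)) := by gcongr
      _ = _ := by ring
  · rw [integral_add (I2.const_mul _) (IY.const_mul _), integral_const_mul, integral_const_mul]
    have := ct2_int h
    have e : a * AA n = a * (8 * KK n * n * (1 + n * KK n)^2) * 2^n := by unfold AA; ring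
    rw [e]
    gcongr

theorem Ecal_nonneg {ν : Fin n → E n → ℝ} (h : Sol ν) : 0 ≤ Ecal ν :=
  integral_nonneg fun x => mul_nonneg (ct_nonneg _ _ _ _) (mul_nonneg (h.V_pos x).le (T2_nonneg _))

theorem Wf_nonneg (ν : Fin n → E n → ℝ) : 0 ≤ Wf ν :=
  integral_nonneg fun x => mul_nonneg (ct_nonneg _ _ _ _) (dot_nonneg _)

theorem exists_del (n : ℕ) : ∀ ε, 0 < ε → ∃ δ, 0 < δ ∧ ∃ η, 0 < η ∧ ∀ ν : Fin n → E n → ℝ, Sol ν → (∀ x, SpecBd (√3 + δ) (Pm ν x)) →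
    Wf ν ≤ η → Ecal ν ≤ ε := by
  intro ε hε
  obtain ⟨C0, C1, δ, hC0, hC1, hδ, hI⟩ := algI n
  have hK := KK_pos n
  have hD := DD_nonneg n
  have hA := AA_nonneg n
  obtain ⟨a, ha, haA⟩ : ∃ a, 0 < a ∧ a * AA n ≤ ε/128 := by
    refine ⟨ε/128/(AA n + 1), by positivity, ?_⟩
    rw [div_mul_eq_mul_div, div_le_iff₀ (by positivity)]
    nlinarith
  obtain ⟨C0', C1', δ', hC0', hC1', hδ', hII⟩ := algII n (κ := a/128) (by positivity)
  obtain ⟨M, hM⟩ : ∃ M, M = 8/a * (C1' + C0') + C1 + C0 := ⟨_, rfl⟩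
  have hM0 : 0 ≤ M := by rw [hM]; positivity
  obtain ⟨mu, hmu, hmuK, hmu2⟩ : ∃ mu, 0 < mu ∧ M * DD n * (mu * KK n) ≤ 1/32 ∧ M * DD n * (mu * 2^n) ≤ ε/128 := by
    refine ⟨min (1/32 / (M * DD n * KK n + 1)) (ε/128/(M * DD n * 2^n + 1)), by positivity, ?_, ?_⟩
    · have : min (1/32 / (M * DD n * KK n + 1)) (ε/128/(M * DD n * 2^n + 1)) * (M * DD n * KK n + 1) ≤ 1/32 := by
        rw [← le_div_iff₀ (by positivity)]; exact min_le_left _ _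
      have h2 : 0 < min (1/32 / (M * DD n * KK n + 1)) (ε/128/(M * DD n * 2^n + 1)) := by positivity
      nlinarith
    · have : min (1/32 / (M * DD n * KK n + 1)) (ε/128/(M * DD n * 2^n + 1)) * (M * DD n * 2^n + 1) ≤ ε/128 := by
        rw [← le_div_iff₀ (by positivity)]; exact min_le_right _ _
      have h2 : 0 < min (1/32 / (M * DD n * KK n + 1)) (ε/128/(M * DD n * 2^n + 1)) := by positivity
      nlinarith
  refine ⟨min δ δ', lt_min hδ hδ', ε/128 / (M * DD n * (2/mu) + 1), by positivity, fun ν h hb hW => ?_⟩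
  rw [le_div_iff₀ (by positivity)] at hW
  have hW0 := Wf_nonneg ν
  have cV := h.smV.cont
  have cT := h.T2_cont
  obtain ⟨cG, cF0, cF1⟩ := h.Gf_cont
  have cY : Continuous fun x => ∑ k, Y2 (Pm ν x) (Tm ν x) k ^ 2 := (Sm.sum fun k => (h.smY k).pow 2).cont
  have IG : Integrable fun x => ct 4 1 ν x * (Vd (Pm ν x) * Gf (Pm ν x) (Tm ν x)) := h.ct_int (by simp) one_pos (by fun_prop)
  have IF0 : Integrable fun x => ct 4 1 ν x * (Vd (Pm ν x) * F0 (Pm ν x) (Tm ν x)) := h.ct_int (by simp) one_pos (by fun_prop)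
  have IF1 : Integrable fun x => ct 4 1 ν x * (Vd (Pm ν x) * F1 (Pm ν x) (Tm ν x)) := h.ct_int (by simp) one_pos (by fun_prop)
  have IT : Integrable fun x => ct 4 1 ν x * (Vd (Pm ν x) * T2 (Tm ν x)) := h.ct_int (by simp) one_pos (by fun_prop)
  have IY : Integrable fun x => ct 4 1 ν x * (Vd (Pm ν x) * ∑ k, Y2 (Pm ν x) (Tm ν x) k ^ 2) := h.ct_int (by simp) one_pos (by fun_prop)
  have hV : ∀ x, 0 ≤ ct 4 1 ν x * Vd (Pm ν x) := fun x => mul_nonneg (ct_nonneg _ _ _ _) (h.V_pos x).le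
  have r1 : 1/8 * Ecal ν ≤ (∫ x, ct 4 1 ν x * (Vd (Pm ν x) * Gf (Pm ν x) (Tm ν x))) + C1 * (∫ x, ct 4 1 ν x * (Vd (Pm ν x) * F1 (Pm ν x) (Tm ν x)))
      + C0 * (∫ x, ct 4 1 ν x * (Vd (Pm ν x) * F0 (Pm ν x) (Tm ν x))) := by
    have J : Integrable fun x => ct 4 1 ν x * (Vd (Pm ν x) * Gf (Pm ν x) (Tm ν x)) + C1 * (ct 4 1 ν x * (Vd (Pm ν x) * F1 (Pm ν x) (Tm ν x))) := IG.add (IF1.const_mul _)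
    unfold Ecal
    rw [← integral_const_mul, ← integral_const_mul, ← integral_const_mul, ← integral_add IG (IF1.const_mul _), ← integral_add J (IF0.const_mul _)]
    refine integral_mono (IT.const_mul _) (J.add (IF0.const_mul _)) fun x => ?_
    have := mul_le_mul_of_nonneg_left (hI (Pm ν x) (Tm ν x) (h.sym x) ((hb x).mono (by linarith [min_le_left δ δ'])) (h.ts x)) (hV x)
    simp only [Pi.add_apply]
    linarith
  have r2 : (∫ x, ct 4 1 ν x * (Vd (Pm ν x) * ∑ k, Y2 (Pm ν x) (Tm ν x) k ^ 2)) ≤ a/128 * Ecal ν + C1' * (∫ x, ct 4 1 ν x * (Vd (Pm ν x) * F1 (Pm ν x) (Tm ν x)))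
      + C0' * (∫ x, ct 4 1 ν x * (Vd (Pm ν x) * F0 (Pm ν x) (Tm ν x))) := by
    have J : Integrable fun x => a/128 * (ct 4 1 ν x * (Vd (Pm ν x) * T2 (Tm ν x))) + C1' * (ct 4 1 ν x * (Vd (Pm ν x) * F1 (Pm ν x) (Tm ν x))) := (IT.const_mul _).add (IF1.const_mul _)
    unfold Ecal
    rw [← integral_const_mul, ← integral_const_mul, ← integral_const_mul, ← integral_add (IT.const_mul _) (IF1.const_mul _), ← integral_add J (IF0.const_mul _)]
    refine integral_mono IY (J.add (IF0.const_mul _)) fun x => ?_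
    have := mul_le_mul_of_nonneg_left (hII (Pm ν x) (Tm ν x) (h.sym x) ((hb x).mono (by linarith [min_le_right δ δ'])) (h.ts x)) (hV x)
    simp only [Pi.add_apply]
    linarith
  have r3 := G_bd h ha
  have b0 := F0_bd h hmu
  have b1 := F1_bd h hmu
  have hE := Ecal_nonneg h
  set X0 := ∫ x, ct 4 1 ν x * (Vd (Pm ν x) * F0 (Pm ν x) (Tm ν x))
  set X1 := ∫ x, ct 4 1 ν x * (Vd (Pm ν x) * F1 (Pm ν x) (Tm ν x))
  set XG := ∫ x, ct 4 1 ν x * (Vd (Pm ν x) * Gf (Pm ν x) (Tm ν x))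
  set XY := ∫ x, ct 4 1 ν x * (Vd (Pm ν x) * ∑ k, Y2 (Pm ν x) (Tm ν x) k ^ 2)
  set Ec := Ecal ν
  set Z := DD n * (mu * 2^n + mu * KK n * Ec + 2 / mu * Wf ν) with hZ
  have q1 : 8/a * XY ≤ 1/16 * Ec + 8/a * C1' * Z + 8/a * C0' * Z := by
    calc 8/a * XY ≤ 8/a * (a/128 * Ec + C1' * Z + C0' * Z) := by
          refine mul_le_mul_of_nonneg_left (r2.trans ?_) (by positivity)
          gcongr
      _ = _ := by field_simp; ring
  have q2 : C1 * X1 ≤ C1 * Z := by gcongr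
  have q3 : C0 * X0 ≤ C0 * Z := by gcongr
  have q4 : M * Z = 8/a * C1' * Z + 8/a * C0' * Z + C1 * Z + C0 * Z := by rw [hM]; ring
  have q5 : M * Z = M * DD n * (mu * 2^n) + M * DD n * (mu * KK n) * Ec + Wf ν * (M * DD n * (2/mu)) := by rw [hZ]; ring
  have q6 : M * DD n * (mu * KK n) * Ec ≤ 1/32 * Ec := by gcongr
  linarith

theorem Sol.nu_le {ν : Fin n → E n → ℝ} (h : Sol ν) (h0 : ∀ i, ν i 0 = 0) (i : Fin n) (x : E n) : |ν i x| ≤ n * KK n * ‖x‖ := by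
  have hK := KK_pos n
  have := Convex.norm_image_sub_le_of_norm_fderiv_le (𝕜 := ℝ) (f := ν i) (s := Set.univ) (C := n * KK n) (x := 0) (y := x)
    (fun y _ => (h.sm i).diff y) (fun y _ => ?_) convex_univ (Set.mem_univ _) (Set.mem_univ _)
  · simpa [h0] using this
  · refine ContinuousLinearMap.opNorm_le_bound _ (by positivity) fun v => ?_
    rw [fderiv_eq_sum, Real.norm_eq_abs, mul_assoc]
    exact abs_sum_le fun j => abs_mul_le' (h.P_le y i j) (norm_le_pi_norm v j)

noncomputable def rho (n : ℕ) : ℝ := (2 * (n+1)^2 * KK n)⁻¹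

theorem rho_pos (n : ℕ) : 0 < rho n := by have := KK_pos n; unfold rho; positivity

theorem Sol.tt_small {ν : Fin n → E n → ℝ} (h : Sol ν) (h0 : ∀ i, ν i 0 = 0) {x : E n} (hx : ‖x‖ ≤ rho n) : tt ν x ≤ 1/2 := by
  have hK := KK_ge n
  have hr := rho_pos n
  have hn : (0:ℝ) ≤ n := n.cast_nonneg
  have e : rho n * (2 * (n+1)^2 * KK n) = 1 := by unfold rho; exact inv_mul_cancel₀ (by positivity)
  have b1 : ∀ i, |x i| ≤ rho n := fun i => (norm_le_pi_norm x i).trans hx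
  have b2 : ∀ i, |ν i x| ≤ n * KK n * rho n := fun i => (h.nu_le h0 i x).trans (by gcongr)
  have t : tt ν x ≤ n * (rho n * rho n) + n * ((n * KK n * rho n)*(n * KK n * rho n)) := by
    unfold tt
    simp only [pow_two]
    exact add_le_add ((le_abs_self _).trans (abs_sum_le fun i => abs_mul_le' (b1 i) (b1 i))) ((le_abs_self _).trans (abs_sum_le fun i => abs_mul_le' (b2 i) (b2 i)))
  refine t.trans ?_
  set K := KK n
  set r := rho n
  set N : ℝ := (n:ℝ)
  have h1 : (r * (2 * (N+1)^2*K))^2 = 1 := by rw [e]; norm_num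
  have h2 : (N + N^3 * K^2) ≤ 1/2 * (2 * (N+1)^2*K)^2 := by
    have : 1/2 * (2 * (N+1)^2*K)^2 = 2 * (N+1)^4 * K^2 := by ring
    rw [this]
    have k2 : 1 ≤ K^2 := one_le_pow₀ hK
    have : N + N^3 * K^2 ≤ N * K^2 + N^3 * K^2 := by nlinarith
    refine this.trans ?_
    rw [← add_mul]
    gcongr
    nlinarith [pow_nonneg hn 2, pow_nonneg hn 3, pow_nonneg hn 4]
  calc N * (r * r) + N * ((N * K * r)*(N * K * r)) = r^2 * (N + N^3*K^2) := by ring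
    _ ≤ r^2 * (1/2 * (2 * (N+1)^2*K)^2) := by gcongr
    _ = 1/2 * (r * (2 * (N+1)^2*K))^2 := by ring
    _ = 1/2 := by rw [h1, mul_one]

theorem Ecal_ge {ν : Fin n → E n → ℝ} (h : Sol ν) (h0 : ∀ i, ν i 0 = 0) :
    ∫ x in Metric.closedBall 0 (rho n), T2 (Tm ν x) ≤ 16 * KK n * Ecal ν := by
  have hK := KK_pos n
  have cV := h.smV.cont
  have cT := h.T2_cont
  have IT : Integrable fun x => ct 4 1 ν x * (Vd (Pm ν x) * T2 (Tm ν x)) := h.ct_int (by simp) one_pos (by fun_prop)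
  unfold Ecal
  rw [← integral_const_mul, ← integral_indicator measurableSet_closedBall]
  refine integral_mono ?_ (IT.const_mul _) fun x => ?_
  · rw [integrable_indicator_iff measurableSet_closedBall]
    exact cT.continuousOn.integrableOn_compact (isCompact_closedBall _ _)
  · dsimp only
    have hT := T2_nonneg (Tm ν x)
    by_cases hx : x ∈ Metric.closedBall 0 (rho n)
    · rw [Set.indicator_of_mem hx]
      rw [mem_closedBall_zero_iff] at hx
      have ht := h.tt_small h0 hx
      have hc : 1/16 ≤ ct 4 1 ν x := by
        have : 1/2 ≤ ct 1 1 ν x := by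
          unfold ct pp
          simp
          left; linarith
        rw [ct_pow]
        calc (1/16:ℝ) = (1/2)^4 := by norm_num
          _ ≤ _ := by gcongr
      have hv := h.V_ge x
      have h1 : 1 ≤ 16 * ct 4 1 ν x := by linarith
      calc T2 (Tm ν x) = 1 * 1 * T2 (Tm ν x) := by ring
        _ ≤ (16 * ct 4 1 ν x) * (Vd (Pm ν x) * KK n) * T2 (Tm ν x) := by gcongr
        _ = _ := by ring
    · rw [Set.indicator_of_notMem hx]
      have := ct_nonneg 4 1 ν x
      have := (h.V_pos x).le
      positivity

/-- Prop P -/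
theorem propP (n : ℕ) : ∀ ε, 0 < ε → ∃ δ, 0 < δ ∧ ∃ η, 0 < η ∧ ∀ ν : Fin n → E n → ℝ, Sol ν → (∀ i, ν i 0 = 0) → (∀ x, SpecBd (√3 + δ) (Pm ν x)) →
    Wf ν ≤ η → ∫ x in Metric.closedBall 0 (rho n), T2 (Tm ν x) ≤ ε := by
  intro ε hε
  have hK := KK_pos n
  obtain ⟨δ, hδ, η, hη, H⟩ := exists_del n (ε / (16 * KK n)) (by positivity)
  refine ⟨δ, hδ, η, hη, fun ν h h0 hb hW => (Ecal_ge h h0).trans ?_⟩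
  have := H ν h hb hW
  rw [le_div_iff₀ (by positivity)] at this
  linarith

end SL
end

section
set_option autoImplicit false
set_option linter.unusedVariables false
set_option linter.unusedSimpArgs false
namespace SL
open Matrix MeasureTheory Filter Topology
open scoped ContDiff Pointwise

variable {n : ℕ}

def Bn (n : ℕ) : Set (E n) := Metric.closedBall 0 1

theorem Bn_meas : MeasurableSet (Bn n) := measurableSet_closedBall
theorem Bn_compact : IsCompact (Bn n) := isCompact_closedBall _ _
theorem Bn_conv : Convex ℝ (Bn n) := convex_closedBall _ _
theorem mem_Bn {x : E n} : x ∈ Bn n ↔ ‖x‖ ≤ 1 := mem_closedBall_zero_iff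
theorem Bn_int {f : E n → ℝ} (cf : Continuous f) : IntegrableOn f (Bn n) := cf.continuousOn.integrableOn_compact Bn_compact
theorem Bn_vol : volume.real (Bn n) = 2^n := by
  unfold Bn
  rw [Measure.real, Real.volume_pi_closedBall _ zero_le_one,
    ENNReal.toReal_ofReal (by positivity), Fintype.card_fin]
  simp
theorem Bn_const (c : ℝ) : ∫ x in Bn n, c = 2^n * c := by
  rw [setIntegral_const, Bn_vol, smul_eq_mul]
theorem Bn_comb {x y : E n} (hx : x ∈ Bn n) (hy : y ∈ Bn n) {θ : ℝ} (h0 : 0 ≤ θ) (h1 : θ ≤ 1) : (1-θ)•y + θ•x ∈ Bn n :=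
  Bn_conv hy hx (by linarith) h0 (by ring)

theorem scl {f : E n → ℝ} (cf : Continuous f) (fp : ∀ x, 0 ≤ f x) {y : E n} (hy : y ∈ Bn n) {θ : ℝ} (h0 : 0 < θ) (h1 : θ ≤ 1) :
    ∫ x in Bn n, f ((1-θ)•y + θ•x) ≤ (θ^n)⁻¹ * ∫ x in Bn n, f x := by
  have e := Measure.setIntegral_comp_smul_of_pos volume (fun z => f ((1-θ)•y + z)) (Bn n) h0
  rw [e, smul_eq_mul]
  have hd : Module.finrank ℝ (E n) = n := by simp [E]
  rw [hd]
  refine mul_le_mul_of_nonneg_left ?_ (by positivity)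
  have hc : IsCompact (θ • Bn n) := Bn_compact.smul θ
  have c2 : Continuous fun z : E n => f ((1-θ)•y + z) := by fun_prop
  have hI : Integrable ((Bn n).indicator f) := (integrable_indicator_iff Bn_meas).2 (Bn_int cf)
  rw [← integral_indicator hc.measurableSet, ← integral_indicator Bn_meas,
    ← integral_add_left_eq_self (μ := volume) (fun z => (Bn n).indicator f z) ((1-θ)•y)]
  refine integral_mono ((integrable_indicator_iff hc.measurableSet).2 (c2.continuousOn.integrableOn_compact hc)) (hI.comp_add_left _) fun z => ?_
  dsimp only
  by_cases hz : z ∈ θ • Bn n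
  · rw [Set.indicator_of_mem hz]
    obtain ⟨x, hx, rfl⟩ := hz
    dsimp only
    rw [Set.indicator_of_mem (Bn_comb hx hy h0.le h1)]
  · rw [Set.indicator_of_notMem hz]
    exact Set.indicator_nonneg (fun _ _ => fp _) _

theorem int_prod {X Y : Type*} [TopologicalSpace X] [TopologicalSpace Y] [MeasureSpace X] [MeasureSpace Y] [OpensMeasurableSpace X] [OpensMeasurableSpace Y]
    [SecondCountableTopologyEither X Y] [T2Space X] [T2Space Y] [SigmaFinite (volume : Measure X)] [SigmaFinite (volume : Measure Y)]
    [IsLocallyFiniteMeasure (volume : Measure X)] [IsLocallyFiniteMeasure (volume : Measure Y)] {A : Set X} {B : Set Y} (hA : IsCompact A) (hB : IsCompact B)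
    {f : X → Y → ℝ} (cf : Continuous (Function.uncurry f)) :
    Integrable (Function.uncurry f) ((volume.restrict A).prod (volume.restrict B)) := by
  rw [Measure.prod_restrict]
  exact cf.continuousOn.integrableOn_compact (hA.prod hB)

theorem seg {f : E n → ℝ} (cf : Continuous f) (fp : ∀ x, 0 ≤ f x) {y : E n} (hy : y ∈ Bn n) {s : ℝ} (h0 : 0 < s) (h1 : s ≤ 1) :
    IntegrableOn (fun x => ∫ θ in Set.Icc s 1, f ((1-θ)•y + θ•x)) (Bn n) ∧
    ∫ x in Bn n, ∫ θ in Set.Icc s 1, f ((1-θ)•y + θ•x) ≤ (s^n)⁻¹ * ∫ x in Bn n, f x := by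
  have I : Integrable (Function.uncurry fun (x : E n) (θ : ℝ) => f ((1-θ)•y + θ•x)) ((volume.restrict (Bn n)).prod (volume.restrict (Set.Icc s 1))) := by
    refine int_prod Bn_compact isCompact_Icc ?_
    unfold Function.uncurry; fun_prop
  refine ⟨I.integral_prod_left, ?_⟩
  rw [integral_integral_swap I]
  have hb : 0 ≤ ∫ x in Bn n, f x := integral_nonneg fun x => fp x
  have : ∫ θ in Set.Icc s 1, ∫ x in Bn n, f ((1-θ)•y + θ•x) ≤ ∫ θ in Set.Icc s 1, (s^n)⁻¹ * ∫ x in Bn n, f x := by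
    refine setIntegral_mono_on I.integral_prod_right (continuousOn_const.integrableOn_compact isCompact_Icc) measurableSet_Icc fun θ hθ => ?_
    have hθ0 := h0.trans_le hθ.1
    refine (scl cf fp hy hθ0 hθ.2).trans ?_
    gcongr
    exact hθ.1
  refine this.trans ?_
  rw [setIntegral_const, smul_eq_mul, Measure.real, Real.volume_Icc, ENNReal.toReal_ofReal (by linarith)]
  refine mul_le_of_le_one_left (by positivity) (by linarith)

theorem segline {f g : E n → ℝ} (hf : Sm f) (cg : Continuous g) (hg : ∀ k z, |pd k f z| ≤ g z) {x y : E n} (hx : x ∈ Bn n) (hy : y ∈ Bn n) {s : ℝ} (h0 : 0 ≤ s) (h1 : s ≤ 1) :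
    |f x - f ((1-s)•y + s•x)| ≤ 2 * n * ∫ θ in Set.Icc s 1, g ((1-θ)•y + θ•x) := by
  have hd : ∀ θ : ℝ, HasDerivAt (fun θ : ℝ => f ((1-θ)•y + θ•x)) (∑ k, pd k f ((1-θ)•y + θ•x) * (x - y) k) θ := fun θ => by
    have := (hf.diff ((1-θ)•y + θ•x)).hasFDerivAt
    rw [← fderiv_eq_sum]
    have l : HasDerivAt (fun θ : ℝ => (1-θ)•y + θ•x) (x - y) θ := by
      have a := (((hasDerivAt_id θ).const_sub 1).smul_const y).add ((hasDerivAt_id θ).smul_const x)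
      refine a.congr_deriv ?_
      simp; abel
    exact this.comp_hasDerivAt θ l
  have ci : Continuous fun θ : ℝ => ∑ k, pd k f ((1-θ)•y + θ•x) * (x - y) k := by
    refine continuous_finsetSum _ fun k _ => ?_
    have := (hf.pd k).cont
    fun_prop
  have ftc := intervalIntegral.integral_eq_sub_of_hasDerivAt (a := s) (b := 1) (fun θ _ => hd θ) (ci.intervalIntegrable _ _)
  rw [intervalIntegral.integral_of_le h1, ← integral_Icc_eq_integral_Ioc] at ftc
  simp only [sub_self, zero_smul, one_smul, zero_add] at ftc
  rw [← ftc, ← Real.norm_eq_abs, ← integral_const_mul]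
  have cgc : Continuous fun θ : ℝ => g ((1-θ)•y + θ•x) := by fun_prop
  refine norm_integral_le_of_norm_le ?_ (Eventually.of_forall fun θ => ?_)
  · exact (cgc.const_mul (2 * (n:ℝ))).continuousOn.integrableOn_compact isCompact_Icc
  · rw [Real.norm_eq_abs]
    have : ∀ k, |(x - y) k| ≤ 2 := fun k => by
      refine (norm_le_pi_norm (x-y) k).trans ((norm_sub_le _ _).trans ?_)
      have := mem_Bn.1 hx
      have := mem_Bn.1 hy
      linarith
    refine (abs_sum_le fun k => abs_mul_le' (hg k _) (this k)).trans (le_of_eq ?_)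
    ring

theorem halfL {f g : E n → ℝ} (hf : Sm f) (cg : Continuous g) (hg : ∀ k z, |pd k f z| ≤ g z) (gp : ∀ z, 0 ≤ g z) {y : E n} (hy : y ∈ Bn n) {s : ℝ} (h0 : 0 < s) (h1 : s ≤ 1) :
    ∫ x in Bn n, |f x - f ((1-s)•y + s•x)| ≤ 2 * n * ((s^n)⁻¹ * ∫ x in Bn n, g x) := by
  obtain ⟨I, hI⟩ := seg cg gp hy h0 h1
  have := hf.cont
  calc _ ≤ ∫ x in Bn n, 2 * n * ∫ θ in Set.Icc s 1, g ((1-θ)•y + θ•x) :=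
        setIntegral_mono_on (Bn_int (by fun_prop)) (I.const_mul _) Bn_meas fun x hx => segline hf cg hg hx hy h0.le h1
    _ ≤ _ := by
      rw [integral_const_mul]
      gcongr

theorem Sol.Ta_cont {ν : Fin n → E n → ℝ} (h : Sol ν) : Continuous (Ta ν) := h.T2_cont.sqrt

noncomputable def DP (ν : Fin n → E n → ℝ) (x : E n) (q : Mt n) : ℝ := ∑ i, ∑ j, |Pm ν x i j - q i j|

theorem DP_nonneg (ν : Fin n → E n → ℝ) (x : E n) (q : Mt n) : 0 ≤ DP ν x q := Finset.sum_nonneg fun _ _ => Finset.sum_nonneg fun _ _ => abs_nonneg _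

theorem Sol.DP_cont {ν : Fin n → E n → ℝ} (h : Sol ν) {Y : Type*} [TopologicalSpace Y] {f g : Y → E n} (hf : Continuous f) (hg : Continuous g) : Continuous fun y => DP ν (f y) (Pm ν (g y)) := by
  refine continuous_finsetSum _ fun i _ => continuous_finsetSum _ fun j _ => ?_
  have := (h.smP i j).cont
  exact ((this.comp hf).sub (this.comp hg)).abs

theorem DP_tri (ν : Fin n → E n → ℝ) (x y z : E n) : DP ν x (Pm ν z) ≤ DP ν x (Pm ν y) + DP ν z (Pm ν y) := by
  unfold DP
  simp only [← Finset.sum_add_distrib]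
  refine Finset.sum_le_sum fun i _ => Finset.sum_le_sum fun j _ => ?_
  rw [abs_sub_comm (Pm ν z i j)]
  exact abs_sub_le _ _ _

theorem poincare {ν : Fin n → E n → ℝ} (h : Sol ν) : ∃ y ∈ Bn n, ∫ x in Bn n, DP ν x (Pm ν y) ≤ 4 * n^3 * 2^n * ∫ x in Bn n, Ta ν x := by
  set m : E n → E n → E n := fun x y => (1 - (1/2:ℝ)) • y + (1/2:ℝ) • x with hm
  have msym : ∀ x y, m x y = m y x := fun x y => by
    simp only [hm]; norm_num; rw [add_comm]
  set H : E n → E n → ℝ := fun y x => DP ν x (Pm ν (m x y)) with hH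
  have cH : Continuous (Function.uncurry H) := h.DP_cont continuous_snd (by simp only [hm]; fun_prop)
  have cHs : Continuous (Function.uncurry fun y x => H x y) := h.DP_cont continuous_fst (by simp only [hm]; fun_prop)
  have cH1 : ∀ y, Continuous (H y) := fun y => h.DP_cont continuous_id (by simp only [hm]; fun_prop)
  have cH2 : ∀ y, Continuous (fun x => H x y) := fun y => h.DP_cont continuous_const (by simp only [hm]; fun_prop)
  have IH := int_prod (Bn_compact (n := n)) (Bn_compact (n := n)) cH
  have IHs := int_prod (Bn_compact (n := n)) (Bn_compact (n := n)) cHs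
  have ID : Integrable (Function.uncurry fun y x => DP ν x (Pm ν y)) ((volume.restrict (Bn n)).prod (volume.restrict (Bn n))) :=
    int_prod Bn_compact Bn_compact (h.DP_cont continuous_snd continuous_fst)
  set C : ℝ := 2 * n^3 * 2^n * ∫ x in Bn n, Ta ν x with hC
  have hb : ∀ y ∈ Bn n, ∫ x in Bn n, H y x ≤ C := fun y hy => by
    simp only [hH, DP]
    have cP : ∀ i j, Continuous fun x => |Pm ν x i j - Pm ν (m x y) i j| := fun i j => by
      have := (h.smP i j).cont
      have cm : Continuous fun x => m x y := by simp only [hm]; fun_prop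
      exact (this.sub (this.comp cm)).abs
    rw [integral_finsetSum _ fun i _ => integrable_finsetSum _ fun j _ => Bn_int (cP i j)]
    have : ∀ i : Fin n, ∫ x in Bn n, ∑ j, |Pm ν x i j - Pm ν (m x y) i j| ≤ n * (2 * n * (2^n * ∫ x in Bn n, Ta ν x)) := fun i => by
      rw [integral_finsetSum _ fun j _ => Bn_int (cP i j)]
      refine (Finset.sum_le_sum fun j _ => halfL (h.smP i j) h.Ta_cont (fun k z => ?_) (Ta_nonneg ν) hy (by norm_num) (by norm_num)).trans ?_
      · exact T_le ν z k i j
      · simp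
    refine (Finset.sum_le_sum fun i _ => this i).trans (le_of_eq ?_)
    rw [Finset.sum_const, Finset.card_univ, Fintype.card_fin, nsmul_eq_mul, hC]; ring
  have hInt0 : ∫ y in Bn n, ∫ x in Bn n, H y x ≤ 2^n * C := by
    rw [← Bn_const]
    exact setIntegral_mono_on IH.integral_prod_left (Bn_int continuous_const) Bn_meas hb
  have tot : ∫ y in Bn n, ∫ x in Bn n, DP ν x (Pm ν y) ≤ 2 * (2^n * C) := by
    calc _ ≤ ∫ y in Bn n, ((∫ x in Bn n, H y x) + ∫ x in Bn n, H x y) := by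
          refine integral_mono ID.integral_prod_left (IH.integral_prod_left.add IHs.integral_prod_left) fun y => ?_
          dsimp only
          rw [← integral_add (Bn_int (cH1 y)) (Bn_int (cH2 y))]
          refine integral_mono (Bn_int (h.DP_cont continuous_id continuous_const)) ((Bn_int (cH1 y)).add (Bn_int (cH2 y))) fun x => ?_
          have := DP_tri ν x (m x y) y
          simpa only [hH, msym y x, Pi.add_apply] using this
      _ = (∫ y in Bn n, ∫ x in Bn n, H y x) + ∫ y in Bn n, ∫ x in Bn n, H y x := by
          have A1 : Integrable (fun y => ∫ x in Bn n, H y x) (volume.restrict (Bn n)) := IH.integral_prod_left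
          have A2 : Integrable (fun y => ∫ x in Bn n, H x y) (volume.restrict (Bn n)) := IHs.integral_prod_left
          rw [integral_add A1 A2]
          congr 1
          exact integral_integral_swap IHs
      _ ≤ _ := by linarith
  have hv : volume (Bn n) ≠ 0 := fun h0 => by
    have := Bn_vol (n := n)
    rw [Measure.real, h0] at this
    have h2 : (0:ℝ) < 2^n := by positivity
    rw [ENNReal.toReal_zero] at this
    linarith
  obtain ⟨y, hy, hle⟩ := exists_le_setAverage hv Bn_compact.measure_ne_top ID.integral_prod_left
  refine ⟨y, hy, ?_⟩
  rw [setAverage_eq, Bn_vol, smul_eq_mul] at hle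
  refine hle.trans ?_
  rw [inv_mul_le_iff₀ (by positivity)]
  refine tot.trans (le_of_eq ?_)
  rw [hC]; ring

end SL
end

section
set_option autoImplicit false
set_option linter.unusedVariables false
set_option linter.unusedSimpArgs false
namespace SL
open Matrix MeasureTheory Filter Topology
open scoped ContDiff

variable {n : ℕ}

abbrev YQ (n : ℕ) := (Metric.closedBall (0 : E n) 1) × (Metric.closedBall (0 : E n) (n * KK n)) × PS n × PS n

theorem lemQ (n : ℕ) {κ : ℝ} (hκ : 0 < κ) : ∃ C : ℝ, 0 ≤ C ∧ ∀ (x v : E n) (p q : Mt n), x ∈ Bn n → ‖v‖ ≤ n * KK n → p ∈ PS n → q ∈ PS n →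
    pp 3 (x ⬝ᵥ x + v ⬝ᵥ v) * Vd p ≤ pp 3 (x ⬝ᵥ x + (q *ᵥ x) ⬝ᵥ (q *ᵥ x)) * Vd q + κ + C * (∑ i, ∑ j, |p i j - q i j| + ∑ i, |v i - (q *ᵥ x) i|) := by
  have cx : Continuous fun z : YQ n => z.1.1 := by fun_prop
  have cv : Continuous fun z : YQ n => z.2.1.1 := by fun_prop
  have cp : Continuous fun z : YQ n => z.2.2.1.1 := by fun_prop
  have cq : Continuous fun z : YQ n => z.2.2.2.1 := by fun_prop
  have cqx : Continuous fun z : YQ n => z.2.2.2.1 *ᵥ z.1.1 := cq.matrix_mulVec cx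
  have cf : Continuous fun z : YQ n => ∑ i, ∑ j, |z.2.2.1.1 i j - z.2.2.2.1 i j| + ∑ i, |z.2.1.1 i - (z.2.2.2.1 *ᵥ z.1.1) i| := by
    refine Continuous.add (continuous_finsetSum _ fun i _ => continuous_finsetSum _ fun j _ => ((cp.matrix_elem i j).sub (cq.matrix_elem i j)).abs)
      (continuous_finsetSum _ fun i _ => (((continuous_apply i).comp cv).sub ((continuous_apply i).comp cqx)).abs)
  have cg : Continuous fun z : YQ n => pp 3 (z.1.1 ⬝ᵥ z.1.1 + (z.2.2.2.1 *ᵥ z.1.1) ⬝ᵥ (z.2.2.2.1 *ᵥ z.1.1)) * Vd z.2.2.2.1 + κ - pp 3 (z.1.1 ⬝ᵥ z.1.1 + z.2.1.1 ⬝ᵥ z.2.1.1) * Vd z.2.2.1.1 := by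
    have := pp_cont 3
    exact (((this.comp ((cx.dotProduct cx).add (cqx.dotProduct cqx))).mul (continuous_Vd cq)).add continuous_const).sub ((this.comp ((cx.dotProduct cx).add (cv.dotProduct cv))).mul (continuous_Vd cp))
  have : CompactSpace (Metric.closedBall (0 : E n) 1) := isCompact_iff_compactSpace.1 (isCompact_closedBall _ _)
  have : CompactSpace (Metric.closedBall (0 : E n) (n * KK n)) := isCompact_iff_compactSpace.1 (isCompact_closedBall _ _)
  have hs1 : ∀ z : YQ n, 0 ≤ ∑ i, ∑ j, |z.2.2.1.1 i j - z.2.2.2.1 i j| := fun z => Finset.sum_nonneg fun _ _ => Finset.sum_nonneg fun _ _ => abs_nonneg _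
  have hs2 : ∀ z : YQ n, 0 ≤ ∑ i, |z.2.1.1 i - (z.2.2.2.1 *ᵥ z.1.1) i| := fun z => Finset.sum_nonneg fun _ _ => abs_nonneg _
  obtain ⟨C, hC, H⟩ := lemK (Y := YQ n) isClosed_univ cf cg (fun z _ => add_nonneg (hs1 z) (hs2 z)) (fun z _ hz => by
    have z1 := (add_eq_zero_iff_of_nonneg (hs1 z) (hs2 z)).1 hz
    have e1 : z.2.2.1.1 = z.2.2.2.1 := by
      ext i j
      have a := (Finset.sum_eq_zero_iff_of_nonneg (fun _ _ => Finset.sum_nonneg fun _ _ => abs_nonneg _)).1 z1.1 i (Finset.mem_univ i)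
      have b := (Finset.sum_eq_zero_iff_of_nonneg (fun _ _ => abs_nonneg _)).1 a j (Finset.mem_univ j)
      exact sub_eq_zero.1 (abs_eq_zero.1 b)
    have e2 : z.2.1.1 = z.2.2.2.1 *ᵥ z.1.1 := by
      ext i
      have b := (Finset.sum_eq_zero_iff_of_nonneg (fun _ _ => abs_nonneg _)).1 z1.2 i (Finset.mem_univ i)
      exact sub_eq_zero.1 (abs_eq_zero.1 b)
    rw [e2, e1]; linarith)
  refine ⟨C, hC, fun x v p q hx hv hp hq => ?_⟩
  have := H (⟨x, hx⟩, ⟨v, mem_closedBall_zero_iff.2 hv⟩, ⟨p, hp⟩, ⟨q, hq⟩) (Set.mem_univ _)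
  dsimp only at this
  linarith

theorem Sol.mem_PS {ν : Fin n → E n → ℝ} (h : Sol ν) (x : E n) : Pm ν x ∈ PS n := ⟨h.sym x, h.bd x⟩

/-- Prop Q, quantitative -/
theorem propQ' {ν : Fin n → E n → ℝ} (h : Sol ν) (h0 : ∀ i, ν i 0 = 0) {κ C s : ℝ} (hs : 0 < s) (hs1 : s ≤ 1) (hC : 0 ≤ C)
    (H : ∀ (x v : E n) (p q : Mt n), x ∈ Bn n → ‖v‖ ≤ n * KK n → p ∈ PS n → q ∈ PS n →
    pp 3 (x ⬝ᵥ x + v ⬝ᵥ v) * Vd p ≤ pp 3 (x ⬝ᵥ x + (q *ᵥ x) ⬝ᵥ (q *ᵥ x)) * Vd q + κ + C * (∑ i, ∑ j, |p i j - q i j| + ∑ i, |v i - (q *ᵥ x) i|)) {y : E n} (hy : y ∈ Bn n) :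
    Th ν 1 ≤ Th0 n + 2^n * κ + C * ((∫ x in Bn n, DP ν x (Pm ν y)) + n * (2 * n * KK n * s * 2^n + 2 * n * ((s^n)⁻¹ * ∫ x in Bn n, DP ν x (Pm ν y)))) := by
  have hK := KK_pos n
  set q := Pm ν y with hq
  have cD : Continuous fun x => DP ν x q := h.DP_cont continuous_id continuous_const
  have cV := h.smV.cont
  have cqx : Continuous fun x : E n => q *ᵥ x := continuous_const.matrix_mulVec continuous_id
  have sf : ∀ i, Sm fun x : E n => ν i x - (q *ᵥ x) i := fun i => by
    refine (h.sm i).sub ?_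
    simp only [Matrix.mulVec, dotProduct]
    exact Sm.sum fun j => (Sm.const _).mul (Sm.coord j)
  have csf : Continuous fun x : E n => ∑ i, |ν i x - (q *ᵥ x) i| := continuous_finsetSum _ fun i _ => (sf i).cont.abs
  have cpl : Continuous fun x : E n => pp 3 (x ⬝ᵥ x + (q *ᵥ x) ⬝ᵥ (q *ᵥ x)) * Vd q := by
    have := pp_cont 3
    exact (this.comp ((continuous_id.dotProduct continuous_id).add (cqx.dotProduct cqx))).mul continuous_const
  have hpd : ∀ i k z, |pd k (fun x : E n => ν i x - (q *ᵥ x) i) z| ≤ DP ν z q := fun i k z => by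
    have e : pd k (fun x : E n => ν i x - (q *ᵥ x) i) z = Pm ν z i k - q i k := by
      have d1 : ∀ j, DifferentiableAt ℝ (fun x : E n => q i j * x j) z := fun j => ((Sm.const _).mul (Sm.coord j)).diff z
      have s2 : Sm fun x : E n => ∑ j, q i j * x j := Sm.sum fun j => (Sm.const _).mul (Sm.coord j)
      simp only [Matrix.mulVec, dotProduct]
      rw [pd_sub k ((h.sm i).diff z) (s2.diff z), pd_sum]
      · have : ∀ j, pd k (fun x : E n => q i j * x j) z = if j = k then q i j else 0 := fun j => by
          rw [pd_mul k ((Sm.const _).diff z) ((Sm.coord j).diff z), pd_const, pd_coord]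
          simp
        simp only [this]
        simp [Pm]
      · intro j; exact d1 j
    rw [e]
    refine (Finset.single_le_sum (f := fun j => |Pm ν z i j - q i j|) (fun _ _ => abs_nonneg _) (Finset.mem_univ k)).trans ?_
    exact Finset.single_le_sum (f := fun i => ∑ j, |Pm ν z i j - q i j|) (fun _ _ => Finset.sum_nonneg fun _ _ => abs_nonneg _) (Finset.mem_univ i)
  set X := ∫ x in Bn n, DP ν x q with hX
  have hv : ∀ i, ∫ x in Bn n, |ν i x - (q *ᵥ x) i| ≤ 2 * n * KK n * s * 2^n + 2 * n * ((s^n)⁻¹ * X) := fun i => by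
    have c1 := (sf i).cont
    have z0 : (0 : E n) ∈ Bn n := mem_Bn.2 (by simp)
    have a := halfL (sf i) cD (hpd i) (fun z => DP_nonneg ν z q) z0 hs hs1
    refine le_trans ?_ (add_le_add_right a _)
    have cc : Continuous fun x : E n => |ν i x - (q *ᵥ x) i - (ν i ((1-s)•(0:E n) + s•x) - (q *ᵥ ((1-s)•(0:E n) + s•x)) i)| := by
      exact (c1.sub (c1.comp (by fun_prop : Continuous fun x : E n => (1-s)•(0:E n) + s•x))).abs
    have e : 2 * n * KK n * s * 2^n = ∫ x in Bn n, 2 * n * KK n * s := by rw [Bn_const]; ring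
    rw [e, ← integral_add (Bn_int continuous_const) (Bn_int cc)]
    refine setIntegral_mono_on (Bn_int c1.abs) ((Bn_int continuous_const).add (Bn_int cc)) Bn_meas fun x hx => ?_
    have hsx : ‖s • x‖ ≤ s := by
      rw [norm_smul, Real.norm_eq_abs, abs_of_pos hs]
      exact mul_le_of_le_one_right hs.le (mem_Bn.1 hx)
    have b1 := h.nu_le h0 i (s • x)
    have b2 : |(q *ᵥ (s • x)) i| ≤ n * (KK n * s) := abs_mulVec_le (h.P_le y) (fun j => (norm_le_pi_norm (s • x) j).trans hsx) i
    have b3 : n * KK n * ‖s • x‖ ≤ n * KK n * s := by gcongr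
    simp only [smul_zero, zero_add, Pi.add_apply]
    have t := abs_sub_abs_le_abs_sub (ν i x - (q *ᵥ x) i) (ν i (s • x) - (q *ᵥ (s • x)) i)
    have t2 := abs_sub (ν i (s • x)) ((q *ᵥ (s • x)) i)
    linarith
  have ev : ∫ x in Bn n, ∑ i, |ν i x - (q *ᵥ x) i| ≤ n * (2 * n * KK n * s * 2^n + 2 * n * ((s^n)⁻¹ * X)) := by
    rw [integral_finsetSum _ fun i _ => Bn_int (sf i).cont.abs]
    refine (Finset.sum_le_sum fun i _ => hv i).trans (le_of_eq ?_)
    rw [Finset.sum_const, Finset.card_univ, Fintype.card_fin, nsmul_eq_mul]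
  have e1 : Th ν 1 = ∫ x in Bn n, ct 3 1 ν x * Vd (Pm ν x) := by
    unfold Th If
    rw [setIntegral_eq_integral_of_forall_compl_eq_zero]
    · simp
    · intro x hx
      by_contra hne
      exact hx (mem_Bn.2 (norm_le_of_tt zero_le_one (ct_supp (by simp) one_pos (left_ne_zero_of_mul hne)).le))
  have e2 : ∫ x in Bn n, pp 3 (x ⬝ᵥ x + (q *ᵥ x) ⬝ᵥ (q *ᵥ x)) * Vd q ≤ Th0 n := by
    rw [← plane_id (h.sym y)]
    refine (setIntegral_eq_integral_of_forall_compl_eq_zero fun x hx => ?_).le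
    have : 1 ≤ x ⬝ᵥ x := by
      by_contra hlt
      refine hx (mem_Bn.2 ((pi_norm_le_iff_of_nonneg zero_le_one).2 fun i => ?_))
      have : x i * x i ≤ x ⬝ᵥ x := Finset.single_le_sum (f := fun i => x i * x i) (fun _ _ => mul_self_nonneg _) (Finset.mem_univ i)
      rw [Real.norm_eq_abs]
      exact abs_le_of_sq_le_sq (by nlinarith) zero_le_one
    rw [pp_zero (by simp), zero_mul]
    have := dot_nonneg (q *ᵥ x)
    linarith
  have cc3 : Continuous fun x => ct 3 1 ν x * Vd (Pm ν x) := (h.ct_c1 1 1).continuous.mul cV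
  have Iall := (((Bn_int cpl).add (Bn_int (continuous_const (y := κ)))).add ((((Bn_int cD).add (Bn_int csf)).const_mul C)))
  have main : Th ν 1 ≤ ∫ x in Bn n, (pp 3 (x ⬝ᵥ x + (q *ᵥ x) ⬝ᵥ (q *ᵥ x)) * Vd q + κ + C * (DP ν x q + ∑ i, |ν i x - (q *ᵥ x) i|)) := by
    rw [e1]
    refine setIntegral_mono_on (Bn_int cc3) Iall Bn_meas fun x hx => ?_
    have hn : ‖(fun i => ν i x : E n)‖ ≤ n * KK n := by
      refine (pi_norm_le_iff_of_nonneg (by positivity)).2 fun i => (h.nu_le h0 i x).trans ?_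
      exact mul_le_of_le_one_right (by positivity) (mem_Bn.1 hx)
    have := H x (fun i => ν i x) (Pm ν x) q hx hn (h.mem_PS x) (h.mem_PS y)
    have et : tt ν x / 1^2 = x ⬝ᵥ x + (fun i => ν i x) ⬝ᵥ (fun i => ν i x) := by
      simp [tt, dotProduct, pow_two]
    unfold ct
    rw [et]
    exact this
  have J1 : IntegrableOn (fun x : E n => pp 3 (x ⬝ᵥ x + (q *ᵥ x) ⬝ᵥ (q *ᵥ x)) * Vd q + κ) (Bn n) := Bn_int (cpl.add continuous_const)
  have J2 : IntegrableOn (fun x : E n => C * (DP ν x q + ∑ i, |ν i x - (q *ᵥ x) i|)) (Bn n) := Bn_int ((cD.add csf).const_mul C)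
  rw [integral_add J1 J2, integral_add (Bn_int cpl) (Bn_int continuous_const), Bn_const, integral_const_mul, integral_add (Bn_int cD) (Bn_int csf)] at main
  refine main.trans ?_
  gcongr

theorem Ta_int {ν : Fin n → E n → ℝ} (h : Sol ν) {mu : ℝ} (hm : 0 < mu) : ∫ x in Bn n, Ta ν x ≤ 2^n * mu + 1/mu * ∫ x in Bn n, T2 (Tm ν x) := by
  rw [← Bn_const, ← integral_const_mul, ← integral_add (Bn_int continuous_const) (Bn_int (h.T2_cont.const_mul _))]
  refine setIntegral_mono_on (Bn_int h.Ta_cont) ((Bn_int continuous_const).add (Bn_int (h.T2_cont.const_mul _))) Bn_meas fun x _ => ?_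
  rw [← Ta_sq]
  have h1 : 0 ≤ (mu - Ta ν x)^2 / mu := by positivity
  have h2 : (mu - Ta ν x)^2 / mu = mu + 1/mu * Ta ν x^2 - 2 * Ta ν x := by field_simp; ring
  have := Ta_nonneg ν x
  linarith

/-- Prop Q -/
theorem propQ (n : ℕ) {ε : ℝ} (hε : 0 < ε) : ∃ ε2, 0 < ε2 ∧ ∀ ν : Fin n → E n → ℝ, Sol ν → (∀ i, ν i 0 = 0) →
    ∫ x in Bn n, T2 (Tm ν x) ≤ ε2 → Th ν 1 ≤ Th0 n + ε := by
  have hK := KK_pos n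
  obtain ⟨C, hC, H⟩ := lemQ n (κ := ε/4/2^n) (by positivity)
  obtain ⟨s, hs, hs1, hsC⟩ : ∃ s : ℝ, 0 < s ∧ s ≤ 1 ∧ s * (C * (n * (2 * n * KK n * 2^n))) ≤ ε/4 := by
    refine ⟨min 1 (ε/4/(C * (n * (2 * n * KK n * 2^n)) + 1)), by positivity, min_le_left _ _, ?_⟩
    have p : 0 < min 1 (ε/4/(C * (n * (2 * n * KK n * 2^n)) + 1)) := by positivity
    have : min 1 (ε/4/(C * (n * (2 * n * KK n * 2^n)) + 1)) * (C * (n * (2 * n * KK n * 2^n)) + 1) ≤ ε/4 := by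
      rw [← le_div_iff₀ (by positivity)]; exact min_le_right _ _
    linarith
  set B : ℝ := C * (1 + n * (2 * n * (s^n)⁻¹)) * (4 * n^3 * 2^n) with hB
  have hB0 : 0 ≤ B := by positivity
  obtain ⟨mu, hmu, hmuB⟩ : ∃ mu : ℝ, 0 < mu ∧ mu * (B * 2^n) ≤ ε/4 := by
    refine ⟨ε/4/(B * 2^n + 1), by positivity, ?_⟩
    rw [div_mul_eq_mul_div, div_le_iff₀ (by positivity)]
    nlinarith
  refine ⟨ε/4 / (B * (1/mu) + 1), by positivity, fun ν h h0 hT => ?_⟩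
  rw [le_div_iff₀ (by positivity)] at hT
  obtain ⟨y, hy, hX⟩ := poincare h
  have q := propQ' h h0 hs hs1 hC H hy
  have t := Ta_int h hmu
  have hI : 0 ≤ ∫ x in Bn n, T2 (Tm ν x) := integral_nonneg fun x => T2_nonneg _
  set X := ∫ x in Bn n, DP ν x (Pm ν y)
  set I := ∫ x in Bn n, Ta ν x
  set J := ∫ x in Bn n, T2 (Tm ν x)
  have a1 : C * (X + n * (2 * n * KK n * s * 2^n + 2 * n * ((s^n)⁻¹ * X))) = s * (C * (n * (2 * n * KK n * 2^n))) + C * (1 + n * (2 * n * (s^n)⁻¹)) * X := by ring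
  have a2 : C * (1 + n * (2 * n * (s^n)⁻¹)) * X ≤ C * (1 + n * (2 * n * (s^n)⁻¹)) * (4 * n^3 * 2^n * I) := by gcongr
  have a3 : C * (1 + n * (2 * n * (s^n)⁻¹)) * (4 * n^3 * 2^n * I) = B * I := by rw [hB]; ring
  have a4 : B * I ≤ B * (2^n * mu + 1/mu * J) := by gcongr
  have a5 : (2:ℝ)^n * (ε/4/2^n) = ε/4 := by field_simp
  rw [a1, a5] at q
  have a6 : B * (2^n * mu + 1/mu * J) = mu * (B * 2^n) + J * (B * (1/mu)) := by ring
  linarith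

end SL
end

section
set_option autoImplicit false
set_option linter.unusedVariables false
set_option linter.unusedSimpArgs false
namespace SL
open Matrix MeasureTheory Filter Topology
open scoped ContDiff
variable {n : ℕ}

theorem Lop_sum {ι : Type*} (s : Finset ι) (ν : Fin n → E n → ℝ) {f : ι → E n → ℝ} (hf : ∀ i, Sm (f i)) (x : E n) :
    Lop ν (fun y => ∑ i ∈ s, f i y) x = ∑ i ∈ s, Lop ν (f i) x := by
  unfold Lop
  have e : ∀ b, pd b (fun y => ∑ i ∈ s, f i y) = fun y => ∑ i ∈ s, pd b (f i) y := fun b =>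
    funext fun y => pd_sum b fun i => (hf i).diff y
  have e2 : ∀ k b, pd k (pd b (fun y => ∑ i ∈ s, f i y)) x = ∑ i ∈ s, pd k (pd b (f i)) x := by
    intro k b
    rw [e b]; exact pd_sum k fun i => ((hf i).pd b).diff x
  simp only [e2, Finset.mul_sum]
  have e3 : ∀ k : Fin n, ∑ b, ∑ i ∈ s, Rm (Pm ν x) k b * pd k (pd b (f i)) x = ∑ i ∈ s, ∑ b, Rm (Pm ν x) k b * pd k (pd b (f i)) x :=
    fun k => Finset.sum_comm
  exact (Finset.sum_congr rfl fun k _ => e3 k).trans Finset.sum_comm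

theorem Lop_sq (ν : Fin n → E n → ℝ) (hs : ∀ x, (Pm ν x).IsSymm) {f : E n → ℝ} (hf : Sm f) (x : E n) :
    Lop ν (fun y => f y ^ 2) x = 2 * f x * Lop ν f x + 2 * ((fun a => pd a f x) ⬝ᵥ (Rm (Pm ν x) *ᵥ fun a => pd a f x)) := by
  have e1 : ∀ b, pd b (fun y => f y ^ 2) = fun y => 2 * (f y * pd b f y) := by
    intro b; funext y
    have : (fun y => f y ^ 2) = fun y => f y * f y := by funext z; ring
    rw [this, pd_mul b (hf.diff y) (hf.diff y)]; ring
  have e2 : ∀ k b, pd k (pd b (fun y => f y ^ 2)) x = 2 * (pd k f x * pd b f x + f x * pd k (pd b f) x) := by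
    intro k b
    rw [e1 b, pd_mul k ((Sm.const 2).diff x) ((hf.mul (hf.pd b)).diff x), pd_const,
      pd_mul k (hf.diff x) ((hf.pd b).diff x)]; ring
  unfold Lop
  simp only [e2, dotProduct, Matrix.mulVec, Finset.mul_sum, ← Finset.sum_add_distrib]
  refine Finset.sum_congr rfl fun k _ => Finset.sum_congr rfl fun b _ => ?_
  ring

noncomputable def Uu (ν : Fin n → E n → ℝ) (x : E n) : ℝ := ∑ k, ∑ i, ∑ j, ∑ a, (pd a (fun y => Tm ν y k i j) x)^2

theorem Uu_nonneg (ν : Fin n → E n → ℝ) (x : E n) : 0 ≤ Uu ν x := by unfold Uu; positivity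

theorem U_le (ν : Fin n → E n → ℝ) (x : E n) (a k i j : Fin n) : |pd a (fun y => Tm ν y k i j) x| ≤ √(Uu ν x) := by
  rw [← Real.sqrt_sq_eq_abs]
  apply Real.sqrt_le_sqrt
  unfold Uu
  refine le_trans ?_ (Finset.single_le_sum (f := fun k => ∑ i, ∑ j, ∑ a, (pd a (fun y => Tm ν y k i j) x)^2) (fun _ _ => by positivity) (Finset.mem_univ k))
  refine le_trans ?_ (Finset.single_le_sum (f := fun i => ∑ j, ∑ a, (pd a (fun y => Tm ν y k i j) x)^2) (fun _ _ => by positivity) (Finset.mem_univ i))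
  refine le_trans ?_ (Finset.single_le_sum (f := fun j => ∑ a, (pd a (fun y => Tm ν y k i j) x)^2) (fun _ _ => by positivity) (Finset.mem_univ j))
  exact (Finset.single_le_sum (f := fun a => (pd a (fun y => Tm ν y k i j) x)^2) (fun _ _ => by positivity) (Finset.mem_univ a))

theorem Sol.LT_eq {ν : Fin n → E n → ℝ} (h : Sol ν) (x : E n) (l i j : Fin n) :
    Lop ν (fun y => Tm ν y l j i) x =
      -(((pdM l (pdM i (fun y => Rm (Pm ν y))) x * Tm ν x j).trace + (pdM i (fun y => Rm (Pm ν y)) x * pdM l (fun y => Tm ν y j) x).trace))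
      - ∑ k, ∑ b, pdM l (fun y => Rm (Pm ν y)) x k b * pd k (fun y => Tm ν y b j i) x := by
  have e0 : (fun x => ∑ k, ∑ b, Rm (Pm ν x) k b * pd k (fun y => Tm ν y b j i) x) =
      fun x => -(pdM i (fun y => Rm (Pm ν y)) x * Tm ν x j).trace := funext fun x => h.eqdiff x i j
  have e1 := congrArg (fun f => pd l f x) e0
  beta_reduce at e1
  have sP := h.smR.pdM i
  rw [pd_neg, pd_trace (sP.mul (h.smT j)), pdM_mul sP (h.smT j), Matrix.trace_add] at e1
  rw [pd_sum l fun k => (Sm.sum fun b => (h.smR k b).mul ((h.smT b j i).pd k)).diff x] at e1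
  rw [← e1, eq_sub_iff_add_eq]
  unfold Lop
  rw [← Finset.sum_add_distrib]
  refine Finset.sum_congr rfl fun k _ => ?_
  rw [pd_sum l fun b => ((h.smR k b).mul ((h.smT b j i).pd k)).diff x, ← Finset.sum_add_distrib]
  refine Finset.sum_congr rfl fun b _ => ?_
  rw [pd_mul l ((h.smR k b).diff x) (((h.smT b j i).pd k).diff x)]
  have e2 : pd l (pd k (fun y => Tm ν y b j i)) x = pd k (pd b (fun y => Tm ν y l j i)) x := by
    rw [pd_comm (h.smT b j i)]
    congr 1; funext y; exact h.U_comm y l b j i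
  rw [e2, pdM_apply]; ring

theorem abs_mul3_le {A B C : Mt n} {a b c : ℝ} (h1 : ∀ i j, |A i j| ≤ a) (h2 : ∀ i j, |B i j| ≤ b) (h3 : ∀ i j, |C i j| ≤ c)
    (i j : Fin n) : |(A * B * C) i j| ≤ (n:ℝ)^2 * (a * b * c) := by
  refine (abs_mulM_le (abs_mulM_le h1 h2) h3 i j).trans (le_of_eq ?_); ring

theorem Sol.pdR_le {ν : Fin n → E n → ℝ} (h : Sol ν) (x : E n) (k i j : Fin n) :
    |pdM k (fun y => Rm (Pm ν y)) x i j| ≤ 2 * (n:ℝ)^2 * KK n ^ 2 * Ta ν x := by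
  rw [h.pdR, Matrix.neg_apply, abs_neg, Matrix.add_apply]
  refine (abs_add_le _ _).trans ?_
  have h1 := abs_mul3_le (h.R_le x) (T_le ν x k) (h.Q_le x) i j
  have h2 := abs_mul3_le (h.Q_le x) (T_le ν x k) (h.R_le x) i j
  linarith
theorem Sol.pdQ_le {ν : Fin n → E n → ℝ} (h : Sol ν) (x : E n) (k i j : Fin n) :
    |pdM k (fun y => Qm (Pm ν y)) x i j| ≤ 2 * (n:ℝ)^2 * KK n ^ 2 * Ta ν x := by
  rw [h.pdQ, Matrix.sub_apply]
  refine (abs_sub _ _).trans ?_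
  have h1 := abs_mul3_le (h.R_le x) (T_le ν x k) (h.R_le x) i j
  have h2 := abs_mul3_le (h.Q_le x) (T_le ν x k) (h.Q_le x) i j
  linarith

theorem Sol.pd3_le {A B C : E n → Mt n} (sA : SmM A) (sB : SmM B) (sC : SmM C) {x : E n} (l : Fin n)
    {a b c a' b' c' : ℝ} (h1 : ∀ i j, |A x i j| ≤ a) (h2 : ∀ i j, |B x i j| ≤ b) (h3 : ∀ i j, |C x i j| ≤ c)
    (h1' : ∀ i j, |pdM l A x i j| ≤ a') (h2' : ∀ i j, |pdM l B x i j| ≤ b') (h3' : ∀ i j, |pdM l C x i j| ≤ c') (i j : Fin n) :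
    |pdM l (fun y => A y * B y * C y) x i j| ≤ (n:ℝ)^2 * (a' * b * c + a * b' * c + a * b * c') := by
  rw [pdM_mul (sA.mul sB) sC, pdM_mul sA sB, add_mul, Matrix.add_apply, Matrix.add_apply]
  have t1 := abs_mul3_le h1' h2 h3 i j
  have t2 := abs_mul3_le h1 h2' h3 i j
  have t3 := abs_mul3_le h1 h2 h3' i j
  have := abs_add_le ((pdM l A x * B x * C x) i j + (A x * pdM l B x * C x) i j) ((A x * B x * pdM l C x) i j)
  have := abs_add_le ((pdM l A x * B x * C x) i j) ((A x * pdM l B x * C x) i j)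
  linarith

theorem Sol.ppR_le {ν : Fin n → E n → ℝ} (h : Sol ν) (x : E n) (l i a b : Fin n) :
    |pdM l (pdM i (fun y => Rm (Pm ν y))) x a b| ≤
      2 * (n:ℝ)^2 * (4 * (n:ℝ)^2 * KK n ^ 3 * Ta ν x^2 + KK n^2 * √(Uu ν x)) := by
  have e : pdM i (fun y => Rm (Pm ν y)) = fun x => -(Rm (Pm ν x) * Tm ν x i * Qm (Pm ν x) + Qm (Pm ν x) * Tm ν x i * Rm (Pm ν x)) :=
    funext fun x => h.pdR i x
  rw [e, pdM_neg, pdM_add ((h.smR.mul (h.smT i)).mul h.smQ) ((h.smQ.mul (h.smT i)).mul h.smR), Matrix.neg_apply, abs_neg, Matrix.add_apply]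
  refine (abs_add_le _ _).trans ?_
  have h1 := Sol.pd3_le h.smR (h.smT i) h.smQ l (h.R_le x) (T_le ν x i) (h.Q_le x) (h.pdR_le x l)
    (fun a b => U_le ν x l i a b) (h.pdQ_le x l) a b
  have h2 := Sol.pd3_le h.smQ (h.smT i) h.smR l (h.Q_le x) (T_le ν x i) (h.R_le x) (h.pdQ_le x l)
    (fun a b => U_le ν x l i a b) (h.pdR_le x l) a b
  linarith

theorem Sol.LT_le {ν : Fin n → E n → ℝ} (h : Sol ν) (x : E n) (l j i : Fin n) :
    |Lop ν (fun y => Tm ν y l j i) x| ≤ 8 * (n:ℝ)^6 * KK n^3 * Ta ν x^3 + 6 * (n:ℝ)^4 * KK n^2 * (Ta ν x * √(Uu ν x)) := by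
  rw [h.LT_eq]
  have h1 := abs_trace_le (abs_mulM_le (h.ppR_le x l i) (T_le ν x j))
  have h2 := abs_trace_le (abs_mulM_le (h.pdR_le x i) (fun a b => U_le ν x l j a b : ∀ a b, |pdM l (fun y => Tm ν y j) x a b| ≤ _))
  have h3 := abs_sum_le fun k => abs_sum_le fun b => abs_mul_le' (h.pdR_le x l k b) (U_le ν x k b j i)
  refine (abs_sub _ _).trans ?_
  rw [abs_neg]
  refine (add_le_add_left (abs_add_le _ _) _).trans ?_
  refine (add_le_add (add_le_add h1 h2) h3).trans (le_of_eq ?_)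
  ring

theorem LT2 (n : ℕ) : ∃ C : ℝ, 0 < C ∧ ∀ ν : Fin n → E n → ℝ, Sol ν → ∀ x,
    -C * (T2 (Tm ν x))^2 ≤ Lop ν (fun y => T2 (Tm ν y)) x := by
  have hK := KK_pos n
  set K := KK n with hKdef
  refine ⟨2 * n^3 * (8 * (n:ℝ)^6 * K^3) + 2 * n^6 * (6 * (n:ℝ)^4 * K^2)^2 * K + 1, by positivity, fun ν h x => ?_⟩
  have e : Lop ν (fun y => T2 (Tm ν y)) x = ∑ k, ∑ i, ∑ j, Lop ν (fun y => Tm ν y k i j ^ 2) x := by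
    have s1 : ∀ k i j, Sm (fun y => Tm ν y k i j ^ 2) := fun k i j => (h.smT k i j).pow 2
    unfold T2
    rw [Lop_sum _ ν (fun k => Sm.sum fun i => Sm.sum fun j => s1 k i j)]
    refine Finset.sum_congr rfl fun k _ => ?_
    rw [Lop_sum _ ν (fun i => Sm.sum fun j => s1 k i j)]
    refine Finset.sum_congr rfl fun i _ => ?_
    rw [Lop_sum _ ν (fun j => s1 k i j)]
  rw [e]
  set t := Ta ν x with ht
  set u := √(Uu ν x) with hu
  have t0 : 0 ≤ t := Ta_nonneg ν x
  have u0 : 0 ≤ u := Real.sqrt_nonneg _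
  have u2 : u^2 = Uu ν x := Real.sq_sqrt (Uu_nonneg ν x)
  set c1 := 8 * (n:ℝ)^6 * K^3 with hc1
  set c2 := 6 * (n:ℝ)^4 * K^2 with hc2
  have hc10 : 0 ≤ c1 := by positivity
  have hc20 : 0 ≤ c2 := by positivity
  have b1 : ∀ k i j, -(2 * t * (c1 * t^3 + c2 * (t*u))) + 2/K * ∑ a, (pd a (fun y => Tm ν y k i j) x)^2 ≤ Lop ν (fun y => Tm ν y k i j ^ 2) x := by
    intro k i j
    rw [Lop_sq ν h.sym (h.smT k i j)]
    have h1 := abs_mul_le' (T_le ν x k i j) (h.LT_le x k i j)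
    have h2 := (abs_le.mp h1).1
    have h3 := h.R_ge x (fun a => pd a (fun y => Tm ν y k i j) x)
    have h4 : ∑ a, (pd a (fun y => Tm ν y k i j) x)^2 = (fun a => pd a (fun y => Tm ν y k i j) x) ⬝ᵥ (fun a => pd a (fun y => Tm ν y k i j) x) := by
      simp only [dotProduct, sq]
    rw [← h4] at h3
    have h5 : 2/K * ∑ a, (pd a (fun y => Tm ν y k i j) x)^2 ≤ 2 * ((fun a => pd a (fun y => Tm ν y k i j) x) ⬝ᵥ (Rm (Pm ν x) *ᵥ fun a => pd a (fun y => Tm ν y k i j) x)) := by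
      rw [div_mul_eq_mul_div, div_le_iff₀ hK]; linarith
    have h6 : 2 * Tm ν x k i j * Lop ν (fun y => Tm ν y k i j) x = 2 * (Tm ν x k i j * Lop ν (fun y => Tm ν y k i j) x) := by ring
    rw [h6]
    linarith
  have b2 : (n:ℝ)^3 * -(2 * t * (c1 * t^3 + c2 * (t*u))) + 2/K * u^2 ≤ ∑ k, ∑ i, ∑ j, Lop ν (fun y => Tm ν y k i j ^ 2) x := by
    refine le_trans (le_of_eq ?_) (Finset.sum_le_sum fun k _ => Finset.sum_le_sum fun i _ => Finset.sum_le_sum fun j _ => b1 k i j)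
    rw [u2]; unfold Uu
    simp only [Finset.sum_add_distrib, Finset.sum_const, Finset.card_univ, Fintype.card_fin, nsmul_eq_mul, Finset.mul_sum]
    ring
  refine le_trans ?_ b2
  have hT : T2 (Tm ν x) = t^2 := (Ta_sq ν x).symm
  rw [hT]
  have key : 2 * (n:ℝ)^3 * c2 * (t^2*u) ≤ 2/K*u^2 + 2*n^6*c2^2*K*(t^2)^2 := by
    have e3 : 2/K*u^2 + 2*n^6*c2^2*K*(t^2)^2 - 2 * (n:ℝ)^3 * c2 * (t^2*u)
      = (1/K) * ((u - n^3*c2*K*t^2)^2 + u^2 + (n^3*c2*K*t^2)^2) := by field_simp; ring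
    have : 0 ≤ (1/K) * ((u - n^3*c2*K*t^2)^2 + u^2 + (n^3*c2*K*t^2)^2) := by positivity
    linarith
  have : 0 ≤ (t^2)^2 := by positivity
  nlinarith
end SL
end

section
set_option autoImplicit false
set_option linter.unusedVariables false
set_option linter.unusedSimpArgs false
namespace SL
open Matrix MeasureTheory Filter Topology
open scoped ContDiff
variable {n : ℕ}

theorem Sol.T2_sm {ν : Fin n → E n → ℝ} (h : Sol ν) : Sm fun x => T2 (Tm ν x) :=
  Sm.sum fun k => Sm.sum fun i => Sm.sum fun j => (h.smT k i j).pow 2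

theorem Sol.T2_sc {ν : Fin n → E n → ℝ} (h : Sol ν) (x0 : E n) {r : ℝ} (hr : r ≠ 0) (x : E n) :
    T2 (Tm (SL.sc ν x0 r) x) = r^2 * T2 (Tm ν (x0 + r • x)) := by
  rw [h.sc_T x0 hr, T2_smul]

theorem choiSchoen (n : ℕ) : ∃ ε0, 0 < ε0 ∧ ∀ ν : Fin n → E n → ℝ, Sol ν →
    (∀ x0 r, 0 < r → ∫ x in Bn n, T2 (Tm (SL.sc ν x0 r) x) ≤ ε0) → ∀ x, T2 (Tm ν x) = 0 := by
  obtain ⟨C, hC, HC⟩ := LT2 n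
  have hK := KK_pos n
  have hT := Th0_pos n
  refine ⟨Th0 n / (2 * (Real.exp (4*C/16) * KK n)), by positivity, fun ν h H z => ?_⟩
  by_contra hz
  have hz0 : 0 < T2 (Tm ν z) := lt_of_le_of_ne (T2_nonneg _) (Ne.symm hz)
  have tz : 0 < Ta ν z := Real.sqrt_pos.2 hz0
  set R := 2 / Ta ν z with hR
  have R0 : 0 < R := by positivity
  have cg : Continuous fun x => (R - ‖x - z‖) * Ta ν x := by
    have := h.Ta_cont; fun_prop
  obtain ⟨y, hy, hmax⟩ := (isCompact_closedBall z R).exists_isMaxOn ⟨z, by simp [R0.le]⟩ cg.continuousOn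
  have hmax' : ∀ x, ‖x - z‖ ≤ R → (R - ‖x - z‖) * Ta ν x ≤ (R - ‖y - z‖) * Ta ν y := fun x hx =>
    hmax (mem_closedBall_iff_norm.2 hx)
  have h2 : 2 ≤ (R - ‖y - z‖) * Ta ν y := by
    have := hmax' z (by simp [R0.le])
    simp only [sub_self, norm_zero, sub_zero] at this
    have e : R * Ta ν z = 2 := by rw [hR]; field_simp
    linarith
  have hd0 : 0 ≤ R - ‖y - z‖ := by have := mem_closedBall_iff_norm.1 hy; linarith
  set d := R - ‖y - z‖ with hd
  set t := Ta ν y with ht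
  have t0 : 0 < t := by
    rcases (Ta_nonneg ν y).lt_or_eq with h' | h'
    · exact h'
    · rw [← ht] at h'; rw [← h'] at h2; norm_num at h2
  have hr : 0 < t⁻¹ := inv_pos.2 t0
  have hdt : 2 * t⁻¹ ≤ d := by
    rw [← div_eq_mul_inv, div_le_iff₀ t0]; exact h2
  have b1 : ∀ x : E n, ‖x‖ ≤ 1 → T2 (Tm (SL.sc ν y t⁻¹) x) ≤ 4 := by
    intro x hx
    rw [h.T2_sc y hr.ne', ← Ta_sq]
    have n1 : ‖y + t⁻¹ • x - z‖ ≤ ‖y - z‖ + t⁻¹ := by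
      have : y + t⁻¹ • x - z = (y - z) + t⁻¹ • x := by abel
      rw [this]
      refine (norm_add_le _ _).trans ?_
      rw [norm_smul, Real.norm_of_nonneg hr.le]
      have := mul_le_of_le_one_right hr.le hx
      linarith
    have m := hmax' (y + t⁻¹ • x) (by linarith)
    have p := Ta_nonneg ν (y + t⁻¹ • x)
    set q := Ta ν (y + t⁻¹ • x)
    have m2 : d/2 * q ≤ d * t := le_trans (mul_le_mul_of_nonneg_right (by linarith) p) m
    have dp : 0 < d := by linarith
    have m3 : q ≤ 2 * t := by
      by_contra hh
      push Not at hh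
      nlinarith
    have m4 : t⁻¹ * q ≤ 2 := by
      rw [inv_mul_le_iff₀ t0]; linarith
    have m5 : 0 ≤ t⁻¹ * q := by positivity
    rw [← mul_pow]
    nlinarith
  have hS := h.sc y hr.ne'
  have mv := mean_value hS (sc_zero ν y _) hS.T2_sm (fun x => T2_nonneg _) (lam := 4 * C) (by positivity) (fun x hx => by
    refine le_trans ?_ (HC _ hS x)
    have := b1 x hx
    have := T2_nonneg (Tm (SL.sc ν y t⁻¹) x)
    nlinarith [mul_nonneg hC.le (mul_nonneg this (sub_nonneg.2 (b1 x hx)))])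
  have i1 := If_le hS hS.T2_sm.cont (fun x => T2_nonneg _)
  have i2 := H y t⁻¹ hr
  have e0 : T2 (Tm (SL.sc ν y t⁻¹) 0) = 1 := by
    rw [h.T2_sc y hr.ne', smul_zero, add_zero, ← Ta_sq, ← ht]
    field_simp
  rw [e0, one_mul] at mv
  have i3 : Th0 n ≤ Real.exp (4*C/16) * (KK n * (Th0 n / (2 * (Real.exp (4*C/16) * KK n)))) := by
    refine mv.trans (mul_le_mul_of_nonneg_left (i1.trans (mul_le_mul_of_nonneg_left i2 hK.le)) (Real.exp_pos _).le)
  have i4 : Real.exp (4*C/16) * (KK n * (Th0 n / (2 * (Real.exp (4*C/16) * KK n)))) = Th0 n / 2 := by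
    have := (Real.exp_pos (4*C/16)).ne'
    field_simp
  linarith

theorem Sol.int_sc {ν : Fin n → E n → ℝ} (h : Sol ν) {r : ℝ} (hr : 0 < r) :
    ∫ x in Bn n, T2 (Tm (SL.sc ν 0 r) x) = r^2 * ((r^n)⁻¹ * ∫ x in Metric.closedBall 0 r, T2 (Tm ν x)) := by
  simp only [h.T2_sc 0 hr.ne', zero_add]
  rw [integral_const_mul, Measure.setIntegral_comp_smul_of_pos volume (fun x => T2 (Tm ν x)) _ hr]
  congr 2
  · simp
  · unfold Bn
    rw [_root_.smul_closedBall _ _ zero_le_one, smul_zero, Real.norm_of_nonneg hr.le, mul_one]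

theorem propP' (n : ℕ) : ∀ ε, 0 < ε → ∃ δ, 0 < δ ∧ ∃ η, 0 < η ∧ ∀ ν : Fin n → E n → ℝ, Sol ν → (∀ i, ν i 0 = 0) → (∀ x, SpecBd (√3 + δ) (Pm ν x)) →
    Wf ν ≤ η → ∫ x in Bn n, T2 (Tm (SL.sc ν 0 (rho n)) x) ≤ ε := by
  intro ε hε
  have hr := rho_pos n
  obtain ⟨δ, hδ, η, hη, H⟩ := propP n (ε / (rho n^2 * (rho n^n)⁻¹)) (by positivity)
  refine ⟨δ, hδ, η, hη, fun ν h h0 hb hW => ?_⟩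
  rw [h.int_sc hr, ← mul_assoc]
  have := H ν h h0 hb hW
  rwa [le_div_iff₀ (by positivity), mul_comm] at this

theorem Sol.sc_bd {ν : Fin n → E n → ℝ} (h : Sol ν) {c : ℝ} (hb : ∀ x, SpecBd c (Pm ν x)) (x0 : E n) {r : ℝ} (hr : r ≠ 0) (x : E n) :
    SpecBd c (Pm (SL.sc ν x0 r) x) := by rw [h.sc_P x0 hr]; exact hb _

theorem rigid (n : ℕ) : ∃ δ, 0 < δ ∧ ∀ ν : Fin n → E n → ℝ, Sol ν → (∀ x, SpecBd (√3 + δ) (Pm ν x)) → ∀ x, Tm ν x = 0 := by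
  obtain ⟨ε0, hε0, HCS⟩ := choiSchoen n
  obtain ⟨δ1, hδ1, η1, hη1, H1⟩ := propP' n ε0 hε0
  obtain ⟨C, hC, HW⟩ := Wf_le n
  obtain ⟨ε2, hε2, HQ⟩ := propQ n (ε := η1 / C) (by positivity)
  obtain ⟨δ2, hδ2, η2, hη2, H2⟩ := propP' n ε2 hε2
  refine ⟨min δ1 δ2, by positivity, fun ν h hb x => T2_eq_zero (HCS ν h ?_ x)⟩
  have hb1 : ∀ x, SpecBd (√3 + δ1) (Pm ν x) := fun x => (hb x).mono (by linarith [min_le_left δ1 δ2])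
  have hb2 : ∀ x, SpecBd (√3 + δ2) (Pm ν x) := fun x => (hb x).mono (by linarith [min_le_right δ1 δ2])
  have hρ := rho_pos n
  -- Claim A
  have A : ∀ x0 r, 0 < r → Th (SL.sc ν x0 r) 1 ≤ Th0 n + η1 / C := by
    intro x0 r hr
    have hm := h.sc x0 one_ne_zero
    have hm0 := sc_zero ν x0 1
    set μ := SL.sc ν x0 1 with hμ
    have e1 : SL.sc ν x0 r = SL.sc μ 0 r := by rw [hμ, sc_sc, smul_zero, add_zero, one_mul]
    rw [e1, Th_sc hm hm0 hr one_pos, mul_one]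
    have mono : Monotone fun k : ℕ => Th μ (2^k) := by
      refine monotone_nat_of_le_succ fun k => Th_mono hm (by simp) (by simp) ?_
      exact pow_le_pow_right₀ (by norm_num) (Nat.le_succ k)
    have bdd : BddAbove (Set.range fun k : ℕ => Th μ (2^k)) := ⟨KK n * 2^n, by
      rintro _ ⟨k, rfl⟩; exact Th_le hm (by positivity)⟩
    have lim := tendsto_atTop_ciSup mono bdd
    have lim2 := (lim.comp (tendsto_add_atTop_nat 1)).sub lim
    rw [sub_self] at lim2
    have ev := lim2.eventually (gt_mem_nhds (show 0 < η2 / C by positivity))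
    have ev2 : ∀ᶠ k : ℕ in atTop, r / rho n ≤ 2^k :=
      (tendsto_pow_atTop_atTop_of_one_lt (by norm_num : (1:ℝ) < 2)).eventually_ge_atTop _
    obtain ⟨k, hk1, hk2⟩ := (ev.and ev2).exists
    simp only [Function.comp] at hk1
    have p2 : (0:ℝ) < 2^k := by positivity
    have hk := hm.sc 0 p2.ne'
    have w : Wf (SL.sc μ 0 (2^k)) ≤ η2 := by
      refine (HW _ hk).trans ?_
      rw [Th_sc hm hm0 p2 two_pos, Th_sc hm hm0 p2 one_pos, mul_one, ← pow_succ]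
      rw [lt_div_iff₀ hC, mul_comm] at hk1
      exact hk1.le
    have q := H2 _ hk (sc_zero μ 0 _) (hm.sc_bd (h.sc_bd hb2 x0 one_ne_zero) 0 p2.ne') w
    have q2 := HQ _ (hk.sc 0 hρ.ne') (sc_zero _ 0 _) q
    rw [Th_sc hk (sc_zero μ 0 _) hρ one_pos, mul_one, Th_sc hm hm0 p2 hρ] at q2
    refine le_trans (Th_mono hm hr (by simp; positivity) ?_) q2
    rwa [div_le_iff₀ hρ] at hk2
  intro x0 r hr
  have rp : 0 < r / rho n := by positivity
  have hS := h.sc x0 rp.ne'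
  have e2 : Th (SL.sc ν x0 (r/rho n)) 2 = Th (SL.sc ν x0 (r / rho n * 2)) 1 := by
    have := Th_sc hS (sc_zero ν x0 _) two_pos one_pos
    rw [mul_one, sc_sc, smul_zero, add_zero] at this
    exact this.symm
  have w : Wf (SL.sc ν x0 (r / rho n)) ≤ η1 := by
    refine (HW _ hS).trans ?_
    have a := A x0 (r / rho n * 2) (by positivity)
    have b := Th0_le hS (sc_zero ν x0 _)
    rw [e2]
    calc C * _ ≤ C * (η1 / C) := mul_le_mul_of_nonneg_left (by linarith) hC.le
      _ = η1 := by field_simp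
  have f := H1 _ hS (sc_zero ν x0 _) (h.sc_bd hb1 x0 rp.ne') w
  rw [sc_sc, smul_zero, add_zero, div_mul_cancel₀ _ hρ.ne'] at f
  exact f
end SL
end

section
set_option autoImplicit false
set_option linter.unusedVariables false
set_option linter.unusedSimpArgs false
namespace SL
open Matrix MeasureTheory Filter Topology
open scoped ContDiff
variable {n : ℕ}

noncomputable def mvL (A : Mt n) : E n →L[ℝ] E n := (Matrix.mulVecLin A).toContinuousLinearMap

theorem mvL_apply (A : Mt n) (v : E n) : mvL A v = A *ᵥ v := rfl

theorem hasFDeriv_vec {G : Fin n → E n → ℝ} (hG : ∀ i, Sm (G i)) (x : E n) :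
    HasFDerivAt (fun y => (fun i => G i y : E n)) (mvL (Pm G x)) x := by
  rw [hasFDerivAt_pi']
  intro i
  have h1 := ((hG i).diff x).hasFDerivAt
  have e : (ContinuousLinearMap.proj i).comp (mvL (Pm G x)) = fderiv ℝ (G i) x := by
    refine ContinuousLinearMap.ext fun v => ?_
    rw [fderiv_eq_sum]
    rfl
  rw [e]; exact h1

theorem mono_G {G : Fin n → E n → ℝ} (hG : ∀ i, Sm (G i)) {m : ℝ}
    (hm : ∀ x w, m * (w ⬝ᵥ w) ≤ w ⬝ᵥ (Pm G x *ᵥ w)) (x y : E n) :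
    m * ((x - y) ⬝ᵥ (x - y)) ≤ (x - y) ⬝ᵥ ((fun i => G i x) - fun i => G i y) := by
  set w := x - y with hw
  have hd : ∀ t : ℝ, HasDerivAt (fun t : ℝ => w ⬝ᵥ fun i => G i (y + t • w)) (w ⬝ᵥ (Pm G (y + t • w) *ᵥ w)) t := by
    intro t
    have hl : HasDerivAt (fun t : ℝ => y + t • w) w t := by
      simpa using ((hasDerivAt_id t).smul_const w).const_add y
    have h1 := (hasFDeriv_vec hG (y + t • w)).comp_hasDerivAt t hl
    rw [mvL_apply] at h1
    have h2 := hasDerivAt_pi.1 h1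
    unfold dotProduct
    refine HasDerivAt.fun_sum fun i _ => (h2 i).const_mul (w i)
  obtain ⟨t, ht, e⟩ := exists_hasDerivAt_eq_slope _ _ zero_lt_one (fun t _ => (hd t).continuousAt.continuousWithinAt) (fun t _ => hd t)
  have e1 : y + (1:ℝ) • w = x := by rw [hw]; simp
  have e0 : y + (0:ℝ) • w = y := by simp
  rw [e1, e0, sub_zero, div_one] at e
  have e3 : w ⬝ᵥ ((fun i => G i x) - fun i => G i y) = w ⬝ᵥ (Pm G (y + t • w) *ᵥ w) := by
    rw [dotProduct_sub]; exact e.symm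
  rw [e3]
  exact hm _ _

theorem abs_dot_le (v w : E n) : |v ⬝ᵥ w| ≤ n * (‖v‖ * ‖w‖) :=
  abs_sum_le fun i => abs_mul_le' (norm_le_pi_norm v i) (norm_le_pi_norm w i)

theorem norm_sq_le_dot (v : E n) : ‖v‖^2 ≤ v ⬝ᵥ v := by
  have : ‖v‖ ≤ √(v ⬝ᵥ v) := by
    refine (pi_norm_le_iff_of_nonneg (Real.sqrt_nonneg _)).2 fun i => ?_
    rw [Real.norm_eq_abs, ← Real.sqrt_sq_eq_abs]
    apply Real.sqrt_le_sqrt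
    rw [pow_two]
    exact Finset.single_le_sum (f := fun i => v i * v i) (fun _ _ => mul_self_nonneg _) (Finset.mem_univ i)
  calc ‖v‖^2 ≤ √(v ⬝ᵥ v)^2 := by gcongr
    _ = _ := Real.sq_sqrt (dot_nonneg _)

theorem diffeo {G : Fin n → E n → ℝ} (hG : ∀ i, Sm (G i)) {m : ℝ} (m0 : 0 < m)
    (hm : ∀ x w, m * (w ⬝ᵥ w) ≤ w ⬝ᵥ (Pm G x *ᵥ w)) :
    ∃ Ψ : E n → E n, (∀ i, Sm fun z => Ψ z i) ∧ (∀ x, Ψ (fun i => G i x) = x) ∧ ∀ z, (fun i => G i (Ψ z)) = z := by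
  set Φ : E n → E n := fun x i => G i x with hΦ
  have cd : ContDiff ℝ ∞ Φ := contDiff_pi.2 hG
  have anti : AntilipschitzWith (Real.toNNReal (n / m)) Φ := by
    refine AntilipschitzWith.of_le_mul_dist fun x y => ?_
    rw [Real.coe_toNNReal _ (by positivity), dist_eq_norm, dist_eq_norm]
    have h1 := mono_G hG hm x y
    have h2 := (le_abs_self _).trans (abs_dot_le (x - y) (Φ x - Φ y))
    have h3 := norm_sq_le_dot (x - y)
    have h4 : m * ‖x - y‖^2 ≤ n * (‖x - y‖ * ‖Φ x - Φ y‖) :=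
      (mul_le_mul_of_nonneg_left h3 m0.le).trans (h1.trans h2)
    rcases (norm_nonneg (x - y)).lt_or_eq with hp | hp
    · rw [div_mul_eq_mul_div, le_div_iff₀ m0]
      have : ‖x - y‖ * (‖x-y‖ * m) ≤ ‖x - y‖ * (n * ‖Φ x - Φ y‖) := by linarith
      exact le_of_mul_le_mul_left this hp
    · rw [← hp]; positivity
  have prop : IsProperMap Φ := by
    rw [isProperMap_iff_tendsto_cocompact]
    refine ⟨cd.continuous, ?_⟩
    rw [← Metric.cobounded_eq_cocompact]
    exact anti.tendsto_cobounded
  have inj : ∀ x, Function.Injective (mvL (Pm G x) : E n →ₗ[ℝ] E n) := by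
    intro x
    rw [← LinearMap.ker_eq_bot, LinearMap.ker_eq_bot']
    intro w hw
    have hw' : Pm G x *ᵥ w = 0 := hw
    have h1 := hm x w
    rw [hw', dotProduct_zero] at h1
    have h2 := norm_sq_le_dot w
    have h3 : ‖w‖^2 ≤ 0 := by
      have := nonpos_of_mul_nonpos_right h1 m0
      linarith
    have : ‖w‖ = 0 := by nlinarith [norm_nonneg w]
    exact norm_eq_zero.1 this
  set F : ∀ x, E n ≃L[ℝ] E n := fun x => (LinearEquiv.ofInjectiveEndo _ (inj x)).toContinuousLinearEquiv with hF
  have hFd : ∀ x, HasFDerivAt Φ (F x : E n →L[ℝ] E n) x := fun x => by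
    have := hasFDeriv_vec hG x
    have e : (F x : E n →L[ℝ] E n) = mvL (Pm G x) := by ext v; rfl
    rw [e]; exact this
  have opn : IsOpenMap Φ := isOpenMap_of_hasStrictFDerivAt_equiv (f' := F) fun x =>
    cd.contDiffAt.hasStrictFDerivAt' (hFd x) (by simp)
  have surj : Function.Surjective Φ := by
    have hc : IsClopen (Set.range Φ) := ⟨prop.isClosedMap.isClosed_range, opn.isOpen_range⟩
    exact Set.range_eq_univ.1 (hc.eq_univ (Set.range_nonempty _))
  let e : E n ≃ₜ E n := (Equiv.ofBijective Φ ⟨anti.injective, surj⟩).toHomeomorphOfContinuousClosed cd.continuous prop.isClosedMap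
  have he : ∀ x, e x = Φ x := fun x => rfl
  have sm : ContDiff ℝ ∞ e.symm := Homeomorph.contDiff_symm e (f₀' := F) hFd cd
  exact ⟨e.symm, fun i => contDiff_pi.1 sm i, fun x => e.symm_apply_apply x, fun z => e.apply_symm_apply z⟩
end SL
end

section
set_option autoImplicit false
set_option linter.unusedVariables false
set_option linter.unusedSimpArgs false
namespace SL
open Matrix MeasureTheory Filter Topology
open scoped ContDiff
variable {n : ℕ}

/-- complexified `1 + i p` -/
noncomputable def cM (p : Mt n) : Matrix (Fin n) (Fin n) ℂ := 1 + Complex.I • p.map Complex.ofReal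

theorem map_mul_c (A B : Mt n) : (A * B).map Complex.ofReal = A.map Complex.ofReal * B.map Complex.ofReal :=
  Matrix.map_mul (f := Complex.ofRealHom)

theorem map_one_c : (1 : Mt n).map Complex.ofReal = 1 := by
  rw [Matrix.map_one] <;> simp

theorem cM_det {p O : Mt n} {l : Fin n → ℝ} (h1 : O * Oᵀ = 1) (h2 : Oᵀ * O = 1) (hp : p = O * diagonal l * Oᵀ) :
    (cM p).det = ∏ i, (1 + Complex.I * l i) := by
  have e : cM p = O.map Complex.ofReal * diagonal (fun i => 1 + Complex.I * (l i : ℂ)) * Oᵀ.map Complex.ofReal := by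
    have e1 : diagonal (fun i => 1 + Complex.I * (l i : ℂ)) = 1 + Complex.I • (diagonal l).map Complex.ofReal := by
      ext i j
      by_cases h : i = j
      · subst h; simp
      · simp [h]
    rw [e1, mul_add, add_mul, mul_one, ← map_mul_c, h1, map_one_c]
    unfold cM
    rw [mul_smul_comm, smul_mul_assoc, ← map_mul_c, ← map_mul_c, ← hp]
  rw [e, det_mul, det_mul, det_diagonal, mul_right_comm, ← det_mul, ← map_mul_c, h1, map_one_c, det_one, one_mul]

theorem gM_det {p O : Mt n} {l : Fin n → ℝ} (h1 : O * Oᵀ = 1) (h2 : Oᵀ * O = 1) (hp : p = O * diagonal l * Oᵀ) :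
    (gM p).det = ∏ i, (1 + l i ^ 2) := by
  have e : gM p = O * diagonal (fun i => 1 + l i ^ 2) * Oᵀ := by
    have e1 : diagonal (fun i => 1 + l i ^ 2) = 1 + diagonal l * diagonal l := by
      rw [diagonal_mul_diagonal, ← diagonal_one, diagonal_add]
      congr 1; funext i; ring
    have e2 : p * p = O * (diagonal l * diagonal l) * Oᵀ := by
      calc p * p = O * diagonal l * (Oᵀ * O) * diagonal l * Oᵀ := by rw [hp]; simp only [mul_assoc]
        _ = _ := by rw [h2, mul_one]; simp only [mul_assoc]
    rw [e1, mul_add, add_mul, mul_one, h1, ← e2]; rfl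
  rw [e, det_mul, det_mul, det_diagonal, mul_right_comm, ← det_mul, h1, det_one, one_mul]

theorem norm_cM {p : Mt n} (hp : p.IsSymm) : ‖(cM p).det‖ = Vd p := by
  obtain ⟨O, l, h1, h2, h3⟩ := exists_diag hp
  unfold Vd
  rw [cM_det h1 h2 h3, gM_det h1 h2 h3, norm_prod, Real.sqrt_prod _ (fun i _ => by positivity)]
  refine Finset.prod_congr rfl fun i _ => ?_
  rw [Complex.norm_eq_sqrt_sq_add_sq]
  simp

noncomputable def rA (p : Mt n) : Mt n := (√3/2) • 1 + (1/2 : ℝ) • p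
noncomputable def rB (p : Mt n) : Mt n := (√3/2) • p - (1/2 : ℝ) • 1

theorem s3 : √3 * √3 = (3:ℝ) := Real.mul_self_sqrt (by norm_num)
theorem inv3 : 1/√3 = √3/3 := by
  have := s3
  have h : (0:ℝ) < √3 := Real.sqrt_pos.2 (by norm_num)
  field_simp; linarith

structure Pre (g : Fin n → E n → ℝ) (ε : ℝ) : Prop where
  sm : ∀ i, Sm (g i)
  sym : ∀ x, (Pm g x).IsSymm
  low : ∀ x w, -(1/√3 + ε) * (w ⬝ᵥ w) ≤ w ⬝ᵥ (Pm g x *ᵥ w)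
  phase : ∃ om : ℂ, ‖om‖ = 1 ∧ ∀ x, ∃ r : ℝ, 0 < r ∧ om * (cM (Pm g x)).det = r

theorem rA_mulVec (p : Mt n) (w : E n) : rA p *ᵥ w = (√3/2) • w + (1/2 : ℝ) • (p *ᵥ w) := by
  simp [rA, add_mulVec, smul_mulVec]
theorem rB_mulVec (p : Mt n) (w : E n) : rB p *ᵥ w = (√3/2) • (p *ᵥ w) - (1/2 : ℝ) • w := by
  simp [rB, sub_mulVec, smul_mulVec]

theorem rA_low {p : Mt n} {ε : ℝ} (e0 : 0 ≤ ε) (e1 : ε ≤ 1/2) {w : E n} (h : -(1/√3 + ε) * (w ⬝ᵥ w) ≤ w ⬝ᵥ (p *ᵥ w)) :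
    1/4 * (w ⬝ᵥ w) ≤ w ⬝ᵥ (rA p *ᵥ w) := by
  rw [rA_mulVec, dotProduct_add, dotProduct_smul, dotProduct_smul, smul_eq_mul, smul_eq_mul]
  rw [inv3] at h
  have h0 := dot_nonneg w
  have h3 : (3:ℝ)/2 ≤ √3 := Real.le_sqrt_of_sq_le (by norm_num)
  nlinarith [mul_nonneg h0 (sub_nonneg.2 h3), mul_nonneg h0 (sub_nonneg.2 e1)]

theorem rA_symm {p : Mt n} (hp : p.IsSymm) : (rA p).IsSymm := by
  unfold rA Matrix.IsSymm
  rw [transpose_add, transpose_smul, transpose_smul, hp.eq, transpose_one]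
theorem rB_symm {p : Mt n} (hp : p.IsSymm) : (rB p).IsSymm := by
  unfold rB Matrix.IsSymm
  rw [transpose_sub, transpose_smul, transpose_smul, hp.eq, transpose_one]
theorem rAB_comm (p : Mt n) : rA p * rB p = rB p * rA p := by
  unfold rA rB
  simp only [add_mul, mul_add, sub_mul, mul_sub, smul_mul_assoc, mul_smul_comm, one_mul, mul_one]
  module

theorem rA_det {p : Mt n} (hp : p.IsSymm) (h : ∀ w : E n, 1/4 * (w ⬝ᵥ w) ≤ w ⬝ᵥ (rA p *ᵥ w)) : 0 < (rA p).det := by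
  refine Matrix.PosDef.det_pos (Matrix.PosDef.of_dotProduct_mulVec_pos ?_ fun x hx => ?_)
  · unfold Matrix.IsHermitian; rw [Matrix.conjTranspose_eq_transpose_of_trivial]; exact rA_symm hp
  · have h1 := h x
    have h2 := norm_sq_le_dot x
    have h3 : 0 < ‖x‖ := norm_pos_iff.2 hx
    have : 0 < ‖x‖^2 := by positivity
    simp only [star_trivial]
    linarith

theorem rot_symm {p q : Mt n} (hp : p.IsSymm) (hd : 0 < (rA p).det) (h : q * rA p = rB p) : q.IsSymm := by
  have u : IsUnit (rA p) := (Matrix.isUnit_iff_isUnit_det _).2 hd.ne'.isUnit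
  have h1 : rA p * qᵀ = rB p := by
    have := congrArg Matrix.transpose h
    rwa [transpose_mul, (rA_symm hp).eq, (rB_symm hp).eq] at this
  have h2 : rA p * qᵀ * rA p = rA p * q * rA p := by rw [h1, mul_assoc, h, rAB_comm]
  exact u.mul_left_cancel (u.mul_right_cancel h2)

theorem rot_bd {p q : Mt n} {ε δ : ℝ} (hp : p.IsSymm) (hd : 0 < (rA p).det) (h : q * rA p = rB p) (d0 : 0 ≤ δ) (e0 : 0 ≤ ε) (e1 : ε ≤ 1/2)
    (ed : ε ≤ δ/8) (low : ∀ w, -(1/√3 + ε) * (w ⬝ᵥ w) ≤ w ⬝ᵥ (p *ᵥ w)) : SpecBd (√3 + δ) q := by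
  intro y
  have u : IsUnit (rA p).det := hd.ne'.isUnit
  obtain ⟨w, hw⟩ : ∃ w, rA p *ᵥ w = y := ⟨(rA p)⁻¹ *ᵥ y, by rw [mulVec_mulVec, mul_nonsing_inv _ u, one_mulVec]⟩
  have hq : q *ᵥ y = rB p *ᵥ w := by rw [← hw, mulVec_mulVec, h]
  have l := low w
  rw [inv3] at l
  have hN : 0 ≤ (p *ᵥ w + (√3/3 + ε) • w) ⬝ᵥ (p *ᵥ w + (√3/3 + ε) • w) := dot_nonneg _
  have hW := dot_nonneg w
  rw [hq, ← hw, rA_mulVec, rB_mulVec]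
  simp only [dotProduct_add, add_dotProduct, dotProduct_sub, dotProduct_smul, smul_dotProduct, smul_eq_mul] at hN ⊢
  rw [dotProduct_comm (p *ᵥ w) w] at hN ⊢
  set W := w ⬝ᵥ w
  set M := w ⬝ᵥ (p *ᵥ w)
  set N := (p *ᵥ w) ⬝ᵥ (p *ᵥ w)
  have s := s3
  have s32 : (3:ℝ)/2 ≤ √3 := Real.le_sqrt_of_sq_le (by norm_num)
  have s2 := sqrt3_lt
  have s2' : √3^2 = 3 := by rw [pow_two, s]
  set t := √3
  set mu := M + (t/3+ε) * W with hmu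
  have mu0 : 0 ≤ mu := by rw [hmu]; linarith
  have hM : M = mu - (t/3+ε) * W := by rw [hmu]; ring
  set nu := N + 2 * (t/3+ε) * M + (t/3+ε)^2 * W with hnu
  have nu0 : 0 ≤ nu := by rw [hnu]; nlinarith
  have hNn : N = nu - 2 * (t/3+ε) * M - (t/3+ε)^2 * W := by rw [hnu]; ring
  clear_value mu nu
  have yy : t/2 * (t/2 * W + 1/2 * M) + 1/2 * (t/2 * M + 1/2 * N) = 3/4 * W + t/2 * M + 1/4 * N := by
    linear_combination (W/4) * s2'
  have yq : t/2 * (t/2*M - 1/2*W) + 1/2 * (t/2 * N - 1/2 * M) = -(t/4) * W + 1/2 * M + t/4 * N := by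
    linear_combination (M/4) * s2'
  have up : t * (3/4 * W + t/2 * M + 1/4 * N) - (-(t/4) * W + 1/2 * M + t/4 * N) = t * W + M := by
    linear_combination (M/2) * s2'
  have yy0 : 0 ≤ 3/4 * W + t/2 * M + 1/4 * N := by
    rw [← yy]
    have := dot_nonneg (rA p *ᵥ w)
    rw [rA_mulVec] at this
    simp only [dotProduct_add, add_dotProduct, dotProduct_sub, dotProduct_smul, smul_dotProduct, smul_eq_mul] at this
    rw [dotProduct_comm (p *ᵥ w) w] at this
    linarith
  set a := t/3 - ε/2 with ha
  have a0 : 1/4 ≤ a := by rw [ha]; linarith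
  have al : 0 ≤ δ * a - t * ε := by nlinarith
  have dn : (t + δ) * (3/4 * W + t/2 * M + 1/4 * N) + (-(t/4) * W + 1/2 * M + t/4 * N) =
      a * (δ * a - t * ε) * W + (a * (δ/2+t) + (δ*a-t*ε)/2) * mu + (δ/2+t)/2 * nu := by
    rw [hNn, hM, ha]
    ring_nf
    have s3' : t^3 = 3 * t := by rw [pow_succ, s2']
    simp only [s2', s3']
    ring
  have dn0 : 0 ≤ a * (δ * a - t * ε) * W + (a * (δ/2+t) + (δ*a-t*ε)/2) * mu + (δ/2+t)/2 * nu := by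
    have : 0 ≤ t := by linarith
    have : 0 ≤ a := by linarith
    positivity
  have up0 : 0 ≤ t * W + M := by nlinarith
  have g1 := mul_nonneg d0 yy0
  have goal1 : |-(t/4) * W + 1/2 * M + t/4 * N| ≤ (t+δ) * (3/4 * W + t/2 * M + 1/4 * N) := by
    rw [abs_le]; constructor <;> linarith
  refine le_trans (le_of_eq ?_) (goal1.trans (le_of_eq ?_))
  · congr 1; linarith
  · congr 1; linarith

theorem rot_phase {p q : Mt n} (hp : p.IsSymm) (hd : 0 < (rA p).det) (h : q * rA p = rB p) {om : ℂ} (ho : ‖om‖ = 1) {r : ℝ} (hr : 0 < r)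
    (hph : om * (cM p).det = r) :
    om * (((√3/2 : ℝ) : ℂ) - ((1/2 : ℝ) : ℂ) * Complex.I)⁻¹ ^ n * (cM q).det = (Vd q : ℂ) := by
  set z : ℂ := ((√3/2 : ℝ) : ℂ) - ((1/2 : ℝ) : ℂ) * Complex.I with hz
  have nz : ‖z‖ = 1 := by
    have e : Complex.normSq z = 1 := by
      rw [hz, Complex.normSq_apply]
      simp
      linear_combination s3/4
    rw [Complex.normSq_eq_norm_sq] at e
    nlinarith [norm_nonneg z]
  have z0 : z ≠ 0 := by intro h0; rw [h0] at nz; simp at nz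
  have e1 : cM q * (rA p).map Complex.ofReal = z • cM p := by
    have e2 : cM q * (rA p).map Complex.ofReal = (rA p).map Complex.ofReal + Complex.I • (rB p).map Complex.ofReal := by
      rw [← h, map_mul_c]; unfold cM; rw [add_mul, one_mul, smul_mul_assoc]
    rw [e2, hz]
    ext i j
    have i2 := Complex.I_sq
    by_cases hij : i = j
    · subst hij
      simp [rA, rB, cM]
      linear_combination ((p i i:ℂ) / 2) * i2
    · simp [rA, rB, cM, hij]
      linear_combination ((p i j:ℂ) / 2) * i2
  have e3 := congrArg Matrix.det e1
  have e4 : ((rA p).map Complex.ofReal).det = ((rA p).det : ℂ) := (RingHom.map_det Complex.ofRealHom (rA p)).symm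
  rw [det_mul, e4, det_smul, Fintype.card_fin] at e3
  have dA : ((rA p).det : ℂ) ≠ 0 := by exact_mod_cast hd.ne'
  set w := om * z⁻¹ ^ n * (cM q).det with hw
  have e5 : w * ((rA p).det : ℂ) = (r : ℂ) := by
    rw [hw, mul_assoc, e3, ← hph]
    rw [inv_pow]
    field_simp
  have e6 : w = ((r / (rA p).det : ℝ) : ℂ) := by
    rw [Complex.ofReal_div, eq_div_iff dA, e5]
  have e7 : ‖w‖ = Vd q := by
    rw [hw, norm_mul, norm_mul, norm_pow, norm_inv, nz, ho, norm_cM (rot_symm hp hd h)]; simp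
  rw [e6, Complex.norm_real, Real.norm_of_nonneg (by positivity)] at e7
  rw [e6, e7]
end SL
end

section
set_option autoImplicit false
set_option linter.unusedVariables false
set_option linter.unusedSimpArgs false
namespace SL
open Matrix MeasureTheory Filter Topology
open scoped ContDiff
variable {n : ℕ}

theorem const_of_pd {f : E n → ℝ} (hf : Sm f) (h : ∀ k x, pd k f x = 0) (x y : E n) : f x = f y := by
  refine is_const_of_fderiv_eq_zero hf.diff (fun z => ?_) x y
  refine ContinuousLinearMap.ext fun v => ?_
  rw [fderiv_eq_sum]; simp [h]

theorem Pm_comp {f G : Fin n → E n → ℝ} (hf : ∀ i, Sm (f i)) (hG : ∀ i, Sm (G i)) (x : E n) :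
    Pm (fun i y => f i (fun k => G k y)) x = Pm f (fun k => G k x) * Pm G x := by
  ext i j
  have h1 := ((hf i).diff (fun k => G k x)).hasFDerivAt.comp x (hasFDeriv_vec hG x)
  have h2 : pd j (fun y => f i (fun k => G k y)) x = fderiv ℝ (f i) (fun k => G k x) (mvL (Pm G x) (Pi.single j 1)) := by
    unfold pd
    rw [show (fun y => f i (fun k => G k y)) = f i ∘ fun y k => G k y from rfl, h1.fderiv]; rfl
  change pd j (fun y => f i (fun k => G k y)) x = _
  rw [h2, fderiv_eq_sum, mvL_apply, Matrix.mul_apply]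
  refine Finset.sum_congr rfl fun k _ => ?_
  rw [Matrix.mulVec_single_one]; rfl

theorem rigid2 (n : ℕ) : ∃ ε, 0 < ε ∧ ∀ g : Fin n → E n → ℝ, Pre g ε → ∀ x y, Pm g x = Pm g y := by
  obtain ⟨δ0, hδ0, H⟩ := rigid n
  set δ := min δ0 (1/8) with hδ
  have d0 : 0 < δ := by positivity
  have d1 : δ ≤ 1/8 := min_le_right _ _
  have s74 : √3 < 7/4 := by rw [Real.sqrt_lt' (by norm_num)]; norm_num
  refine ⟨δ/8, by positivity, fun g hg => ?_⟩
  have lowA : ∀ x w, 1/4 * (w ⬝ᵥ w) ≤ w ⬝ᵥ (rA (Pm g x) *ᵥ w) := fun x w => rA_low (by positivity) (by linarith) (hg.low x w)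
  set G : Fin n → E n → ℝ := fun i x => √3/2 * x i + 1/2 * g i x with hG
  have sG : ∀ i, Sm (G i) := fun i => ((Sm.const _).mul (Sm.coord i)).add ((Sm.const _).mul (hg.sm i))
  have PG : ∀ x, Pm G x = rA (Pm g x) := by
    intro x; ext i j
    change pd j (fun x => √3/2 * x i + 1/2 * g i x) x = _
    rw [pd_add j (((Sm.const _).mul (Sm.coord i)).diff x) (((Sm.const _).mul (hg.sm i)).diff x),
      pd_mul j ((Sm.const _).diff x) ((Sm.coord i).diff x), pd_mul j ((Sm.const _).diff x) ((hg.sm i).diff x), pd_const, pd_const, pd_coord]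
    simp [rA, Matrix.one_apply, Pm]
  obtain ⟨Ψ, sΨ, Ψ1, Ψ2⟩ := diffeo sG (m := 1/4) (by norm_num) (fun x w => by rw [PG]; exact lowA x w)
  set ν : Fin n → E n → ℝ := fun i z => √3/2 * g i (Ψ z) - 1/2 * Ψ z i with hν
  have sgΨ : ∀ i, Sm fun z => g i (Ψ z) := fun i => ContDiff.comp (hg.sm i) (contDiff_pi.2 sΨ)
  have sν : ∀ i, Sm (ν i) := fun i => ((Sm.const _).mul (sgΨ i)).sub ((Sm.const _).mul (sΨ i))
  have key : ∀ x, Pm ν (fun k => G k x) * rA (Pm g x) = rB (Pm g x) := by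
    intro x
    rw [← PG, ← Pm_comp sν sG]
    ext i j
    change pd j (fun y => √3/2 * g i (Ψ (fun k => G k y)) - 1/2 * Ψ (fun k => G k y) i) x = _
    simp only [Ψ1]
    rw [pd_sub j (((Sm.const _).mul (hg.sm i)).diff x) (((Sm.const _).mul (Sm.coord i)).diff x),
      pd_mul j ((Sm.const _).diff x) ((Sm.coord i).diff x), pd_mul j ((Sm.const _).diff x) ((hg.sm i).diff x), pd_const, pd_const, pd_coord]
    simp [rB, Matrix.one_apply, Pm]
  have hdet : ∀ x, 0 < (rA (Pm g x)).det := fun x => rA_det (hg.sym x) (lowA x)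
  have key' : ∀ z, Pm ν z * rA (Pm g (Ψ z)) = rB (Pm g (Ψ z)) := fun z => by
    have := key (Ψ z); rwa [Ψ2] at this
  have bd : ∀ z, SpecBd (√3 + δ) (Pm ν z) := fun z =>
    rot_bd (hg.sym _) (hdet _) (key' z) d0.le (by positivity) (by linarith) le_rfl (hg.low _)
  obtain ⟨om, ho, hph⟩ := hg.phase
  have S : Sol ν := {
    sm := sν
    sym := fun z => rot_symm (hg.sym _) (hdet _) (key' z)
    bd := fun z => (bd z).mono (by linarith)
    phase := by
      refine ⟨om * ((((√3/2 : ℝ) : ℂ) - ((1/2 : ℝ) : ℂ) * Complex.I)⁻¹) ^ n, fun z => ?_⟩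
      obtain ⟨r, hr, e⟩ := hph (Ψ z)
      exact rot_phase (hg.sym _) (hdet _) (key' z) ho hr e }
  have T0 := H ν S (fun z => (bd z).mono (by linarith [min_le_left δ0 (1/8)]))
  have Pc : ∀ z z', Pm ν z = Pm ν z' := by
    intro z z'
    ext i j
    refine const_of_pd (f := fun z => Pm ν z i j) (S.smP i j) (fun k x => ?_) z z'
    have := congrFun (congrFun (congrFun (T0 x) k) i) j
    exact this
  have inv : ∀ x, ((√3/2) • (1 : Mt n) - (1/2 : ℝ) • Pm ν 0) * rA (Pm g x) = 1 := by
    intro x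
    rw [sub_mul, smul_mul_assoc, smul_mul_assoc, one_mul, Pc 0 (fun k => G k x), key x]
    unfold rA rB
    have e : (√3/2) * (√3/2) + (1/2:ℝ) * (1/2) = 1 := by linear_combination s3/4
    rw [smul_add, smul_sub, smul_smul, smul_smul, smul_smul, smul_smul, mul_comm (√3/2) (1/2:ℝ), show ∀ X Y Z : Mt n, X + Y - (Y - Z) = X + Z from fun X Y Z => by abel, ← add_smul, e, one_smul]
  intro x y
  have h1 := inv x
  have h2 := inv y
  have h3 := mul_eq_one_comm.1 h1
  have h4 : rA (Pm g x) = rA (Pm g y) := left_inv_eq_right_inv h3 h2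
  unfold rA at h4
  exact smul_right_injective _ (by norm_num : (1/2:ℝ) ≠ 0) (add_left_cancel h4)

theorem quad_of_const {v : E n → ℝ} (hv : Sm v) {A : Mt n} (hA : A.IsSymm) (h : ∀ x i j, pd j (pd i v) x = A i j) :
    ∃ (b : Fin n → ℝ) (c : ℝ), ∀ x, v x = (1/2) * ∑ i, ∑ j, A i j * x i * x j + ∑ i, b i * x i + c := by
  have sl : ∀ i, Sm fun x : E n => ∑ j, A i j * x j := fun i => Sm.sum fun j => (Sm.const _).mul (Sm.coord j)
  have pl : ∀ (a : Fin n → ℝ) k (x : E n), pd k (fun x => ∑ j, a j * x j) x = a k := by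
    intro a k x
    rw [pd_sum k fun j => ((Sm.const (a j)).mul (Sm.coord j)).diff x]
    simp only [pd_mul k ((Sm.const _).diff x) ((Sm.coord _).diff x), pd_const, pd_coord]
    simp
  have h1 : ∀ i x, pd i v x - ∑ j, A i j * x j = pd i v 0 := by
    intro i x
    have := const_of_pd (f := fun x => pd i v x - ∑ j, A i j * x j) ((hv.pd i).sub (sl i)) (fun k y => by
      rw [pd_sub k ((hv.pd i).diff y) ((sl i).diff y), h, pl, sub_self]) x 0
    simpa using this
  refine ⟨fun i => pd i v 0, v 0, fun x => ?_⟩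
  have sq : ∀ i, Sm fun x : E n => x i * ∑ j, A i j * x j := fun i => (Sm.coord i).mul (sl i)
  have sQ : Sm fun x : E n => (1/2) * ∑ i, x i * ∑ j, A i j * x j := (Sm.const _).mul (Sm.sum sq)
  have sb : Sm fun x : E n => ∑ i, pd i v 0 * x i := Sm.sum fun i => (Sm.const _).mul (Sm.coord i)
  have pQ : ∀ k (y : E n), pd k (fun x : E n => (1/2) * ∑ i, x i * ∑ j, A i j * x j) y = ∑ j, A k j * y j := by
    intro k y
    rw [pd_mul k ((Sm.const _).diff y) ((Sm.sum sq).diff y), pd_const, pd_sum k fun i => (sq i).diff y]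
    simp only [pd_mul k ((Sm.coord _).diff y) ((sl _).diff y), pl, pd_coord]
    rw [Finset.sum_add_distrib]
    have e : ∑ i, y i * A i k = ∑ j, A k j * y j := Finset.sum_congr rfl fun i _ => by rw [hA.apply k i]; ring
    rw [e]
    simp
    ring
  have := const_of_pd (f := fun x => v x - (1/2) * (∑ i, x i * ∑ j, A i j * x j) - ∑ i, pd i v 0 * x i) ((hv.sub sQ).sub sb) (fun k y => by
    rw [pd_sub k ((hv.sub sQ).diff y) (sb.diff y), pd_sub k (hv.diff y) (sQ.diff y), pQ, pl, h1, sub_self]) x 0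
  have e : ∑ i, x i * ∑ j, A i j * x j = ∑ i, ∑ j, A i j * x i * x j :=
    Finset.sum_congr rfl fun i _ => by rw [Finset.mul_sum]; exact Finset.sum_congr rfl fun j _ => by ring
  rw [e] at this
  simp at this
  linarith

theorem low_of_eig {p : Mt n} (hH : p.IsHermitian) {K : ℝ} (h : ∀ i, K ≤ hH.eigenvalues i) (w : E n) :
    K * (w ⬝ᵥ w) ≤ w ⬝ᵥ (p *ᵥ w) := by
  set O : Mt n := hH.eigenvectorUnitary.1 with hO
  have h1 : O * Oᵀ = 1 := by
    have := Unitary.coe_mul_star_self hH.eigenvectorUnitary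
    rwa [Unitary.coe_star, Matrix.star_eq_conjTranspose, Matrix.conjTranspose_eq_transpose_of_trivial] at this
  have h3 : p = O * diagonal hH.eigenvalues * Oᵀ := by
    have := hH.spectral_theorem
    rw [Unitary.conjStarAlgAut_apply, Matrix.star_eq_conjTranspose,
      Matrix.conjTranspose_eq_transpose_of_trivial] at this
    exact this
  have e1 : w ⬝ᵥ w = (Oᵀ *ᵥ w) ⬝ᵥ (Oᵀ *ᵥ w) := by
    rw [dotProduct_mulVec, vecMul_transpose, mulVec_mulVec, h1, one_mulVec]
  have e2 : w ⬝ᵥ (p *ᵥ w) = (Oᵀ *ᵥ w) ⬝ᵥ (diagonal hH.eigenvalues *ᵥ (Oᵀ *ᵥ w)) := by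
    conv_lhs => rw [h3]
    rw [← mulVec_mulVec, ← mulVec_mulVec, dotProduct_mulVec, mulVec_transpose]
  rw [e1, e2]
  unfold dotProduct
  rw [Finset.mul_sum]
  refine Finset.sum_le_sum fun i _ => ?_
  rw [mulVec_diagonal]
  have := mul_le_mul_of_nonneg_right (h i) (mul_self_nonneg ((Oᵀ *ᵥ w) i))
  linarith

theorem det_of_eig {p : Mt n} (hH : p.IsHermitian) : (cM p).det = ∏ i, (1 + Complex.I * hH.eigenvalues i) := by
  refine cM_det (O := hH.eigenvectorUnitary) ?_ ?_ ?_
  · have := Unitary.coe_mul_star_self hH.eigenvectorUnitary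
    rwa [Unitary.coe_star, Matrix.star_eq_conjTranspose, Matrix.conjTranspose_eq_transpose_of_trivial] at this
  · have := Unitary.coe_star_mul_self hH.eigenvectorUnitary
    rwa [Matrix.star_eq_conjTranspose, Matrix.conjTranspose_eq_transpose_of_trivial] at this
  · have := hH.spectral_theorem
    rw [Unitary.conjStarAlgAut_apply, Matrix.star_eq_conjTranspose,
      Matrix.conjTranspose_eq_transpose_of_trivial] at this
    exact this

theorem one_add_I (l : ℝ) : (1 + Complex.I * l : ℂ) = (√(1 + l^2) : ℝ) * Complex.exp ((Real.arctan l : ℝ) * Complex.I) := by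
  rw [Complex.exp_mul_I, ← Complex.ofReal_cos, ← Complex.ofReal_sin, Real.cos_arctan, Real.sin_arctan]
  have h : (√(1 + l^2) : ℝ) ≠ 0 := (Real.sqrt_pos.2 (by positivity)).ne'
  have h' : ((√(1 + l^2) : ℝ) : ℂ) ≠ 0 := by exact_mod_cast h
  push_cast
  field_simp

theorem phase_of_eig {l : Fin n → ℝ} {c : ℝ} (h : ∑ i, Real.arctan (l i) = c) :
    ∃ r : ℝ, 0 < r ∧ Complex.exp ((-c : ℝ) * Complex.I) * ∏ i, (1 + Complex.I * (l i : ℂ)) = r := by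
  refine ⟨∏ i, √(1 + l i^2), Finset.prod_pos fun i _ => Real.sqrt_pos.2 (by positivity), ?_⟩
  simp only [one_add_I]
  rw [Finset.prod_mul_distrib, ← Complex.exp_sum, ← Finset.sum_mul, ← Complex.ofReal_sum, h, mul_left_comm, ← Complex.exp_add]
  simp
end SL
end

section
set_option autoImplicit false
set_option linter.unusedVariables false
set_option linter.unusedSimpArgs false
namespace SL
open Matrix MeasureTheory Filter Topology
open scoped ContDiff
variable {n : ℕ}

theorem pd_toLp {u : EuclideanSpace ℝ (Fin n) → ℝ} (hu : Differentiable ℝ u) (y : E n) (i : Fin n) :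
    pd i (fun y : E n => u (WithLp.toLp 2 y)) y = fderiv ℝ u (WithLp.toLp 2 y) (EuclideanSpace.single i 1) := by
  have h := (hu (WithLp.toLp 2 y)).hasFDerivAt.comp y ((EuclideanSpace.equiv (Fin n) ℝ).symm.hasFDerivAt (x := y))
  unfold pd
  rw [show (fun y : E n => u (WithLp.toLp 2 y)) = u ∘ WithLp.toLp 2 from rfl, h.fderiv]
  rfl

theorem pd_pd_eq {u : EuclideanSpace ℝ (Fin n) → ℝ} (hu : ContDiff ℝ (⊤ : ℕ∞) u) (y : E n) (i j : Fin n) :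
    pd i (pd j (fun y : E n => u (WithLp.toLp 2 y))) y =
      iteratedFDeriv ℝ 2 u (WithLp.toLp 2 y) ![EuclideanSpace.single i 1, EuclideanSpace.single j 1] := by
  have hd : Differentiable ℝ u := hu.differentiable (by simp)
  have h1 : ContDiff ℝ 1 (fderiv ℝ u) := hu.fderiv_right (by rw [one_add_one_eq_two]; exact WithTop.coe_le_coe.2 le_top)
  have hd1 : Differentiable ℝ (fderiv ℝ u) := h1.differentiable (by simp)
  have e : pd j (fun y : E n => u (WithLp.toLp 2 y)) =
      fun y => (fun z => fderiv ℝ u z (EuclideanSpace.single j 1)) (WithLp.toLp 2 y) := by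
    funext z; exact pd_toLp hd z j
  rw [e, pd_toLp (hd1.clm_apply (differentiable_const _)), iteratedFDeriv_two_apply,
    fderiv_clm_apply (hd1 _) (differentiableAt_const _)]
  simp

end SL
end

/-- For `n ≥ 4` there is `ε(n) > 0` such that any entire solution with
`λᵢ ≥ −1/√3 − ε(n)` is a quadratic polynomial. -/
theorem stmt_18 {n : ℕ} (hn : 4 ≤ n) :
    ∃ ε : ℝ, 0 < ε ∧
      ∀ (c : ℝ) (u : EuclideanSpace ℝ (Fin n) → ℝ),
        ContDiff ℝ (⊤ : ℕ∞) u →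
        ∀ hsym : ∀ x : EuclideanSpace ℝ (Fin n), (Hess u x).IsHermitian,
        (∀ x, ∑ i, Real.arctan ((hsym x).eigenvalues i) = c) →
        (∀ x, ∀ i : Fin n, -1 / Real.sqrt 3 - ε ≤ (hsym x).eigenvalues i) →
        ∃ (A : Matrix (Fin n) (Fin n) ℝ) (b : Fin n → ℝ) (c₀ : ℝ), A.IsSymm ∧
          ∀ x : EuclideanSpace ℝ (Fin n),
            u x = (1 / 2) * ∑ i, ∑ j, A i j * x i * x j + ∑ i, b i * x i + c₀ := by
  obtain ⟨ε, hε, H⟩ := SL.rigid2 n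
  refine ⟨ε, hε, fun c u hu hsym hc hl => ?_⟩
  have sv : SL.Sm fun y : SL.E n => u (WithLp.toLp 2 y) :=
    hu.comp (EuclideanSpace.equiv (Fin n) ℝ).symm.contDiff
  set v : SL.E n → ℝ := fun y => u (WithLp.toLp 2 y) with hv
  have sg : ∀ i, SL.Sm (SL.pd i v) := fun i => sv.pd i
  have hP : ∀ y, SL.Pm (fun i => SL.pd i v) y = Hess u (WithLp.toLp 2 y) := by
    intro y
    ext i j
    change SL.pd j (SL.pd i v) y = _
    rw [SL.pd_comm sv]
    exact SL.pd_pd_eq hu y i j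
  have pre : SL.Pre (fun i => SL.pd i v) ε := {
    sm := sg
    sym := fun y => by
      rw [hP]
      have := hsym (WithLp.toLp 2 y)
      rwa [Matrix.IsHermitian, Matrix.conjTranspose_eq_transpose_of_trivial] at this
    low := fun y w => by
      rw [hP]
      refine SL.low_of_eig (hsym (WithLp.toLp 2 y)) (fun i => ?_) w
      have := hl (WithLp.toLp 2 y) i
      have e : -(1 / √3 + ε) = -1 / √3 - ε := by ring
      rw [e]; exact this
    phase := ⟨Complex.exp ((-c : ℝ) * Complex.I), Complex.norm_exp_ofReal_mul_I _, fun y => by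
      rw [hP, SL.det_of_eig (hsym (WithLp.toLp 2 y))]
      exact SL.phase_of_eig (hc _)⟩ }
  have hA := pre.sym 0
  obtain ⟨b, c₀, hq⟩ := SL.quad_of_const sv hA (fun x i j => by
    have := congrFun (congrFun (H _ pre x 0) i) j
    exact this)
  exact ⟨_, b, c₀, hA, fun x => hq x.ofLp⟩
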